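/- Let p, q : Fin n → EuclideanSpace ℝ (Fin d) be injective families whose values are exactly the extreme points of P := convexHull ℝ (Set.range p) and Q := convexHull ℝ (Set.range q) respectively, and assume P and Q are combinatorially equivalent with compatible labelling. If 0 ∈ interior Q, ‖q i − q j‖ = ‖p i − p j‖ for every edge (i,j) of P, and ‖q i‖ = ‖p i‖ for all i, then there exists a linear isometry equivalence T : EuclideanSpace ℝ (Fin d) ≃ₗᵢ EuclideanSpace ℝ (Fin d) with T (p i) = q i for all i. (A polytope with the origin in its interior is uniquely determined by its face-lattice, its edge lengths and its vertex-origin distances.) -/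

import Mathlib

/-- For `i ≠ j`, the pair `(i,j)` is an edge of the polytope `convexHull ℝ (Set.range p)`
if the closed segment between `p i` and `p j` is an extreme subset of it. -/
def IsEdge {n d : ℕ} (p : Fin n → EuclideanSpace ℝ (Fin d)) (i j : Fin n) : Prop :=
  i ≠ j ∧ IsExtreme ℝ (convexHull ℝ (Set.range p)) (segment ℝ (p i) (p j))

/-- Two polytopes with labelled vertices are combinatorially equivalent with compatible
labelling if for every `S ⊆ Fin n`, `convexHull ℝ (p '' S)` is an extreme subset of the
first polytope exactly when `convexHull ℝ (q '' S)` is an extreme subset of the second. -/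
def CombEquiv {n d : ℕ} (p q : Fin n → EuclideanSpace ℝ (Fin d)) : Prop :=
  ∀ S : Set (Fin n),
    IsExtreme ℝ (convexHull ℝ (Set.range p)) (convexHull ℝ (p '' S)) ↔
    IsExtreme ℝ (convexHull ℝ (Set.range q)) (convexHull ℝ (q '' S))


open MeasureTheory Set Filter Topology in
theorem det_interp {d : ℕ} (v : ℕ → ℝ) (hv : Set.InjOn v (Finset.range (d+1))) (A : Matrix (Fin d) (Fin d) ℝ) (t : ℝ) :
    (1 + t • A).det = ∑ k ∈ Finset.range (d+1),
      (1 + v k • A).det * (Lagrange.basis (Finset.range (d+1)) v k).eval t := by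
  set f : Polynomial ℝ := Matrix.det ((Polynomial.X : Polynomial ℝ) • A.map Polynomial.C + (1 : Matrix (Fin d) (Fin d) ℝ).map Polynomial.C) with hf
  have heval : ∀ s : ℝ, f.eval s = (1 + s • A).det := by
    intro s
    rw [hf, ← Polynomial.coe_evalRingHom, RingHom.map_det]
    congr 1
    ext i j
    by_cases h : i = j <;> simp [h] <;> ring
  have hdeg : f.degree < (Finset.range (d+1)).card := by
    refine lt_of_le_of_lt Polynomial.degree_le_natDegree ?_
    have := Polynomial.natDegree_det_X_add_C_le A (1 : Matrix (Fin d) (Fin d) ℝ)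
    simp only [Fintype.card_fin] at this
    rw [Finset.card_range]
    exact_mod_cast Nat.lt_succ_of_le this
  have h := congrArg (Polynomial.eval t) (Lagrange.eq_interpolate hv hdeg)
  rw [heval, Lagrange.interpolate_apply, Polynomial.eval_finsetSum] at h
  rw [h]
  refine Finset.sum_congr rfl fun k _ => ?_
  simp [heval]

open MeasureTheory Set Filter Topology in
theorem det_interp_clm {E : Type*} [NormedAddCommGroup E] [InnerProductSpace ℝ E]
    [FiniteDimensional ℝ E] (v : ℕ → ℝ)
    (hv : Set.InjOn v (Finset.range (Module.finrank ℝ E+1))) (A : E →L[ℝ] E) (t : ℝ) :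
    (ContinuousLinearMap.id ℝ E + t • A).det = ∑ k ∈ Finset.range (Module.finrank ℝ E+1),
      (ContinuousLinearMap.id ℝ E + v k • A).det * (Lagrange.basis (Finset.range (Module.finrank ℝ E+1)) v k).eval t := by
  have key : ∀ s : ℝ, (ContinuousLinearMap.id ℝ E + s • A).det =
      (1 + s • LinearMap.toMatrix (Module.finBasis ℝ E) (Module.finBasis ℝ E) (A : E →ₗ[ℝ] E)).det := by
    intro s
    rw [ContinuousLinearMap.det, ← LinearMap.det_toMatrix (Module.finBasis ℝ E)]
    congr 1
    simp
  rw [key, det_interp v hv]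
  simp_rw [key]

open MeasureTheory Set Filter Topology in
theorem no_retraction {E : Type*} [NormedAddCommGroup E] [InnerProductSpace ℝ E]
    [FiniteDimensional ℝ E] (r : E → E) (hr : ContDiff ℝ 1 r) (ρ : ℝ) (hρ : 0 < ρ)
    (h1 : ∀ u, ‖r u‖ = ρ) (h2 : ∀ u, ‖u‖ = ρ → r u = u) : False := by
  classical
  borelize E
  let μ : Measure E := Measure.addHaar
  let I := ContinuousLinearMap.id ℝ E
  let g : E → E := fun u => r u - u
  have hg : ContDiff ℝ 1 g := hr.sub contDiff_id
  let A : E → E →L[ℝ] E := fun u => fderiv ℝ g u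
  have hA : Continuous A := hg.continuous_fderiv one_ne_zero
  have hgd : ∀ u, HasFDerivAt g (A u) u := fun u => (hg.differentiable one_ne_zero u).hasFDerivAt
  obtain ⟨K, hK⟩ : ∃ K : ℝ, ∀ u ∈ Metric.closedBall (0:E) ρ, ‖A u‖ ≤ K := by
    obtain ⟨K, hK⟩ := (isCompact_closedBall (0:E) ρ).exists_bound_of_continuousOn hA.continuousOn
    exact ⟨K, hK⟩
  have hK0 : 0 ≤ K := (norm_nonneg _).trans (hK 0 (by simp [hρ.le]))
  have hlip : ∀ u ∈ Metric.closedBall (0:E) ρ, ∀ w ∈ Metric.closedBall (0:E) ρ,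
      ‖g u - g w‖ ≤ K * ‖u - w‖ := by
    intro u hu w hw
    exact (convex_closedBall (0:E) ρ).norm_image_sub_le_of_norm_hasFDerivWithin_le
      (fun x _ => (hgd x).hasFDerivWithinAt) hK hw hu
  let f : ℝ → E → E := fun t u => u + t • g u
  have hfd : ∀ t u, HasFDerivAt (f t) (I + t • A u) u := fun t u =>
    (hasFDerivAt_id u).add ((hgd u).const_smul t)
  set τ : ℝ := 1 / (K + 1) / 2 with hτ
  have hKτ : ∀ t, 0 ≤ t → t ≤ τ → t * K < 1 ∧ t < 1 := by
    intro t ht0 ht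
    have h3 : τ * (K+1) = 1/2 := by rw [hτ]; field_simp
    constructor <;> nlinarith
  have hinj : ∀ t, 0 ≤ t → t ≤ τ → InjOn (f t) (Metric.closedBall 0 ρ) := by
    intro t ht0 ht u hu w hw huw
    have h3 : u - w = - (t • (g u - g w)) := by
      have : u + t • g u = w + t • g w := huw
      rw [smul_sub]
      have h4 : u - w = t • g w - t • g u := by
        rw [sub_eq_sub_iff_add_eq_add, this]; abel
      rw [h4]; abel
    have h4 : ‖u - w‖ ≤ t * (K * ‖u - w‖) := by
      conv_lhs => rw [h3]
      rw [norm_neg, norm_smul, Real.norm_of_nonneg ht0]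
      exact mul_le_mul_of_nonneg_left (hlip u hu w hw) ht0
    have h5 := (hKτ t ht0 ht).1
    have h6 : ‖u - w‖ = 0 := by
      have := norm_nonneg (u - w)
      nlinarith
    exact sub_eq_zero.mp (norm_eq_zero.mp h6)
  have hinv : ∀ t, 0 ≤ t → t ≤ τ → ∀ u ∈ Metric.closedBall (0:E) ρ, (I + t • A u).det ≠ 0 := by
    intro t ht0 ht u hu hdet
    have hker : ∃ w : E, w ≠ 0 ∧ (I + t • A u) w = 0 := by
      have h3 := LinearMap.bot_lt_ker_of_det_eq_zero (f := ((I + t • A u : E →L[ℝ] E) : E →ₗ[ℝ] E)) hdet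
      obtain ⟨w, hw, hw0⟩ := (Submodule.ne_bot_iff _).mp h3.ne'
      exact ⟨w, hw0, hw⟩
    obtain ⟨w, hw0, hw⟩ := hker
    have h3 : w = - (t • A u w) := by
      have : w + t • A u w = 0 := hw
      exact eq_neg_of_add_eq_zero_left this
    have h4 : ‖w‖ ≤ t * (K * ‖w‖) := by
      conv_lhs => rw [h3]
      rw [norm_neg, norm_smul, Real.norm_of_nonneg ht0]
      refine mul_le_mul_of_nonneg_left ?_ ht0
      exact ((A u).le_opNorm w).trans (mul_le_mul_of_nonneg_right (hK u hu) (norm_nonneg _))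
    have h5 := (hKτ t ht0 ht).1
    have h6 : 0 < ‖w‖ := norm_pos_iff.mpr hw0
    nlinarith
  have hdetc : ∀ t : ℝ, Continuous fun u => (I + t • A u).det := by
    intro t
    exact ContinuousLinearMap.continuous_det.comp (by fun_prop)
  have hpos : ∀ t, 0 ≤ t → t ≤ τ → ∀ u ∈ Metric.closedBall (0:E) ρ, 0 < (I + t • A u).det := by
    intro t ht0 ht u hu
    by_contra hneg
    push Not at hneg
    have hc : ContinuousOn (fun s : ℝ => (I + s • A u).det) (Icc 0 t) :=
      (ContinuousLinearMap.continuous_det.comp (by fun_prop)).continuousOn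
    have h0 : (I + (0:ℝ) • A u).det = 1 := by
      simp [I, ContinuousLinearMap.det]
    have hiv := intermediate_value_Icc' ht0 hc
    obtain ⟨s, hs, hs0⟩ := hiv (show (0:ℝ) ∈ _ from ⟨hneg, by simp only [h0]; norm_num⟩)
    exact hinv s hs.1 (hs.2.trans ht) u hu hs0
  have hmap : ∀ t, 0 ≤ t → t ≤ τ → f t '' Metric.ball 0 ρ = Metric.ball 0 ρ := by
    intro t ht0 ht
    have ht1 := (hKτ t ht0 ht).2
    have hform : ∀ u, f t u = (1 - t) • u + t • r u := by
      intro u; simp only [f, g, smul_sub, sub_smul, one_smul]; abel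
    have hsub : f t '' Metric.ball 0 ρ ⊆ Metric.ball 0 ρ := by
      rintro _ ⟨u, hu, rfl⟩
      rw [mem_ball_zero_iff] at hu ⊢
      rw [hform]
      calc ‖(1 - t) • u + t • r u‖ ≤ (1-t) * ‖u‖ + t * ρ := by
            refine (norm_add_le _ _).trans ?_
            rw [norm_smul, norm_smul, Real.norm_of_nonneg ht0, Real.norm_of_nonneg (by linarith), h1]
        _ < ρ := by nlinarith
    refine hsub.antisymm ?_
    have hfc : Continuous (f t) := by
      have : Continuous g := hg.continuous
      simp only [f]; fun_prop
    refine (convex_ball (0:E) ρ).isPreconnected.subset_of_closure_inter_subset ?_ ?_ ?_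
    · rw [isOpen_iff_mem_nhds]
      rintro _ ⟨u, hu, rfl⟩
      have hfs : HasStrictFDerivAt (f t) (I + t • A u) u := by
        have hcd : ContDiff ℝ 1 (f t) := contDiff_id.add (contDiff_const.smul hg)
        exact hcd.contDiffAt.hasStrictFDerivAt' (hfd t u) one_ne_zero
      have hd := hinv t ht0 ht u (Metric.ball_subset_closedBall hu)
      have he : ((ContinuousLinearMap.toContinuousLinearEquivOfDetNeZero _ hd : E ≃L[ℝ] E) : E →L[ℝ] E) = I + t • A u :=
        ContinuousLinearMap.coe_toContinuousLinearEquivOfDetNeZero _ hd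
      rw [← he] at hfs
      rw [← hfs.map_nhds_eq_of_equiv]
      exact image_mem_map (Metric.isOpen_ball.mem_nhds hu)
    · refine ⟨f t 0, hsub ⟨0, by simp [hρ], rfl⟩, ⟨0, by simp [hρ], rfl⟩⟩
    · rintro y ⟨hy1, hy2⟩
      have hcl : y ∈ f t '' Metric.closedBall 0 ρ := by
        have hc : IsClosed (f t '' Metric.closedBall 0 ρ) :=
          ((isCompact_closedBall (0:E) ρ).image hfc).isClosed
        exact closure_minimal (image_mono Metric.ball_subset_closedBall) hc hy1
      obtain ⟨u, hu, rfl⟩ := hcl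
      refine ⟨u, ?_, rfl⟩
      rw [mem_closedBall_zero_iff] at hu
      rw [mem_ball_zero_iff] at hy2 ⊢
      rcases hu.lt_or_eq with h | h
      · exact h
      · exfalso
        have : f t u = u := by simp only [f, g, h2 u h, sub_self, smul_zero, add_zero]
        rw [this] at hy2; linarith
  have hintg : ∀ t, IntegrableOn (fun u => (I + t • A u).det) (Metric.ball 0 ρ) μ := fun t =>
    ((hdetc t).continuousOn.integrableOn_compact (isCompact_closedBall (0:E) ρ)).mono_set
      Metric.ball_subset_closedBall
  have hvol : ∀ t, 0 ≤ t → t ≤ τ → ∫ u in Metric.ball 0 ρ, (I + t • A u).det ∂μ = μ.real (Metric.ball 0 ρ) := by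
    intro t ht0 ht
    have h3 := integral_image_eq_integral_abs_det_fderiv_smul μ (Metric.isOpen_ball (x := (0:E)) (ε := ρ)).measurableSet
      (fun x _ => (hfd t x).hasFDerivWithinAt) ((hinj t ht0 ht).mono Metric.ball_subset_closedBall) (fun _ => (1:ℝ))
    rw [hmap t ht0 ht] at h3
    simp only [smul_eq_mul, mul_one] at h3
    rw [setIntegral_const, smul_eq_mul, mul_one] at h3
    rw [h3]
    refine setIntegral_congr_fun Metric.isOpen_ball.measurableSet fun u hu => ?_
    rw [abs_of_pos (hpos t ht0 ht u (Metric.ball_subset_closedBall hu))]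
  -- interpolation nodes
  set D := Module.finrank ℝ E
  have hτ0 : 0 < τ := by rw [hτ]; positivity
  let v : ℕ → ℝ := fun k => τ / (k + 1)
  have hv : Set.InjOn v (Finset.range (D+1)) := by
    intro a _ b _ hab
    simp only [v] at hab
    have ha : (0:ℝ) < a + 1 := by positivity
    have hb : (0:ℝ) < b + 1 := by positivity
    rw [div_eq_div_iff ha.ne' hb.ne'] at hab
    have := mul_left_cancel₀ hτ0.ne' hab
    exact_mod_cast (add_right_cancel this).symm
  have hvk : ∀ k, 0 ≤ v k ∧ v k ≤ τ := by
    intro k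
    have ha : (0:ℝ) < k + 1 := by positivity
    refine ⟨by positivity, ?_⟩
    rw [div_le_iff₀ ha]
    nlinarith [(Nat.cast_nonneg k : (0:ℝ) ≤ k)]
  have hone : ∫ u in Metric.ball 0 ρ, (I + (1:ℝ) • A u).det ∂μ = μ.real (Metric.ball 0 ρ) := by
    have : ∀ u, (I + (1:ℝ) • A u).det = _ := fun u => det_interp_clm v hv (A u) 1
    simp_rw [this]
    rw [integral_finsetSum _ (fun k _ => (hintg (v k)).mul_const _)]
    simp_rw [integral_mul_const]
    have h4 : ∀ k ∈ Finset.range (D+1), (∫ u in Metric.ball 0 ρ, (ContinuousLinearMap.id ℝ E + v k • A u).det ∂μ) *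
        (Lagrange.basis (Finset.range (D+1)) v k).eval 1 = μ.real (Metric.ball 0 ρ) * (Lagrange.basis (Finset.range (D+1)) v k).eval 1 := by
      intro k _
      rw [hvol (v k) (hvk k).1 (hvk k).2]
    rw [Finset.sum_congr rfl h4, ← Finset.mul_sum, ← Polynomial.eval_finsetSum,
      Lagrange.sum_basis hv ⟨0, by simp⟩]
    simp
  have hzero : ∀ u, (I + (1:ℝ) • A u).det = 0 := by
    intro u
    have hrd : HasFDerivAt r (I + (1:ℝ) • A u) u := by
      have h3 := hfd 1 u
      have h4 : f 1 = r := by ext w; simp [f, g]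
      rwa [h4] at h3
    by_contra hne
    have hcst : HasFDerivAt (fun w => inner ℝ (r w) (r w)) (0 : E →L[ℝ] ℝ) u := by
      have : (fun w => inner ℝ (r w) (r w)) = fun _ => ρ^2 := by
        ext w; rw [real_inner_self_eq_norm_sq, h1]
      rw [this]; exact hasFDerivAt_const _ _
    have h5 := hcst.unique (hrd.inner ℝ hrd)
    set e := ContinuousLinearMap.toContinuousLinearEquivOfDetNeZero _ hne
    have h6 := congrArg (fun L : E →L[ℝ] ℝ => L (e.symm (r u))) h5
    have h7 : (I + (1:ℝ) • A u) (e.symm (r u)) = r u := by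
      have := ContinuousLinearMap.coe_toContinuousLinearEquivOfDetNeZero _ hne
      have h8 : (e : E →L[ℝ] E) (e.symm (r u)) = r u := by simp
      rwa [this] at h8
    simp only [ContinuousLinearMap.comp_apply, ContinuousLinearMap.prod_apply, fderivInnerCLM_apply, h7,
      zero_apply, real_inner_self_eq_norm_sq, h1] at h6
    nlinarith
  simp_rw [hzero] at hone
  rw [integral_zero] at hone
  have hpos' : 0 < μ.real (Metric.ball (0:E) ρ) :=
    ENNReal.toReal_pos (Metric.measure_ball_pos μ 0 hρ).ne' measure_ball_lt_top.ne
  linarith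

open Set Filter Topology in
theorem exists_zero_of_inner_pos {E : Type*} [NormedAddCommGroup E] [InnerProductSpace ℝ E]
    [FiniteDimensional ℝ E] (F : E → E) (hF : Continuous F) (R : ℝ)
    (hR : ∀ u, R ≤ ‖u‖ → 0 < inner ℝ (F u) u) : ∃ u, F u = 0 := by
  by_contra hno
  push Not at hno
  have hR0 : 0 < R := by
    by_contra h
    have := hR 0 (by simpa using not_lt.mp h)
    simp at this
  let χ : E → ℝ := fun u => max 0 (min 1 (‖u‖ - R))
  have hχc : Continuous χ := by fun_prop
  have hχ0 : ∀ u, 0 ≤ χ u := fun u => le_max_left _ _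
  have hχ1 : ∀ u, χ u ≤ 1 := fun u => max_le zero_le_one (min_le_left _ _)
  let H : E → E := fun u => (1 - χ u) • F u + χ u • u
  have hHc : Continuous H := by fun_prop
  have hHne : ∀ u, H u ≠ 0 := by
    intro u hu
    rcases lt_or_ge ‖u‖ R with h | h
    · have : χ u = 0 := by
        simp only [χ]; rw [max_eq_left]; exact (min_le_right _ _).trans (by linarith)
      simp only [H, this] at hu
      simp at hu
      exact hno u hu
    · have h3 : inner ℝ (H u) u = (1 - χ u) * inner ℝ (F u) u + χ u * ‖u‖^2 := by
        simp only [H]; rw [inner_add_left, real_inner_smul_left, real_inner_smul_left, real_inner_self_eq_norm_sq]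
      rw [hu, inner_zero_left] at h3
      have h4 := hR u h
      have h5 : 0 < ‖u‖^2 := by have : 0 < ‖u‖ := by linarith
                                positivity
      rcases (hχ0 u).lt_or_eq with h6 | h6
      · nlinarith [hχ1 u, mul_pos h6 h5, mul_nonneg (sub_nonneg.mpr (hχ1 u)) h4.le]
      · rw [← h6] at h3; linarith
  have hHid : ∀ u, R + 1 ≤ ‖u‖ → H u = u := by
    intro u hu
    have : χ u = 1 := by
      simp only [χ]; rw [min_eq_left (by linarith)]; simp
    simp [H, this]
  obtain ⟨g, hg, hg1, hg2, -⟩ := hHc.exists_contDiff_approx_and_eqOn (1 : ℕ∞) (ε := fun u => ‖H u‖) hHc.norm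
    (fun u => norm_pos_iff.mpr (hHne u)) (S := {u | R + 2 ≤ ‖u‖}) (U := {u | R + 1 < ‖u‖})
    (isClosed_le continuous_const continuous_norm)
    ((isOpen_lt continuous_const continuous_norm).mem_nhdsSet.mpr (fun u hu => by
      simp only [Set.mem_ofPred_eq] at hu ⊢; linarith))
    (contDiffOn_id.congr fun u hu => hHid u (le_of_lt hu))
  have hgne : ∀ u, g u ≠ 0 := by
    intro u hu
    have := hg1 u
    rw [hu, dist_zero_left] at this
    exact lt_irrefl _ this
  refine no_retraction (fun u => ((R+2) / ‖g u‖) • g u) ?_ (R+2) (by linarith) ?_ ?_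
  · refine ContDiff.smul (contDiff_const.div (hg.norm ℝ hgne) fun u => norm_ne_zero_iff.mpr (hgne u)) hg
  · intro u
    rw [norm_smul, norm_div, norm_norm, div_mul_cancel₀ _ (norm_ne_zero_iff.mpr (hgne u)), Real.norm_of_nonneg (by linarith)]
  · intro u hu
    have : g u = u := by
      rw [hg2 (show R + 2 ≤ ‖u‖ from hu.ge), hHid u (by linarith)]
    simp only [this, hu]
    rw [div_self (by linarith), one_smul]


open MeasureTheory Set in
theorem bm_aux (B : Set ℝ) (hB : MeasurableSet B) (k M : ENNReal)
    (h : ∀ L ⊆ B, IsCompact L → k + volume L ≤ M) : k + volume B ≤ M := by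
  have h0 : k ≤ M := by simpa using h ∅ (empty_subset _) isCompact_empty
  by_cases hk : k = ⊤
  · subst hk
    have : M = ⊤ := top_le_iff.mp h0
    simp [this]
  by_contra hcon
  push Not at hcon
  have h4 : M - k < volume B := by
    by_contra h5
    push Not at h5
    have : k + volume B ≤ k + (M - k) := by gcongr
    rw [add_tsub_cancel_of_le h0] at this
    exact absurd hcon (not_lt.mpr this)
  obtain ⟨L, hLB, hL, hlt⟩ := hB.exists_lt_isCompact h4
  have h6 := h L hLB hL
  have h7 : M < k + volume L := by
    rwa [add_comm, ← ENNReal.sub_lt_iff_lt_right hk h0]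
  exact absurd h7 (not_lt.mpr h6)

open MeasureTheory Set in
theorem bm_one_dim (A B C : Set ℝ) (hA : MeasurableSet A) (hB : MeasurableSet B)
    (hAn : A.Nonempty) (hBn : B.Nonempty) (h : ∀ x ∈ A, ∀ y ∈ B, (x + y) / 2 ∈ C) :
    volume A + volume B ≤ 2 * volume C := by
  -- compact version
  have key : ∀ K ⊆ A, IsCompact K → K.Nonempty → ∀ L ⊆ B, IsCompact L → L.Nonempty →
      volume K + volume L ≤ 2 * volume C := by
    intro K hKA hK hKn L hLB hL hLn
    obtain ⟨a, haK, ha⟩ := hK.exists_isGreatest hKn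
    obtain ⟨b, hbL, hb⟩ := hL.exists_isLeast hLn
    let S1 : Set ℝ := (fun x => x + (-b)) ⁻¹' K
    let S2 : Set ℝ := (fun x => x + (-a)) ⁻¹' L
    have hv1 : volume S1 = volume K := measure_preimage_add_right volume (-b) K
    have hv2 : volume S2 = volume L := measure_preimage_add_right volume (-a) L
    have hS1m : MeasurableSet S1 := hK.measurableSet.preimage (by fun_prop)
    have hS2m : MeasurableSet S2 := hL.measurableSet.preimage (by fun_prop)
    have hdis : AEDisjoint volume S1 S2 := by
      refine measure_mono_null (t := {a + b}) ?_ (by simp)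
      rintro x ⟨h1, h2⟩
      have h3 : x + -b ≤ a := ha h1
      have h4 : b ≤ x + -a := hb h2
      simp only [mem_singleton_iff]; linarith
    have hun : volume (S1 ∪ S2) = volume K + volume L := by
      rw [measure_union₀ hS2m.nullMeasurableSet hdis, hv1, hv2]
    have hsub : (fun x : ℝ => 2 * x) ⁻¹' (S1 ∪ S2) ⊆ C := by
      rintro x (hx | hx)
      · have h1 : 2 * x + -b ∈ K := hx
        have := h _ (hKA h1) _ (hLB hbL)
        have h2 : (2 * x + -b + b) / 2 = x := by ring
        rwa [h2] at this
      · have h1 : 2 * x + -a ∈ L := hx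
        have := h _ (hKA haK) _ (hLB h1)
        have h2 : (a + (2 * x + -a)) / 2 = x := by ring
        rwa [h2] at this
    have h3 := measure_mono (μ := volume) hsub
    rw [Real.volume_preimage_mul_left two_ne_zero, hun] at h3
    calc volume K + volume L = 2 * (ENNReal.ofReal |2⁻¹| * (volume K + volume L)) := by
          rw [← mul_assoc]
          have : (2:ENNReal) * ENNReal.ofReal |2⁻¹| = 1 := by
            rw [abs_of_pos (by norm_num), show (2:ENNReal) = ENNReal.ofReal 2 by simp, ← ENNReal.ofReal_mul (by norm_num)]
            norm_num
          rw [this, one_mul]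
      _ ≤ 2 * volume C := by gcongr
  obtain ⟨a0, ha0⟩ := hAn
  obtain ⟨b0, hb0⟩ := hBn
  have h2 : ∀ K ⊆ A, IsCompact K → ∀ L ⊆ B, IsCompact L → volume K + volume L ≤ 2 * volume C := by
    intro K hKA hK L hLB hL
    refine le_trans ?_ (key (insert a0 K) (insert_subset ha0 hKA) (hK.insert a0) ⟨a0, by simp⟩
      (insert b0 L) (insert_subset hb0 hLB) (hL.insert b0) ⟨b0, by simp⟩)
    gcongr <;> exact subset_insert _ _
  rw [add_comm]
  refine bm_aux A hA _ _ fun K hKA hK => ?_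
  rw [add_comm]
  exact bm_aux B hB _ _ fun L hLB hL => h2 K hKA hK L hLB hL

open MeasureTheory Set in
theorem pl_aux_real (f g h : ℝ → ℝ) (hf : Measurable f) (hg : Measurable g) (hh : Measurable h)
    (hf0 : ∀ x, 0 ≤ f x) (hg0 : ∀ x, 0 ≤ g x) (hh0 : ∀ x, 0 ≤ h x)
    (hf1 : ∀ x, f x ≤ 1) (hg1 : ∀ x, g x ≤ 1)
    (hfs : ∀ t < 1, ∃ x, t < f x) (hgs : ∀ t < 1, ∃ x, t < g x)
    (H : ∀ x y t, t < f x → t < g y → t < h ((x + y) / 2)) :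
    (∫⁻ x, ENNReal.ofReal (f x)) + ∫⁻ x, ENNReal.ofReal (g x) ≤
      2 * ∫⁻ x, ENNReal.ofReal (h x) := by
  rw [lintegral_eq_lintegral_meas_lt volume (Filter.Eventually.of_forall hf0) hf.aemeasurable,
    lintegral_eq_lintegral_meas_lt volume (Filter.Eventually.of_forall hg0) hg.aemeasurable,
    lintegral_eq_lintegral_meas_lt volume (Filter.Eventually.of_forall hh0) hh.aemeasurable,
    ← lintegral_const_mul' _ _ (by norm_num), ← lintegral_add_left]
  · refine lintegral_mono fun t => ?_
    by_cases ht : t < 1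
    · refine bm_one_dim _ _ _ (measurableSet_lt measurable_const hf)
        (measurableSet_lt measurable_const hg) (hfs t ht) (hgs t ht) ?_
      intro x hx y hy
      exact H x y t hx hy
    · have e1 : {a | t < f a} = ∅ := by
        ext a; simp; linarith [hf1 a]
      have e2 : {a | t < g a} = ∅ := by
        ext a; simp; linarith [hg1 a]
      simp [e1, e2]
  · have : Antitone fun t => volume {a | t < f a} := fun s t hst =>
      measure_mono fun x hx => lt_of_le_of_lt hst hx
    exact this.measurable

open MeasureTheory Set in
theorem pl_one_bdd (f g h : ℝ → ENNReal) (hf : Measurable f) (hg : Measurable g)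
    (hh : Measurable h) (hfb : (⨆ x, f x) ≠ ⊤) (hgb : (⨆ x, g x) ≠ ⊤)
    (H : ∀ x y, f x * g y ≤ h ((x + y) / 2) ^ 2) :
    (∫⁻ x, f x) * (∫⁻ x, g x) ≤ (∫⁻ x, h x) ^ 2 := by
  obtain ⟨F, hF⟩ : ∃ F, F = ⨆ x, f x := ⟨_, rfl⟩
  obtain ⟨G, hG⟩ : ∃ G, G = ⨆ x, g x := ⟨_, rfl⟩
  rw [← hF] at hfb
  rw [← hG] at hgb
  have hfF : ∀ x, f x ≤ F := fun x => hF ▸ le_iSup f x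
  have hgG : ∀ x, g x ≤ G := fun x => hG ▸ le_iSup g x
  by_cases hF0 : F = 0
  · have : ∀ x, f x = 0 := fun x => le_antisymm (hF0 ▸ hfF x) bot_le
    simp [this]
  by_cases hG0 : G = 0
  · have : ∀ x, g x = 0 := fun x => le_antisymm (hG0 ▸ hgG x) bot_le
    simp [this]
  have hFr : 0 < F.toReal := ENNReal.toReal_pos hF0 hfb
  have hGr : 0 < G.toReal := ENNReal.toReal_pos hG0 hgb
  obtain ⟨c, hc0, hc⟩ : ∃ c : ℝ, 0 < c ∧ c ^ 2 = F.toReal * G.toReal :=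
    ⟨√(F.toReal * G.toReal), Real.sqrt_pos.mpr (by positivity), Real.sq_sqrt (by positivity)⟩
  have hFe : F = ENNReal.ofReal F.toReal := (ENNReal.ofReal_toReal hfb).symm
  have hGe : G = ENNReal.ofReal G.toReal := (ENNReal.ofReal_toReal hgb).symm
  have hce : ENNReal.ofReal c ^ 2 = F * G := by
    rw [← ENNReal.ofReal_pow hc0.le, hc, ENNReal.ofReal_mul hFr.le, ← hFe, ← hGe]
  have hcne : ENNReal.ofReal c ≠ 0 := by simpa using hc0
  -- real versions
  have hft : ∀ x, f x ≠ ⊤ := fun x => ne_top_of_le_ne_top hfb (hfF x)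
  have hgt : ∀ x, g x ≠ ⊤ := fun x => ne_top_of_le_ne_top hgb (hgG x)
  have key := pl_aux_real (fun x => (f x).toReal / F.toReal) (fun x => (g x).toReal / G.toReal)
    (fun x => (min (h x) (ENNReal.ofReal (2 * c))).toReal / c) (by fun_prop) (by fun_prop)
    (by fun_prop) (fun x => by positivity) (fun x => by positivity) (fun x => by positivity)
    (fun x => (div_le_one hFr).mpr (ENNReal.toReal_mono hfb (hfF x)))
    (fun x => (div_le_one hGr).mpr (ENNReal.toReal_mono hgb (hgG x))) ?_ ?_ ?_
  rotate_left
  · intro t ht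
    rcases lt_or_ge t 0 with htn | htn
    · exact ⟨0, lt_of_lt_of_le htn (by positivity)⟩
    have ht0 : 0 ≤ t * F.toReal := by positivity
    have : ENNReal.ofReal (t * F.toReal) < ⨆ x, f x := by
      rw [← hF]
      conv_rhs => rw [hFe]
      rw [ENNReal.ofReal_lt_ofReal_iff hFr]
      nlinarith
    obtain ⟨x, hx⟩ := lt_iSup_iff.mp this
    exact ⟨x, by rw [lt_div_iff₀ hFr]; exact (ENNReal.ofReal_lt_iff_lt_toReal ht0 (hft x)).mp hx⟩
  · intro t ht
    rcases lt_or_ge t 0 with htn | htn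
    · exact ⟨0, lt_of_lt_of_le htn (by positivity)⟩
    have ht0 : 0 ≤ t * G.toReal := by positivity
    have : ENNReal.ofReal (t * G.toReal) < ⨆ x, g x := by
      rw [← hG]
      conv_rhs => rw [hGe]
      rw [ENNReal.ofReal_lt_ofReal_iff hGr]
      nlinarith
    obtain ⟨x, hx⟩ := lt_iSup_iff.mp this
    exact ⟨x, by rw [lt_div_iff₀ hGr]; exact (ENNReal.ofReal_lt_iff_lt_toReal ht0 (hgt x)).mp hx⟩
  · intro x y t hx hy
    rcases lt_or_ge t 0 with htn | htn
    · exact lt_of_lt_of_le htn (by positivity)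
    set m := (x + y) / 2 with hm
    have hu1 : (f x).toReal / F.toReal ≤ 1 := (div_le_one hFr).mpr (ENNReal.toReal_mono hfb (hfF x))
    rw [lt_div_iff₀ hc0]
    rcases le_total (h m) (ENNReal.ofReal (2 * c)) with hle | hle
    · rw [min_eq_left hle]
      have hnt : h m ≠ ⊤ := ne_top_of_le_ne_top ENNReal.ofReal_ne_top hle
      have h1 : (f x).toReal * (g y).toReal ≤ (h m).toReal ^ 2 := by
        rw [← ENNReal.toReal_mul, ← ENNReal.toReal_pow]
        exact ENNReal.toReal_mono (by finiteness) (H x y)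
      rw [lt_div_iff₀ hFr] at hx
      rw [lt_div_iff₀ hGr] at hy
      have h2 : (t * c) ^ 2 < (h m).toReal ^ 2 := by
        calc (t * c) ^ 2 = (t * F.toReal) * (t * G.toReal) := by rw [mul_pow, hc]; ring
          _ < (f x).toReal * (g y).toReal := by
            apply mul_lt_mul'' hx hy <;> positivity
          _ ≤ _ := h1
      exact lt_of_pow_lt_pow_left₀ 2 (by positivity) h2
    · rw [min_eq_right hle, ENNReal.toReal_ofReal (by positivity)]
      nlinarith
  have e1 : ∀ x, f x = F * ENNReal.ofReal ((f x).toReal / F.toReal) := by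
    intro x
    conv_rhs => enter [1]; rw [hFe]
    rw [← ENNReal.ofReal_mul hFr.le, mul_div_cancel₀ _ hFr.ne', ENNReal.ofReal_toReal (hft x)]
  have e2 : ∀ x, g x = G * ENNReal.ofReal ((g x).toReal / G.toReal) := by
    intro x
    conv_rhs => enter [1]; rw [hGe]
    rw [← ENNReal.ofReal_mul hGr.le, mul_div_cancel₀ _ hGr.ne', ENNReal.ofReal_toReal (hgt x)]
  have e3 : ∀ x, ENNReal.ofReal c * ENNReal.ofReal ((min (h x) (ENNReal.ofReal (2 * c))).toReal / c) ≤ h x := by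
    intro x
    rw [← ENNReal.ofReal_mul hc0.le, mul_div_cancel₀ _ hc0.ne', ENNReal.ofReal_toReal
      (ne_top_of_le_ne_top ENNReal.ofReal_ne_top (min_le_right _ _))]
    exact min_le_left _ _
  set If := ∫⁻ x, ENNReal.ofReal ((f x).toReal / F.toReal)
  set Ig := ∫⁻ x, ENNReal.ofReal ((g x).toReal / G.toReal)
  set Ih := ∫⁻ x, ENNReal.ofReal ((min (h x) (ENNReal.ofReal (2 * c))).toReal / c)
  have i1 : ∫⁻ x, f x = F * If := by
    rw [← lintegral_const_mul' _ _ hfb]; exact lintegral_congr e1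
  have i2 : ∫⁻ x, g x = G * Ig := by
    rw [← lintegral_const_mul' _ _ hgb]; exact lintegral_congr e2
  have i3 : ENNReal.ofReal c * Ih ≤ ∫⁻ x, h x := by
    rw [← lintegral_const_mul' _ _ (by simp)]; exact lintegral_mono e3
  have amgm : If * Ig ≤ Ih ^ 2 := by
    by_cases hIh : Ih = ⊤
    · rw [hIh]; simp
    have hs : If + Ig ≠ ⊤ := ne_top_of_le_ne_top (by finiteness) key
    have hIf : If ≠ ⊤ := fun h => hs (by simp [h])
    have hIg : Ig ≠ ⊤ := fun h => hs (by simp [h])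
    have k1 := ENNReal.toReal_mono (by finiteness) key
    rw [ENNReal.toReal_add hIf hIg, ENNReal.toReal_mul] at k1
    simp only [ENNReal.toReal_ofNat] at k1
    rw [← ENNReal.toReal_le_toReal (by finiteness) (by finiteness), ENNReal.toReal_mul,
      ENNReal.toReal_pow]
    have p1 : 0 ≤ If.toReal := ENNReal.toReal_nonneg
    have p2 : 0 ≤ Ig.toReal := ENNReal.toReal_nonneg
    nlinarith [sq_nonneg (If.toReal - Ig.toReal)]
  calc (∫⁻ x, f x) * (∫⁻ x, g x) = (F * G) * (If * Ig) := by rw [i1, i2]; ring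
    _ ≤ (F * G) * Ih ^ 2 := by gcongr
    _ = (ENNReal.ofReal c * Ih) ^ 2 := by rw [← hce]; ring
    _ ≤ _ := by gcongr

open MeasureTheory Set in
theorem pl_one (f g h : ℝ → ENNReal) (hf : Measurable f) (hg : Measurable g)
    (hh : Measurable h) (H : ∀ x y, f x * g y ≤ h ((x + y) / 2) ^ 2) :
    (∫⁻ x, f x) * (∫⁻ x, g x) ≤ (∫⁻ x, h x) ^ 2 := by
  have trunc : ∀ f : ℝ → ENNReal, Measurable f →
      ∫⁻ x, f x = ⨆ n : ℕ, ∫⁻ x, min (f x) n := by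
    intro f hf
    rw [← lintegral_iSup (fun n => hf.min measurable_const)]
    · refine lintegral_congr fun x => ?_
      refine le_antisymm ?_ (iSup_le fun n => min_le_left _ _)
      refine le_of_forall_lt fun b hb => ?_
      obtain ⟨n, hn⟩ := ENNReal.exists_nat_gt (ne_top_of_lt hb)
      exact lt_of_lt_of_le (lt_min hb hn) (le_iSup (fun n : ℕ => min (f x) n) n)
    · intro m n hmn x
      simp only
      gcongr
  rw [trunc f hf, trunc g hg, ENNReal.iSup_mul]
  refine iSup_le fun n => ?_
  rw [ENNReal.mul_iSup]
  refine iSup_le fun k => ?_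
  refine pl_one_bdd _ _ h (hf.min measurable_const) (hg.min measurable_const) hh ?_ ?_ ?_
  · exact ne_top_of_le_ne_top (ENNReal.natCast_ne_top n) (iSup_le fun x => min_le_right _ _)
  · exact ne_top_of_le_ne_top (ENNReal.natCast_ne_top k) (iSup_le fun x => min_le_right _ _)
  · intro x y
    refine le_trans ?_ (H x y)
    gcongr <;> exact min_le_left _ _

open MeasureTheory Set in
theorem prekopa_leindler : ∀ (m : ℕ) (f g h : (Fin m → ℝ) → ENNReal) (_ : Measurable f)
    (_ : Measurable g) (_ : Measurable h)
    (_ : ∀ x y, f x * g y ≤ h ((1 / 2 : ℝ) • (x + y)) ^ 2),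
    (∫⁻ x, f x) * (∫⁻ x, g x) ≤ (∫⁻ x, h x) ^ 2 := by
  intro m
  induction m with
  | zero =>
    intro f g h _ _ _ H
    have : ∀ k : (Fin 0 → ℝ) → ENNReal, ∫⁻ x, k x = k 0 := by
      intro k
      rw [volume_pi, Measure.pi_of_empty (x := 0), lintegral_dirac]
    rw [this, this, this]
    have := H 0 0
    simpa using this
  | succ m ih =>
    intro f g h hf hg hh H
    have mp := (volume_preserving_piFinSuccAbove (fun _ : Fin (m + 1) => ℝ) 0).symm
    have hcons : ∀ p : ℝ × (Fin m → ℝ),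
        (MeasurableEquiv.piFinSuccAbove (fun _ : Fin (m + 1) => ℝ) 0).symm p
          = Fin.cons p.1 p.2 := by
      intro p
      simp [MeasurableEquiv.piFinSuccAbove]
      rfl
    have e : ∀ k : (Fin (m + 1) → ℝ) → ENNReal, Measurable k →
        ∫⁻ x, k x = ∫⁻ s : ℝ, ∫⁻ z : Fin m → ℝ, k (Fin.cons s z) := by
      intro k hk
      rw [← mp.lintegral_comp hk, Measure.volume_eq_prod, lintegral_prod]
      · simp only [hcons]
      · exact (hk.comp mp.measurable).aemeasurable
    have hm : ∀ k : (Fin (m + 1) → ℝ) → ENNReal, Measurable k →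
        Measurable fun p : ℝ × (Fin m → ℝ) => k (Fin.cons p.1 p.2) := by
      intro k hk
      simpa only [Function.comp_def, hcons] using hk.comp mp.measurable
    rw [e f hf, e g hg, e h hh]
    refine pl_one _ _ _ (hm f hf).lintegral_prod_right' (hm g hg).lintegral_prod_right'
      (hm h hh).lintegral_prod_right' fun s t => ?_
    refine ih _ _ _ ((hm f hf).comp measurable_prodMk_left) ((hm g hg).comp measurable_prodMk_left)
      ((hm h hh).comp measurable_prodMk_left) fun x y => ?_
    refine (H _ _).trans_eq ?_
    congr 2
    ext i
    refine Fin.cases ?_ (fun j => ?_) i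
    · simp; ring
    · simp; ring


open MeasureTheory Set Filter Topology in
theorem tail_bound (ρ ρs ρss : ℝ → ℝ) (C : ℝ) (hρ : ∀ s, 0 < ρ s)
    (d1 : ∀ s, HasDerivAt ρ (ρs s) s) (d2 : ∀ s, HasDerivAt ρs (ρss s) s)
    (i0 : Integrable ρ) (b1 : ∀ s, |ρs s| ≤ C * ρ s) (l1 : Tendsto ρ atTop (𝓝 0))
    (hess : ∀ s, ρ s * ρss s ≤ ρs s ^ 2) :
    ∃ k > 0, ∃ s1, ∀ s ≥ s1, ∫ u in Ioi s, ρ u ≤ k * ρ s := by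
  have cρs : Continuous ρs := continuous_iff_continuousAt.mpr fun s => (d2 s).continuousAt
  have is : Integrable ρs := (i0.const_mul C).mono' cρs.aestronglyMeasurable
    (Eventually.of_forall b1)
  have hex : ∃ s1, ρs s1 < 0 := by
    by_contra hcon
    push Not at hcon
    have hm : Monotone ρ := monotone_of_deriv_nonneg (fun s => (d1 s).differentiableAt)
      (fun s => by rw [(d1 s).deriv]; exact hcon s)
    have := ge_of_tendsto l1 (eventually_ge_atTop 0 |>.mono fun s hs => hm hs)
    linarith [hρ 0]
  obtain ⟨s1, hs1⟩ := hex
  have hr : Antitone fun s => ρs s / ρ s := by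
    refine antitone_of_hasDerivAt_nonpos (f' := fun s => (ρss s * ρ s - ρs s * ρs s) / ρ s ^ 2)
      (fun s => (d2 s).div (d1 s) (hρ s).ne') fun s => ?_
    apply div_nonpos_of_nonpos_of_nonneg
    · nlinarith [hess s]
    · positivity
  have hk : 0 < -(ρs s1 / ρ s1) := by
    have := div_neg_of_neg_of_pos hs1 (hρ s1); linarith
  refine ⟨(-(ρs s1 / ρ s1))⁻¹, by positivity, s1, fun s hs => ?_⟩
  have h1 : ∫ u in Ioi s, ρs u = 0 - ρ s :=
    integral_Ioi_of_hasDerivAt_of_tendsto' (fun x _ => d1 x) is.integrableOn l1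
  have h2 : ∫ u in Ioi s, ρ u ≤ ∫ u in Ioi s, (-(ρs s1 / ρ s1))⁻¹ * (- ρs u) := by
    refine setIntegral_mono_on i0.integrableOn (is.neg.const_mul _).integrableOn
      measurableSet_Ioi fun u hu => ?_
    have h3 : ρs u / ρ u ≤ ρs s1 / ρ s1 := hr (le_trans hs (le_of_lt hu))
    rw [div_le_iff₀ (hρ u)] at h3
    rw [inv_mul_eq_div, le_div_iff₀ hk]
    linarith
  rw [integral_const_mul, integral_neg, h1] at h2
  linarith

open MeasureTheory Set Filter Topology in
theorem ode_lemma (ρ ρs ρt ρss ρst ρtt V : ℝ → ℝ) (C : ℝ) (hρ : ∀ s, 0 < ρ s)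
    (d1 : ∀ s, HasDerivAt ρ (ρs s) s) (d2 : ∀ s, HasDerivAt ρs (ρss s) s)
    (d3 : ∀ s, HasDerivAt ρt (ρst s) s)
    (c4 : Continuous ρss) (c5 : Continuous ρst) (c6 : Continuous ρtt)
    (i0 : Integrable ρ) (itt : Integrable ρtt)
    (b1 : ∀ s, |ρs s| ≤ C * ρ s) (b2 : ∀ s, |ρt s| ≤ C * ρ s)
    (l1 : Tendsto ρ atTop (𝓝 0)) (l2 : Tendsto ρ atBot (𝓝 0))
    (hess : ∀ a b s, ρ s * (a ^ 2 * ρss s + 2 * a * b * ρst s + b ^ 2 * ρtt s) ≤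
      (a * ρs s + b * ρt s) ^ 2)
    (h0 : ∫ s, ρt s = 0) (hV : ∀ s, V s = ∫ u in Iic s, ρt u)
    (α β μ : ℝ) (hαβ : α ≤ β) (hμ : 0 < μ) (hμρ : ∀ s ∈ Icc α β, μ ≤ ρ s) :
    (V β / ρ β - V α / ρ α) ^ 2 ≤ (β - α) / μ * (- ∫ s, ρtt s) := by
  have cρ : Continuous ρ := continuous_iff_continuousAt.mpr fun s => (d1 s).continuousAt
  have cρs : Continuous ρs := continuous_iff_continuousAt.mpr fun s => (d2 s).continuousAt
  have cρt : Continuous ρt := continuous_iff_continuousAt.mpr fun s => (d3 s).continuousAt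
  have it : Integrable ρt := (i0.const_mul C).mono' cρt.aestronglyMeasurable
    (Eventually.of_forall b2)
  have hC : 0 ≤ C := by
    have := (abs_nonneg _).trans (b1 0)
    exact nonneg_of_mul_nonneg_left this (hρ 0)
  have dV : ∀ s, HasDerivAt V (ρt s) s := by
    intro s
    have e : V = fun s => (∫ u in Iic 0, ρt u) + ∫ u in (0:ℝ)..s, ρt u := by
      ext s
      rw [hV, ← intervalIntegral.integral_Iic_sub_Iic it.integrableOn it.integrableOn]; ring
    rw [e]
    exact (intervalIntegral.integral_hasDerivAt_right (cρt.intervalIntegrable _ _)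
      (cρt.stronglyMeasurableAtFilter _ _) cρt.continuousAt).const_add _
  have cV : Continuous V := continuous_iff_continuousAt.mpr fun s => (dV s).continuousAt
  have hV2 : ∀ s, V s = - ∫ u in Ioi s, ρt u := by
    intro s
    have := intervalIntegral.integral_Iic_add_Ioi (b := s) it.integrableOn it.integrableOn
    rw [h0] at this
    rw [hV]; linarith
  have hess1 : ∀ s, ρ s * ρss s ≤ ρs s ^ 2 := fun s => by simpa using hess 1 0 s
  -- bounds on V
  have bV1 : ∀ s, |V s| ≤ C * ∫ u in Ioi s, ρ u := by
    intro s
    rw [hV2, abs_neg, ← integral_const_mul]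
    rw [← Real.norm_eq_abs]
    refine (norm_integral_le_integral_norm _).trans ?_
    exact integral_mono it.norm.integrableOn (i0.const_mul C).integrableOn b2
  have bV2 : ∀ s, |V s| ≤ C * ∫ u in Iic s, ρ u := by
    intro s
    rw [hV, ← integral_const_mul]
    rw [← Real.norm_eq_abs]
    refine (norm_integral_le_integral_norm _).trans ?_
    exact integral_mono it.norm.integrableOn (i0.const_mul C).integrableOn b2
  have t1 : ∃ K, ∀ᶠ s in atTop, |V s / ρ s| ≤ K := by
    obtain ⟨k, hk, s1, h⟩ := tail_bound ρ ρs ρss C hρ d1 d2 i0 b1 l1 hess1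
    refine ⟨C * k, (eventually_ge_atTop s1).mono fun s hs => ?_⟩
    rw [abs_div, abs_of_pos (hρ s), div_le_iff₀ (hρ s), mul_assoc]
    exact (bV1 s).trans (mul_le_mul_of_nonneg_left (h s hs) hC)
  have t2 : ∃ K, ∀ᶠ s in atBot, |V s / ρ s| ≤ K := by
    obtain ⟨k, hk, s1, h⟩ := tail_bound (fun s => ρ (-s)) (fun s => - ρs (-s)) (fun s => ρss (-s)) C
      (fun s => hρ _) (fun s => by simpa [Function.comp_def] using (d1 (-s)).comp s (hasDerivAt_neg s))
      (fun s => by simpa [Function.comp_def] using ((d2 (-s)).comp s (hasDerivAt_neg s)).fun_neg)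
      i0.comp_neg (fun s => by rw [abs_neg]; exact b1 _) (l2.comp tendsto_neg_atTop_atBot)
      (fun s => by rw [neg_sq]; exact hess1 _)
    refine ⟨C * k, (eventually_le_atBot (-s1)).mono fun s hs => ?_⟩
    rw [abs_div, abs_of_pos (hρ s), div_le_iff₀ (hρ s), mul_assoc]
    refine (bV2 s).trans (mul_le_mul_of_nonneg_left ?_ hC)
    have := h (-s) (by linarith)
    rw [integral_comp_neg_Ioi] at this
    simpa using this
  -- the flux
  let v : ℝ → ℝ := fun s => V s / ρ s
  let v' : ℝ → ℝ := fun s => (ρt s - v s * ρs s) / ρ s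
  have cv : Continuous v := cV.div cρ fun s => (hρ s).ne'
  have cv' : Continuous v' := by
    exact (cρt.sub (cv.mul cρs)).div cρ fun s => (hρ s).ne'
  have dv : ∀ s, HasDerivAt v (v' s) s := by
    intro s
    refine ((dV s).div (d1 s) (hρ s).ne').congr_deriv ?_
    have := (hρ s).ne'
    change _ = (ρt s - V s / ρ s * ρs s) / ρ s
    field_simp
  let B : ℝ → ℝ := fun s => -2 * v s * ρt s + v s ^ 2 * ρs s
  let B' : ℝ → ℝ := fun s => (-2 * v' s * ρt s - 2 * v s * ρst s) +
    (2 * v s * v' s * ρs s + v s ^ 2 * ρss s)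
  have dB : ∀ s, HasDerivAt B (B' s) s := by
    intro s
    refine ((((dv s).const_mul (-2)).mul (d3 s)).add (((dv s).pow 2).mul (d2 s))).congr_deriv ?_
    change _ = (-2 * v' s * ρt s - 2 * v s * ρst s) +
      (2 * v s * v' s * ρs s + v s ^ 2 * ρss s)
    simp
    ring
  have cB' : Continuous B' := by
    simp only [B']; fun_prop
  have hB : ∀ s, ρ s * v' s ^ 2 ≤ - B' s - ρtt s := by
    intro s
    have h1 := hess (- v s) 1 s
    have h2 : ρt s - v s * ρs s = ρ s * v' s := by
      simp only [v']; have := (hρ s).ne'; field_simp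
    have h3 : v s ^ 2 * ρss s - 2 * v s * ρst s + ρtt s ≤ ρ s * v' s ^ 2 := by
      have e1 : (-v s * ρs s + 1 * ρt s) ^ 2 = ρ s * (ρ s * v' s ^ 2) := by
        rw [show -v s * ρs s + 1 * ρt s = ρt s - v s * ρs s by ring, h2]; ring
      rw [e1] at h1
      have := le_of_mul_le_mul_left h1 (hρ s)
      linarith
    have h4 : B' s = (v s ^ 2 * ρss s - 2 * v s * ρst s) - 2 * v' s * (ρt s - v s * ρs s) := by
      simp only [B']; ring
    rw [h4, h2]
    nlinarith
  have tB : ∀ l : Filter ℝ, Tendsto ρ l (𝓝 0) → (∃ K, ∀ᶠ s in l, |V s / ρ s| ≤ K) →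
      Tendsto B l (𝓝 0) := by
    rintro l hl ⟨K, hK⟩
    refine squeeze_zero_norm' (a := fun s => (2 * K * C + K ^ 2 * C) * ρ s) ?_ ?_
    · filter_upwards [hK] with s hs
      have hvs : |v s| ≤ K := hs
      have hK0 : 0 ≤ K := (abs_nonneg _).trans hvs
      calc ‖B s‖ ≤ |(-2 * v s * ρt s)| + |v s ^ 2 * ρs s| := abs_add_le _ _
        _ = 2 * |v s| * |ρt s| + |v s| ^ 2 * |ρs s| := by
          rw [abs_mul, abs_mul, abs_mul, abs_pow]; norm_num
        _ ≤ 2 * K * (C * ρ s) + K ^ 2 * (C * ρ s) := by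
          gcongr
          · exact b2 s
          · exact b1 s
        _ = _ := by ring
    · simpa using hl.const_mul (2 * K * C + K ^ 2 * C)
  -- main integral inequality
  have cvv : Continuous fun s => ρ s * v' s ^ 2 := by fun_prop
  have main : ∫ s in α..β, ρ s * v' s ^ 2 ≤ - ∫ s, ρtt s := by
    have hlim : Tendsto (fun T : ℝ => - (B T - B (-T)) - ∫ s in (-T)..T, ρtt s) atTop
        (𝓝 (-(0 - 0) - ∫ s, ρtt s)) := by
      refine Tendsto.sub (Tendsto.neg (Tendsto.sub (tB _ l1 t1) ?_)) ?_
      · exact (tB _ l2 t2).comp tendsto_neg_atTop_atBot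
      · exact intervalIntegral_tendsto_integral itt tendsto_neg_atTop_atBot tendsto_id
    have hlim' : Tendsto (fun T : ℝ => - (B T - B (-T)) - ∫ s in (-T)..T, ρtt s) atTop
        (𝓝 (- ∫ s, ρtt s)) := by simpa using hlim
    refine ge_of_tendsto hlim' ?_
    filter_upwards [eventually_ge_atTop (|α|), eventually_ge_atTop (|β|)] with T hT1 hT2
    have a1 : -T ≤ α := by linarith [neg_abs_le α]
    have a2 : β ≤ T := by linarith [le_abs_self β]
    calc ∫ s in α..β, ρ s * v' s ^ 2 ≤ ∫ s in (-T)..T, ρ s * v' s ^ 2 := by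
          refine intervalIntegral.integral_mono_interval a1 hαβ a2 ?_ (cvv.intervalIntegrable _ _)
          exact Eventually.of_forall fun s => mul_nonneg (hρ s).le (sq_nonneg _)
      _ ≤ ∫ s in (-T)..T, (- B' s - ρtt s) := by
          refine intervalIntegral.integral_mono_on (by linarith) (cvv.intervalIntegrable _ _)
            ((cB'.neg.sub c6).intervalIntegrable _ _) fun s _ => hB s
      _ = _ := by
          rw [intervalIntegral.integral_sub (cB'.fun_neg.intervalIntegrable _ _)
            (c6.intervalIntegrable _ _), intervalIntegral.integral_neg,
            intervalIntegral.integral_eq_sub_of_hasDerivAt (fun s _ => dB s)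
              (cB'.intervalIntegrable _ _)]
  have main2 : μ * ∫ s in α..β, v' s ^ 2 ≤ - ∫ s, ρtt s := by
    refine le_trans ?_ main
    rw [← intervalIntegral.integral_const_mul]
    have c1 : Continuous fun s => μ * v' s ^ 2 := by fun_prop
    refine intervalIntegral.integral_mono_on hαβ (c1.intervalIntegrable _ _)
      (cvv.intervalIntegrable _ _) fun s hs => ?_
    exact mul_le_mul_of_nonneg_right (hμρ s hs) (sq_nonneg _)
  -- Cauchy-Schwarz
  rcases hαβ.eq_or_lt with rfl | hlt
  · simp
  have hD : ∫ s in α..β, v' s = v β - v α :=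
    intervalIntegral.integral_eq_sub_of_hasDerivAt (fun s _ => dv s) (cv'.intervalIntegrable _ _)
  have hL : 0 < β - α := by linarith
  have cs : (v β - v α) ^ 2 ≤ (β - α) * ∫ s in α..β, v' s ^ 2 := by
    have h1 : 0 ≤ ∫ s in α..β, (v' s - (v β - v α) / (β - α)) ^ 2 :=
      intervalIntegral.integral_nonneg hαβ fun s _ => sq_nonneg _
    have e : ∀ s, (v' s - (v β - v α) / (β - α)) ^ 2 =
      (v' s ^ 2 - (2 * ((v β - v α) / (β - α))) * v' s) + ((v β - v α) / (β - α)) ^ 2 := by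
      intro s; ring
    simp only [e] at h1
    have i1 : IntervalIntegrable (fun s => v' s ^ 2) volume α β := (cv'.pow 2).intervalIntegrable _ _
    have i2 : IntervalIntegrable (fun s => (2 * ((v β - v α) / (β - α))) * v' s) volume α β :=
      (cv'.const_mul _).intervalIntegrable _ _
    rw [intervalIntegral.integral_add (i1.sub i2) (by simp), intervalIntegral.integral_sub i1 i2,
      intervalIntegral.integral_const_mul, hD, intervalIntegral.integral_const] at h1
    simp only [smul_eq_mul] at h1
    have : (β - α) * (((v β - v α) / (β - α)) ^ 2) = (v β - v α) ^ 2 / (β - α) := by field_simp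
    rw [this] at h1
    have h2 : 2 * ((v β - v α) / (β - α)) * (v β - v α) = 2 * ((v β - v α) ^ 2 / (β - α)) := by
      field_simp
    rw [h2] at h1
    have h3 : (v β - v α) ^ 2 / (β - α) ≤ ∫ s in α..β, v' s ^ 2 := by linarith
    rw [div_le_iff₀ hL] at h3
    linarith
  calc (V β / ρ β - V α / ρ α) ^ 2 = (v β - v α) ^ 2 := rfl
    _ ≤ (β - α) * ∫ s in α..β, v' s ^ 2 := cs
    _ = (β - α) / μ * (μ * ∫ s in α..β, v' s ^ 2) := by field_simp
    _ ≤ _ := by gcongr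


/-- partition function -/
noncomputable def lseS {n : ℕ} (ε : ℝ) (l : Fin n → ℝ) : ℝ := ∑ i, Real.exp (l i / ε)
/-- the weight `S ^ (-ε)` -/
noncomputable def lseW {n : ℕ} (ε : ℝ) (l : Fin n → ℝ) : ℝ := Real.exp (-(ε * Real.log (lseS ε l)))
/-- softmax probabilities -/
noncomputable def smx {n : ℕ} (ε : ℝ) (l : Fin n → ℝ) (i : Fin n) : ℝ :=
  Real.exp (l i / ε) / lseS ε l
/-- softmax mean -/
noncomputable def mn {n : ℕ} (ε : ℝ) (l η : Fin n → ℝ) : ℝ := ∑ i, smx ε l i * η i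
/-- second derivative factor -/
noncomputable def hs {n : ℕ} (ε : ℝ) (l η ζ : Fin n → ℝ) : ℝ :=
  mn ε l η * mn ε l ζ - (mn ε l (fun i => η i * ζ i) - mn ε l η * mn ε l ζ) / ε

section lse
variable {n : ℕ} [NeZero n] {ε : ℝ}

theorem lseS_pos (ε : ℝ) (l : Fin n → ℝ) : 0 < lseS ε l := by
  unfold lseS
  exact Finset.sum_pos (fun i _ => Real.exp_pos _) ⟨0, Finset.mem_univ _⟩

theorem lseW_pos (ε : ℝ) (l : Fin n → ℝ) : 0 < lseW ε l := Real.exp_pos _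

theorem smx_pos (ε : ℝ) (l : Fin n → ℝ) (i : Fin n) : 0 < smx ε l i :=
  div_pos (Real.exp_pos _) (lseS_pos ε l)

theorem smx_sum (ε : ℝ) (l : Fin n → ℝ) : ∑ i, smx ε l i = 1 := by
  unfold smx
  rw [← Finset.sum_div]
  exact div_self (lseS_pos ε l).ne'

theorem smx_le_one (ε : ℝ) (l : Fin n → ℝ) (i : Fin n) : smx ε l i ≤ 1 := by
  rw [← smx_sum ε l]
  exact Finset.single_le_sum (fun j _ => (smx_pos ε l j).le) (Finset.mem_univ i)

theorem abs_mn_le (ε : ℝ) (l η : Fin n → ℝ) (R : ℝ) (h : ∀ i, |η i| ≤ R) : |mn ε l η| ≤ R := by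
  unfold mn
  calc |∑ i, smx ε l i * η i| ≤ ∑ i, |smx ε l i * η i| := Finset.abs_sum_le_sum_abs _ _
    _ ≤ ∑ i, smx ε l i * R := by
      refine Finset.sum_le_sum fun i _ => ?_
      rw [abs_mul, abs_of_pos (smx_pos ε l i)]
      exact mul_le_mul_of_nonneg_left (h i) (smx_pos ε l i).le
    _ = R := by rw [← Finset.sum_mul, smx_sum, one_mul]

theorem abs_hs_le (hε : 0 < ε) (l η ζ : Fin n → ℝ) (R : ℝ) (h : ∀ i, |η i| ≤ R)
    (h' : ∀ i, |ζ i| ≤ R) : |hs ε l η ζ| ≤ R ^ 2 + 2 * R ^ 2 / ε := by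
  have hR : 0 ≤ R := (abs_nonneg _).trans (h 0)
  have h1 := abs_mn_le ε l η R h
  have h2 := abs_mn_le ε l ζ R h'
  have h3 := abs_mn_le ε l (fun i => η i * ζ i) (R ^ 2) (fun i => by
    rw [abs_mul, sq]; exact mul_le_mul (h i) (h' i) (abs_nonneg _) hR)
  have h4 : |mn ε l η * mn ε l ζ| ≤ R ^ 2 := by
    rw [abs_mul, sq]; exact mul_le_mul h1 h2 (abs_nonneg _) hR
  unfold hs
  refine (abs_sub _ _).trans ?_
  gcongr
  rw [abs_div, abs_of_pos hε]
  gcongr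
  refine (abs_sub _ _).trans ?_
  linarith

theorem continuous_lseS (ε : ℝ) : Continuous (lseS ε : (Fin n → ℝ) → ℝ) := by
  unfold lseS; fun_prop

theorem continuous_lseW (ε : ℝ) : Continuous (lseW ε : (Fin n → ℝ) → ℝ) := by
  unfold lseW
  exact Real.continuous_exp.comp (((continuous_lseS ε).log fun l => (lseS_pos ε l).ne').const_mul ε).neg

theorem continuous_smx (ε : ℝ) (i : Fin n) : Continuous (fun l : Fin n → ℝ => smx ε l i) := by
  unfold smx
  exact Continuous.div (by fun_prop) (continuous_lseS ε) fun l => (lseS_pos ε l).ne'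

theorem continuous_mn (ε : ℝ) (η : Fin n → ℝ) : Continuous (fun l : Fin n → ℝ => mn ε l η) := by
  unfold mn
  exact continuous_finsetSum _ fun i _ => (continuous_smx ε i).mul continuous_const

theorem continuous_hs (ε : ℝ) (η ζ : Fin n → ℝ) : Continuous (fun l : Fin n → ℝ => hs ε l η ζ) := by
  unfold hs
  have h1 := continuous_mn ε η
  have h2 := continuous_mn ε ζ
  have h3 := continuous_mn ε (fun i => η i * ζ i)
  fun_prop

theorem lseW_le (hε : 0 < ε) (l : Fin n → ℝ) (i : Fin n) : lseW ε l ≤ Real.exp (-(l i)) := by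
  unfold lseW
  rw [Real.exp_le_exp, neg_le_neg_iff]
  have h1 : Real.exp (l i / ε) ≤ lseS ε l :=
    Finset.single_le_sum (f := fun i => Real.exp (l i / ε)) (fun j _ => (Real.exp_pos _).le)
      (Finset.mem_univ i)
  have h2 := Real.log_le_log (Real.exp_pos _) h1
  rw [Real.log_exp, div_le_iff₀ hε] at h2
  linarith

theorem le_lseW (hε : 0 < ε) (l : Fin n → ℝ) (M : ℝ) (h : ∀ i, l i ≤ M) :
    Real.exp (-(ε * Real.log n) - M) ≤ lseW ε l := by
  unfold lseW
  rw [Real.exp_le_exp]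
  have h1 : lseS ε l ≤ n * Real.exp (M / ε) := by
    unfold lseS
    calc ∑ i, Real.exp (l i / ε) ≤ ∑ i : Fin n, Real.exp (M / ε) := by
          gcongr with i; exact h i
      _ = _ := by simp
  have hn : (0:ℝ) < n := by exact_mod_cast Nat.pos_of_ne_zero (NeZero.ne n)
  have h2 := Real.log_le_log (lseS_pos ε l) h1
  rw [Real.log_mul hn.ne' (Real.exp_pos _).ne', Real.log_exp] at h2
  have h3 : ε * Real.log (lseS ε l) ≤ ε * (Real.log n + M / ε) := by gcongr
  have h4 : ε * (Real.log n + M / ε) = ε * Real.log n + M := by field_simp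
  linarith

theorem lseW_mid (hε : 0 < ε) (l l' : Fin n → ℝ) :
    lseW ε l * lseW ε l' ≤ lseW ε ((1 / 2 : ℝ) • (l + l')) ^ 2 := by
  have h1 : lseS ε ((1 / 2 : ℝ) • (l + l')) ^ 2 ≤ lseS ε l * lseS ε l' := by
    unfold lseS
    have e : ∀ i, Real.exp (((1 / 2 : ℝ) • (l + l')) i / ε) =
        Real.exp (l i / ε / 2) * Real.exp (l' i / ε / 2) := by
      intro i
      rw [← Real.exp_add]; congr 1; simp; ring
    have e2 : ∀ x : ℝ, Real.exp x = Real.exp (x / 2) ^ 2 := by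
      intro x; rw [← Real.exp_nat_mul]; congr 1; push_cast; ring
    rw [Finset.sum_congr rfl fun i _ => e i, Finset.sum_congr rfl fun i _ => e2 (l i / ε),
      Finset.sum_congr rfl fun i _ => e2 (l' i / ε)]
    exact Finset.sum_mul_sq_le_sq_mul_sq _ _ _
  unfold lseW
  rw [← Real.exp_add, ← Real.exp_nat_mul, Real.exp_le_exp]
  have h2 := Real.log_le_log (pow_pos (lseS_pos ε _) 2) h1
  rw [Real.log_pow, Real.log_mul (lseS_pos ε _).ne' (lseS_pos ε _).ne'] at h2
  push_cast at h2 ⊢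
  nlinarith

theorem hasDerivAt_lseS (ε : ℝ) (l η : Fin n → ℝ) (t : ℝ) :
    HasDerivAt (fun t : ℝ => lseS ε (l + t • η))
      (lseS ε (l + t • η) * mn ε (l + t • η) η / ε) t := by
  have h : ∀ i, HasDerivAt (fun t : ℝ => Real.exp ((l + t • η) i / ε))
      (Real.exp ((l + t • η) i / ε) * (η i / ε)) t := by
    intro i
    refine HasDerivAt.exp ?_
    refine HasDerivAt.div_const ?_ ε
    simpa using ((hasDerivAt_id t).mul_const (η i)).const_add (l i)
  refine (HasDerivAt.fun_sum fun i _ => h i).congr_deriv ?_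
  unfold mn
  rw [Finset.mul_sum, Finset.sum_div]
  refine Finset.sum_congr rfl fun i _ => ?_
  unfold smx
  have := (lseS_pos ε (l + t • η)).ne'
  field_simp

theorem hasDerivAt_lseW (hε : 0 < ε) (l η : Fin n → ℝ) (t : ℝ) :
    HasDerivAt (fun t : ℝ => lseW ε (l + t • η))
      (-(mn ε (l + t • η) η) * lseW ε (l + t • η)) t := by
  have h1 := (((hasDerivAt_lseS ε l η t).log (lseS_pos ε _).ne').const_mul ε).fun_neg.exp
  refine h1.congr_deriv ?_
  have := (lseS_pos ε (l + t • η)).ne'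
  unfold lseW
  field_simp

theorem hasDerivAt_smx (ε : ℝ) (l η : Fin n → ℝ) (t : ℝ) (i : Fin n) :
    HasDerivAt (fun t : ℝ => smx ε (l + t • η) i)
      (smx ε (l + t • η) i * (η i - mn ε (l + t • η) η) / ε) t := by
  have h : HasDerivAt (fun t : ℝ => Real.exp ((l + t • η) i / ε))
      (Real.exp ((l + t • η) i / ε) * (η i / ε)) t := by
    refine HasDerivAt.exp ?_
    refine HasDerivAt.div_const ?_ ε
    simpa using ((hasDerivAt_id t).mul_const (η i)).const_add (l i)
  refine (h.div (hasDerivAt_lseS ε l η t) (lseS_pos ε _).ne').congr_deriv ?_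
  have := (lseS_pos ε (l + t • η)).ne'
  unfold smx
  field_simp

theorem hasDerivAt_mn (ε : ℝ) (l η ζ : Fin n → ℝ) (t : ℝ) :
    HasDerivAt (fun t : ℝ => mn ε (l + t • η) ζ)
      ((mn ε (l + t • η) (fun i => η i * ζ i) - mn ε (l + t • η) η * mn ε (l + t • η) ζ) / ε) t := by
  refine (HasDerivAt.fun_sum fun i _ => (hasDerivAt_smx ε l η t i).mul_const (ζ i)).congr_deriv ?_
  generalize hm : mn ε (l + t • η) η = m
  unfold mn
  rw [Finset.mul_sum, ← Finset.sum_sub_distrib, Finset.sum_div]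
  refine Finset.sum_congr rfl fun i _ => ?_
  ring

theorem hasDerivAt_mnW (hε : 0 < ε) (l η ζ : Fin n → ℝ) (t : ℝ) :
    HasDerivAt (fun t : ℝ => -(mn ε (l + t • η) ζ) * lseW ε (l + t • η))
      (hs ε (l + t • η) η ζ * lseW ε (l + t • η)) t := by
  refine ((hasDerivAt_mn ε l η ζ t).fun_neg.mul (hasDerivAt_lseW hε l η t)).congr_deriv ?_
  unfold hs
  ring

theorem mn_add (ε : ℝ) (l η ζ : Fin n → ℝ) (a b : ℝ) :
    mn ε l (fun i => a * η i + b * ζ i) = a * mn ε l η + b * mn ε l ζ := by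
  unfold mn
  rw [Finset.mul_sum, Finset.mul_sum, ← Finset.sum_add_distrib]
  exact Finset.sum_congr rfl fun i _ => by ring

theorem hs_add (ε : ℝ) (l η ζ : Fin n → ℝ) (a b : ℝ) :
    hs ε l (fun i => a * η i + b * ζ i) (fun i => a * η i + b * ζ i) =
      a ^ 2 * hs ε l η η + 2 * a * b * hs ε l η ζ + b ^ 2 * hs ε l ζ ζ := by
  have e : mn ε l (fun i => (a * η i + b * ζ i) * (a * η i + b * ζ i)) =
      a ^ 2 * mn ε l (fun i => η i * η i) + 2 * a * b * mn ε l (fun i => η i * ζ i) +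
      b ^ 2 * mn ε l (fun i => ζ i * ζ i) := by
    unfold mn
    rw [Finset.mul_sum, Finset.mul_sum, Finset.mul_sum, ← Finset.sum_add_distrib,
      ← Finset.sum_add_distrib]
    exact Finset.sum_congr rfl fun i _ => by ring
  unfold hs
  rw [e, mn_add]
  ring

end lse


theorem exp_decay_bound (δ : ℝ) (hδ : 0 < δ) (N : ℕ) (t : ℝ) (ht : 0 ≤ t) :
    Real.exp (-(δ * t)) ≤ (N.factorial * Real.exp δ / δ ^ N) * ((1 + t) ^ N)⁻¹ := by
  have h1 := Real.pow_div_factorial_le_exp (δ * (1 + t)) (by positivity) N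
  rw [div_le_iff₀ (by positivity), mul_pow] at h1
  have h2 : Real.exp (δ * (1 + t)) = Real.exp δ / Real.exp (-(δ * t)) := by
    rw [← Real.exp_sub]; congr 1; ring
  rw [h2] at h1
  have hE := Real.exp_pos (-(δ * t))
  rw [div_mul_eq_mul_div, le_div_iff₀ hE] at h1
  rw [← div_eq_mul_inv, le_div_iff₀ (by positivity), le_div_iff₀ (by positivity)]
  linarith

open MeasureTheory in
theorem integrable_exp_norm {E : Type*} [NormedAddCommGroup E] [NormedSpace ℝ E]
    [FiniteDimensional ℝ E] [MeasurableSpace E] [BorelSpace E] (μ : Measure E) [μ.IsAddHaarMeasure]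
    (δ : ℝ) (hδ : 0 < δ) : Integrable (fun z : E => Real.exp (-(δ * ‖z‖))) μ := by
  set N := Module.finrank ℝ E + 1
  have h := integrable_one_add_norm (E := E) (μ := μ) (r := (N : ℝ)) (by simp [N])
  refine (h.const_mul (N.factorial * Real.exp δ / δ ^ N)).mono' (by fun_prop) ?_
  refine Filter.Eventually.of_forall fun z => ?_
  rw [Real.norm_of_nonneg (Real.exp_pos _).le]
  refine (exp_decay_bound δ hδ N ‖z‖ (norm_nonneg _)).trans_eq ?_
  rw [Real.rpow_neg (by positivity), Real.rpow_natCast]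

/-- linear coordinates adapted to a unit vector `e` -/
structure IsSlice {m : ℕ} (e : EuclideanSpace ℝ (Fin (m + 1)))
    (Ψ : (ℝ × (Fin m → ℝ)) ≃L[ℝ] EuclideanSpace ℝ (Fin (m + 1))) : Prop where
  mp : MeasureTheory.MeasurePreserving Ψ MeasureTheory.volume MeasureTheory.volume
  one : Ψ (1, 0) = e
  inner : ∀ s z, inner ℝ (Ψ (s, z)) e = s
  norm : ∀ s z, ‖z‖ ≤ ‖Ψ (s, z)‖

open MeasureTheory in
theorem exists_slice {m : ℕ} (e : EuclideanSpace ℝ (Fin (m + 1))) (he : ‖e‖ = 1) :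
    ∃ Ψ, IsSlice e Ψ := by
  obtain ⟨b, hb⟩ : ∃ b : OrthonormalBasis (Fin (m + 1)) ℝ (EuclideanSpace ℝ (Fin (m + 1))),
      b 0 = e := by
    have := Orthonormal.exists_orthonormalBasis_extension_of_card_eq (𝕜 := ℝ)
      (E := EuclideanSpace ℝ (Fin (m + 1))) (ι := Fin (m + 1)) (by simp) (v := fun _ => e) (s := {0})
      (by
        constructor
        · intro i; simpa using he
        · intro i j hij
          exact absurd (Subsingleton.elim i j) hij)
    obtain ⟨b, hb⟩ := this
    exact ⟨b, hb 0 rfl⟩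
  let L1 : (ℝ × (Fin m → ℝ)) ≃ₗ[ℝ] (Fin (m + 1) → ℝ) := Fin.consLinearEquiv ℝ (fun _ => ℝ)
  let L : (ℝ × (Fin m → ℝ)) ≃ₗ[ℝ] EuclideanSpace ℝ (Fin (m + 1)) :=
    (L1.trans (WithLp.linearEquiv 2 ℝ (Fin (m + 1) → ℝ)).symm).trans b.repr.symm.toLinearEquiv
  have hL : ∀ p, L p = b.repr.symm (WithLp.toLp 2 (Fin.cons p.1 p.2)) := fun p => rfl
  have hrepr : ∀ p, b.repr (L p) = WithLp.toLp 2 (Fin.cons p.1 p.2) := fun p => by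
    rw [hL]; simp
  refine ⟨L.toContinuousLinearEquiv, ?_, ?_, ?_, ?_⟩
  · have m1 := (volume_preserving_piFinSuccAbove (fun _ : Fin (m + 1) => ℝ) 0).symm
    have m2 := (EuclideanSpace.volume_preserving_symm_measurableEquiv_toLp (Fin (m + 1))).symm
    have m3 := b.measurePreserving_repr_symm
    have := m3.comp (m2.comp m1)
    have hcons : ∀ p : ℝ × (Fin m → ℝ),
        (MeasurableEquiv.piFinSuccAbove (fun _ : Fin (m + 1) => ℝ) 0).symm p
          = Fin.cons p.1 p.2 := by
      intro p
      simp [MeasurableEquiv.piFinSuccAbove]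
      rfl
    have heq : (L.toContinuousLinearEquiv : ℝ × (Fin m → ℝ) → EuclideanSpace ℝ (Fin (m + 1))) =
        b.repr.symm ∘ (MeasurableEquiv.toLp 2 (Fin (m + 1) → ℝ)).symm.symm ∘
          (MeasurableEquiv.piFinSuccAbove (fun _ : Fin (m + 1) => ℝ) 0).symm := by
      funext p
      change L p = b.repr.symm (WithLp.toLp 2
        ((MeasurableEquiv.piFinSuccAbove (fun _ : Fin (m + 1) => ℝ) 0).symm p))
      rw [hL, hcons]
    rw [heq]
    exact this
  · change L (1, 0) = e
    rw [hL, ← hb, ← b.repr_symm_single]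
    congr 2
    ext i
    refine Fin.cases ?_ (fun j => ?_) i
    · simp
    · simp
  · intro s z
    change inner ℝ (L (s, z)) e = s
    rw [← hb, real_inner_comm, ← b.repr_apply_apply, hrepr]
    simp
  · intro s z
    change ‖z‖ ≤ ‖L (s, z)‖
    rw [pi_norm_le_iff_of_nonneg (norm_nonneg _)]
    intro i
    have h1 := b.repr_apply_apply (L (s, z)) i.succ
    rw [hrepr] at h1
    simp only [Fin.cons_succ] at h1
    rw [h1]
    refine (norm_inner_le_norm _ _).trans ?_
    simp

section slice
open MeasureTheory Set Filter Topology
variable {m : ℕ} {e : EuclideanSpace ℝ (Fin (m + 1))}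
  {Ψ : (ℝ × (Fin m → ℝ)) ≃L[ℝ] EuclideanSpace ℝ (Fin (m + 1))}

theorem IsSlice.norm_e (h : IsSlice e Ψ) : ‖e‖ = 1 := by
  have h1 := h.inner 1 0
  rw [h.one, real_inner_self_eq_norm_sq] at h1
  nlinarith [norm_nonneg e]

theorem IsSlice.add (h : IsSlice e Ψ) (s t : ℝ) (z : Fin m → ℝ) :
    Ψ (s + t, z) = Ψ (s, z) + t • e := by
  rw [← h.one, ← map_smul, ← map_add]; simp

theorem IsSlice.abs_le (h : IsSlice e Ψ) (s : ℝ) (z : Fin m → ℝ) : |s| ≤ ‖Ψ (s, z)‖ := by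
  have h1 := h.inner s z
  have h2 := abs_real_inner_le_norm (Ψ (s, z)) e
  rw [h1, h.norm_e, mul_one] at h2
  exact h2

/-- decaying continuous functions -/
structure Decay {m : ℕ} (δ K : ℝ) (g : EuclideanSpace ℝ (Fin (m + 1)) → ℝ) : Prop where
  cont : Continuous g
  bound : ∀ z, |g z| ≤ K * Real.exp (-(δ * ‖z‖))

variable {δ K : ℝ} {g g' : EuclideanSpace ℝ (Fin (m + 1)) → ℝ}

theorem Decay.integrable (hg : Decay δ K g) (hδ : 0 < δ) : Integrable g :=
  ((integrable_exp_norm volume δ hδ).const_mul K).mono' hg.cont.aestronglyMeasurable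
    (Eventually.of_forall hg.bound)

theorem Decay.K_nonneg (hg : Decay δ K g) : 0 ≤ K := by
  have := (abs_nonneg _).trans (hg.bound 0)
  exact nonneg_of_mul_nonneg_left this (Real.exp_pos _)

theorem Decay.slice_bound (hg : Decay δ K g) (hδ : 0 < δ) (h : IsSlice e Ψ) (s : ℝ)
    (z : Fin m → ℝ) : |g (Ψ (s, z))| ≤ K * Real.exp (-(δ / 2 * |s|)) * Real.exp (-(δ / 2 * ‖z‖)) := by
  refine (hg.bound _).trans ?_
  rw [mul_assoc, ← Real.exp_add]
  refine mul_le_mul_of_nonneg_left ?_ hg.K_nonneg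
  rw [Real.exp_le_exp]
  have h1 := h.abs_le s z
  have h2 := h.norm s z
  nlinarith

theorem Decay.slice_bound' (hg : Decay δ K g) (hδ : 0 < δ) (h : IsSlice e Ψ) (s : ℝ)
    (z : Fin m → ℝ) : |g (Ψ (s, z))| ≤ K * Real.exp (-(δ / 2 * ‖z‖)) := by
  refine (hg.slice_bound hδ h s z).trans ?_
  have : Real.exp (-(δ / 2 * |s|)) ≤ 1 := by
    rw [Real.exp_le_one_iff]; have := abs_nonneg s; nlinarith
  have hK := hg.K_nonneg
  have h0 := Real.exp_pos (-(δ / 2 * ‖z‖))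
  nlinarith [mul_nonneg hK h0.le]

theorem Decay.slice_integrable (hg : Decay δ K g) (hδ : 0 < δ) (h : IsSlice e Ψ) (s : ℝ) :
    Integrable fun z => g (Ψ (s, z)) := by
  refine ((integrable_exp_norm volume (δ / 2) (by positivity)).const_mul K).mono' ?_
    (Eventually.of_forall (hg.slice_bound' hδ h s))
  exact (hg.cont.comp (by fun_prop)).aestronglyMeasurable

theorem Decay.slice_cont (hg : Decay δ K g) (hδ : 0 < δ) (h : IsSlice e Ψ) :
    Continuous fun s => ∫ z, g (Ψ (s, z)) := by
  refine continuous_of_dominated (fun s => (hg.slice_integrable hδ h s).aestronglyMeasurable)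
    (fun s => Eventually.of_forall (hg.slice_bound' hδ h s))
    ((integrable_exp_norm volume (δ / 2) (by positivity)).const_mul K) ?_
  exact Eventually.of_forall fun z => hg.cont.comp (by fun_prop)

theorem Decay.slice_decay (hg : Decay δ K g) (hδ : 0 < δ) (h : IsSlice e Ψ) (s : ℝ) :
    |∫ z, g (Ψ (s, z))| ≤
      (K * ∫ z : Fin m → ℝ, Real.exp (-(δ / 2 * ‖z‖))) * Real.exp (-(δ / 2 * |s|)) := by
  rw [← Real.norm_eq_abs]
  refine (norm_integral_le_integral_norm _).trans ?_
  calc ∫ z, ‖g (Ψ (s, z))‖ ≤ ∫ z : Fin m → ℝ, K * Real.exp (-(δ / 2 * |s|)) * Real.exp (-(δ / 2 * ‖z‖)) :=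
        integral_mono (hg.slice_integrable hδ h s).norm
          ((integrable_exp_norm volume (δ / 2) (by positivity)).const_mul _)
          (hg.slice_bound hδ h s)
    _ = _ := by rw [integral_const_mul]; ring

theorem Decay.fubini (hg : Decay δ K g) (hδ : 0 < δ) (h : IsSlice e Ψ) :
    Integrable (fun s => ∫ z, g (Ψ (s, z))) ∧ ∫ s, ∫ z, g (Ψ (s, z)) = ∫ x, g x := by
  have hm : MeasurableEmbedding Ψ := Ψ.toHomeomorph.measurableEmbedding
  have h1 := (h.mp.integrable_comp_emb hm).mpr (hg.integrable hδ)
  have h2 := h.mp.integral_comp hm g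
  rw [Measure.volume_eq_prod] at h1 h2
  refine ⟨h1.integral_prod_left, ?_⟩
  rw [← h2]
  exact (integral_prod _ h1).symm

/-- differentiation under the integral sign -/
theorem diff_under_int (F F' : ℝ → (Fin m → ℝ) → ℝ) (t0 δ K : ℝ) (hδ : 0 < δ)
    (c1 : ∀ t, Continuous (F t)) (c2 : Continuous (F' t0))
    (b1 : ∀ z, |F t0 z| ≤ K * Real.exp (-(δ * ‖z‖)))
    (b2 : ∀ t z, |t - t0| < 1 → |F' t z| ≤ K * Real.exp (-(δ * ‖z‖)))
    (d : ∀ t z, HasDerivAt (fun t => F t z) (F' t z) t) :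
    HasDerivAt (fun t => ∫ z, F t z) (∫ z, F' t0 z) t0 := by
  have hi := (integrable_exp_norm (volume : Measure (Fin m → ℝ)) δ hδ).const_mul K
  refine (hasDerivAt_integral_of_dominated_loc_of_deriv_le (Metric.ball_mem_nhds t0 one_pos)
    (Eventually.of_forall fun t => (c1 t).aestronglyMeasurable)
    (hi.mono' (c1 t0).aestronglyMeasurable (Eventually.of_forall b1)) c2.aestronglyMeasurable
    (Eventually.of_forall fun z t ht => ?_) hi (Eventually.of_forall fun z t _ => d t z)).2
  exact b2 t z (by simpa [Real.dist_eq] using ht)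

theorem Decay.slice_deriv (hg : Decay δ K g) (hg' : Decay δ K g') (hδ : 0 < δ)
    (h : IsSlice e Ψ) (d : ∀ z, HasDerivAt (fun t : ℝ => g (z + t • e)) (g' z) 0) (s : ℝ) :
    HasDerivAt (fun s => ∫ z, g (Ψ (s, z))) (∫ z, g' (Ψ (s, z))) s := by
  refine diff_under_int (fun s z => g (Ψ (s, z))) (fun s z => g' (Ψ (s, z))) s (δ / 2) K
    (by positivity) (fun t => hg.cont.comp (by fun_prop)) (hg'.cont.comp (by fun_prop))
    (hg.slice_bound' hδ h s) (fun t z _ => hg'.slice_bound' hδ h t z) ?_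
  intro t z
  have h1 := (d (Ψ (t, z)))
  have h2 : HasDerivAt (fun u : ℝ => u - t) 1 t := (hasDerivAt_id t).sub_const t
  have h3 : HasDerivAt (fun u : ℝ => g (Ψ (t, z) + u • e)) (g' (Ψ (t, z))) (t - t) := by simpa using h1
  have h4 := h3.comp (h := fun u : ℝ => u - t) t h2
  rw [mul_one] at h4
  refine h4.congr_of_eventuallyEq (Eventually.of_forall fun u => ?_)
  simp only [Function.comp]
  rw [← h.add]; simp

end slice


open Filter Topology Set in
theorem logconc_deriv (f f' : ℝ → ℝ) (f2 : ℝ) (d1 : ∀ t, HasDerivAt f (f' t) t)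
    (d2 : HasDerivAt f' f2 0) (h : ∀ t, f t * f (-t) ≤ f 0 ^ 2) : f 0 * f2 ≤ f' 0 ^ 2 := by
  by_contra hcon
  push Not at hcon
  let k : ℝ → ℝ := fun t => f' t * f (-t) - f t * f' (-t)
  have dneg : ∀ t, HasDerivAt (fun t => f (-t)) (- f' (-t)) t := fun t => by
    simpa [Function.comp_def] using (d1 (-t)).comp t (hasDerivAt_neg t)
  have dneg2 : HasDerivAt (fun t => f' (-t)) (- f2) 0 := by
    have : HasDerivAt f' f2 (-0) := by simpa using d2
    simpa [Function.comp_def] using this.comp 0 (hasDerivAt_neg 0)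
  have dP : ∀ t, HasDerivAt (fun t => f t * f (-t)) (k t) t := fun t =>
    ((d1 t).mul (dneg t)).congr_deriv (by simp only [k]; ring)
  have dk : HasDerivAt k (2 * (f 0 * f2 - f' 0 ^ 2)) 0 := by
    refine ((d2.mul (dneg 0)).sub ((d1 0).mul dneg2)).congr_deriv ?_
    simp; ring
  have hk0 : k 0 = 0 := by simp [k]; ring
  have hpos : ∀ᶠ t in 𝓝[>] (0:ℝ), 0 < k t := by
    have h1 := hasDerivAt_iff_tendsto_slope.mp dk
    have h2 : ∀ᶠ t in 𝓝[≠] (0:ℝ), 0 < slope k 0 t := h1.eventually_const_lt (by linarith)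
    have h3 : ∀ᶠ t in 𝓝[>] (0:ℝ), 0 < slope k 0 t :=
      h2.filter_mono (nhdsWithin_mono 0 fun x hx => ne_of_gt hx)
    filter_upwards [h3, self_mem_nhdsWithin] with t ht ht0
    rw [slope_def_field, hk0, sub_zero, sub_zero] at ht
    exact (div_pos_iff_of_pos_right ht0).mp ht
  obtain ⟨r, hr, hr2⟩ := mem_nhdsGT_iff_exists_Ioo_subset.mp hpos
  have hr : 0 < r := hr
  have hmono : StrictMonoOn (fun t => f t * f (-t)) (Icc 0 (r / 2)) := by
    refine strictMonoOn_of_deriv_pos (convex_Icc _ _)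
      (fun t _ => (dP t).continuousAt.continuousWithinAt) fun t ht => ?_
    rw [interior_Icc] at ht
    rw [(dP t).deriv]
    exact hr2 ⟨ht.1, by linarith [ht.2]⟩
  have := hmono (left_mem_Icc.mpr (by linarith)) (right_mem_Icc.mpr (by linarith)) (by linarith : (0:ℝ) < r / 2)
  simp only [neg_zero] at this
  have h5 := h (r / 2)
  nlinarith

/-- the linear map `z ↦ (⟪z, c i⟫)` -/
noncomputable def lin {n m : ℕ} (c : Fin n → EuclideanSpace ℝ (Fin (m + 1)))
    (z : EuclideanSpace ℝ (Fin (m + 1))) : Fin n → ℝ := fun i => inner ℝ z (c i)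

/-- quantitative version of `0 ∈ interior (convexHull c)` -/
def Good {n m : ℕ} (c : Fin n → EuclideanSpace ℝ (Fin (m + 1))) (δ : ℝ) : Prop :=
  ∀ z : EuclideanSpace ℝ (Fin (m + 1)), ∃ i, δ * ‖z‖ ≤ inner ℝ z (c i)

theorem Decay.mono {m : ℕ} {δ K K' : ℝ} {g : EuclideanSpace ℝ (Fin (m + 1)) → ℝ}
    (h : Decay δ K g) (hK : K ≤ K') : Decay δ K' g :=
  ⟨h.cont, fun z => (h.bound z).trans (mul_le_mul_of_nonneg_right hK (Real.exp_pos _).le)⟩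

section main
open MeasureTheory Set Filter Topology
variable {n m : ℕ} [NeZero n] {c : Fin n → EuclideanSpace ℝ (Fin (m + 1))} {δ ε : ℝ}

theorem continuous_lin : Continuous (lin c) := by
  unfold lin; fun_prop

theorem lin_add_smul (z e : EuclideanSpace ℝ (Fin (m + 1))) (t : ℝ) :
    lin c (z + t • e) = lin c z + t • lin c e := by
  ext i; simp [lin, inner_add_left, inner_smul_left]

theorem lseW_lin_le (hε : 0 < ε) (hg : Good c δ) (z : EuclideanSpace ℝ (Fin (m + 1))) :
    lseW ε (lin c z) ≤ Real.exp (-(δ * ‖z‖)) := by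
  obtain ⟨i, hi⟩ := hg z
  refine (lseW_le hε (lin c z) i).trans ?_
  rw [Real.exp_le_exp, neg_le_neg_iff]
  exact hi

theorem decay_W (hε : 0 < ε) (hg : Good c δ) : Decay δ 1 (fun z => lseW ε (lin c z)) := by
  refine ⟨(continuous_lseW ε).comp continuous_lin, fun z => ?_⟩
  rw [abs_of_pos (lseW_pos _ _), one_mul]
  exact lseW_lin_le hε hg z

theorem decay_mulW (hε : 0 < ε) (hg : Good c δ) (k : (Fin n → ℝ) → ℝ) (hk : Continuous k) (R : ℝ)
    (hR : ∀ l, |k l| ≤ R) : Decay δ R (fun z => k (lin c z) * lseW ε (lin c z)) := by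
  refine ⟨(hk.comp continuous_lin).mul ((continuous_lseW ε).comp continuous_lin), fun z => ?_⟩
  rw [abs_mul, abs_of_pos (lseW_pos _ _)]
  exact mul_le_mul (hR _) (lseW_lin_le hε hg z) (lseW_pos _ _).le ((abs_nonneg _).trans (hR 0))

variable {e : EuclideanSpace ℝ (Fin (m + 1))}
  {Ψ : (ℝ × (Fin m → ℝ)) ≃L[ℝ] EuclideanSpace ℝ (Fin (m + 1))}

theorem exists_bound (η : Fin n → ℝ) : ∃ R, ∀ i, |η i| ≤ R := by
  refine ⟨∑ i, |η i|, fun i => ?_⟩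
  exact Finset.single_le_sum (f := fun i => |η i|) (fun j _ => abs_nonneg _) (Finset.mem_univ i)

theorem slice_hess (hε : 0 < ε) (hδ : 0 < δ) (hg : Good c δ) (h : IsSlice e Ψ) (η : Fin n → ℝ)
    (s : ℝ) :
    (∫ z, lseW ε (lin c (Ψ (s, z)))) *
      (∫ z, hs ε (lin c (Ψ (s, z))) η η * lseW ε (lin c (Ψ (s, z)))) ≤
    (∫ z, -(mn ε (lin c (Ψ (s, z))) η) * lseW ε (lin c (Ψ (s, z)))) ^ 2 := by
  obtain ⟨R, hR⟩ := exists_bound η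
  have hR0 : 0 ≤ R := (abs_nonneg _).trans (hR 0)
  have cl : Continuous fun z : Fin m → ℝ => lin c (Ψ (s, z)) :=
    continuous_lin.comp (by fun_prop)
  have cl' : ∀ t : ℝ, Continuous fun z : Fin m → ℝ => lin c (Ψ (s, z)) + t • η := fun t =>
    cl.add continuous_const
  have bW : ∀ (t : ℝ) z, lseW ε (lin c (Ψ (s, z)) + t • η) ≤
      Real.exp (|t| * R) * Real.exp (-(δ * ‖z‖)) := by
    intro t z
    obtain ⟨i, hi⟩ := hg (Ψ (s, z))
    refine (lseW_le hε _ i).trans ?_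
    rw [← Real.exp_add, Real.exp_le_exp]
    have h1 : -(t * η i) ≤ |t| * R := by
      refine (neg_le_abs _).trans ?_
      rw [abs_mul]
      exact mul_le_mul_of_nonneg_left (hR i) (abs_nonneg _)
    have h2 : δ * ‖z‖ ≤ δ * ‖Ψ (s, z)‖ := mul_le_mul_of_nonneg_left (h.norm s z) hδ.le
    simp only [lin, Pi.add_apply, Pi.smul_apply, smul_eq_mul]
    linarith
  have bW1 : ∀ (t0 t : ℝ) z, |t - t0| < 1 → lseW ε (lin c (Ψ (s, z)) + t • η) ≤
      Real.exp ((|t0| + 1) * R) * Real.exp (-(δ * ‖z‖)) := by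
    intro t0 t z ht
    refine (bW t z).trans ?_
    gcongr
    have := abs_sub_abs_le_abs_sub t t0
    linarith
  have bmul : ∀ (k : (Fin n → ℝ) → ℝ) (R' : ℝ), (∀ l, |k l| ≤ R') → ∀ (t0 t : ℝ) z, |t - t0| < 1 →
      |k (lin c (Ψ (s, z)) + t • η) * lseW ε (lin c (Ψ (s, z)) + t • η)| ≤
      (R' * Real.exp ((|t0| + 1) * R)) * Real.exp (-(δ * ‖z‖)) := by
    intro k R' hk t0 t z ht
    rw [abs_mul, abs_of_pos (lseW_pos _ _), mul_assoc]
    exact mul_le_mul (hk _) (bW1 t0 t z ht) (lseW_pos _ _).le ((abs_nonneg _).trans (hk 0))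
  have bm : ∀ l, |-(mn ε l η)| ≤ R := fun l => by rw [abs_neg]; exact abs_mn_le ε l η R hR
  have d1 : ∀ t : ℝ, HasDerivAt (fun t : ℝ => ∫ z, lseW ε (lin c (Ψ (s, z)) + t • η))
      (∫ z, -(mn ε (lin c (Ψ (s, z)) + t • η) η) * lseW ε (lin c (Ψ (s, z)) + t • η)) t := by
    intro t0
    refine diff_under_int (fun t z => lseW ε (lin c (Ψ (s, z)) + t • η))
      (fun t z => -(mn ε (lin c (Ψ (s, z)) + t • η) η) * lseW ε (lin c (Ψ (s, z)) + t • η)) t0 δ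
      ((R + 1) * Real.exp ((|t0| + 1) * R)) hδ (fun t => (continuous_lseW ε).comp (cl' t))
      (((continuous_mn ε η).comp (cl' t0)).neg.mul ((continuous_lseW ε).comp (cl' t0))) ?_ ?_ ?_
    · intro z
      rw [abs_of_pos (lseW_pos _ _)]
      refine (bW1 t0 t0 z (by simp)).trans ?_
      gcongr
      have := Real.exp_pos ((|t0| + 1) * R)
      nlinarith
    · intro t z ht
      refine (bmul (fun l => -(mn ε l η)) R bm t0 t z ht).trans ?_
      gcongr
      linarith
    · intro t z
      exact hasDerivAt_lseW hε _ _ t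
  have d2 : HasDerivAt
      (fun t : ℝ => ∫ z, -(mn ε (lin c (Ψ (s, z)) + t • η) η) * lseW ε (lin c (Ψ (s, z)) + t • η))
      (∫ z, hs ε (lin c (Ψ (s, z)) + (0:ℝ) • η) η η * lseW ε (lin c (Ψ (s, z)) + (0:ℝ) • η)) 0 := by
    refine diff_under_int
      (fun t z => -(mn ε (lin c (Ψ (s, z)) + t • η) η) * lseW ε (lin c (Ψ (s, z)) + t • η))
      (fun t z => hs ε (lin c (Ψ (s, z)) + t • η) η η * lseW ε (lin c (Ψ (s, z)) + t • η)) 0 δ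
      ((R + (R ^ 2 + 2 * R ^ 2 / ε)) * Real.exp ((|(0:ℝ)| + 1) * R)) hδ
      (fun t => ((continuous_mn ε η).comp (cl' t)).neg.mul ((continuous_lseW ε).comp (cl' t)))
      (((continuous_hs ε η η).comp (cl' 0)).mul ((continuous_lseW ε).comp (cl' 0))) ?_ ?_ ?_
    · intro z
      refine (bmul (fun l => -(mn ε l η)) R bm 0 0 z (by simp)).trans ?_
      gcongr
      have : 0 ≤ R ^ 2 + 2 * R ^ 2 / ε := by positivity
      linarith
    · intro t z ht
      refine (bmul (fun l => hs ε l η η) _ (fun l => abs_hs_le hε l η η R hR hR) 0 t z ht).trans ?_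
      exact mul_le_mul_of_nonneg_right (mul_le_mul_of_nonneg_right (by linarith)
        (Real.exp_pos _).le) (Real.exp_pos _).le
    · intro t z
      exact hasDerivAt_mnW hε _ _ _ t
  have key := logconc_deriv _ _ _ d1 d2 ?_
  · simpa using key
  -- Prekopa-Leindler
  intro t
  have hintg : ∀ t : ℝ, Integrable fun z : Fin m → ℝ => lseW ε (lin c (Ψ (s, z)) + t • η) := by
    intro t
    refine ((integrable_exp_norm volume δ hδ).const_mul (Real.exp (|t| * R))).mono'
      ((continuous_lseW ε).comp (cl' t)).aestronglyMeasurable (Eventually.of_forall fun z => ?_)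
    rw [Real.norm_of_nonneg (lseW_pos _ _).le]
    exact bW t z
  have hco : ∀ t : ℝ, ENNReal.ofReal (∫ z : Fin m → ℝ, lseW ε (lin c (Ψ (s, z)) + t • η)) =
      ∫⁻ z : Fin m → ℝ, ENNReal.ofReal (lseW ε (lin c (Ψ (s, z)) + t • η)) := fun t =>
    ofReal_integral_eq_lintegral_ofReal (hintg t) (Eventually.of_forall fun z => (lseW_pos _ _).le)
  have hnn : ∀ t : ℝ, 0 ≤ ∫ z : Fin m → ℝ, lseW ε (lin c (Ψ (s, z)) + t • η) := fun t =>
    integral_nonneg fun z => (lseW_pos _ _).le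
  have hmeas : ∀ t : ℝ, Measurable fun z : Fin m → ℝ =>
      ENNReal.ofReal (lseW ε (lin c (Ψ (s, z)) + t • η)) := fun t =>
    (((continuous_lseW ε).comp (cl' t)).measurable).ennreal_ofReal
  have pl := prekopa_leindler m _ _ _ (hmeas t) (hmeas (-t)) (hmeas 0) ?_
  · rw [← hco, ← hco, ← hco, ← ENNReal.ofReal_mul (hnn _), ← ENNReal.ofReal_pow (hnn _)] at pl
    exact (ENNReal.ofReal_le_ofReal_iff (by positivity)).mp pl
  · intro x y
    rw [← ENNReal.ofReal_mul (lseW_pos _ _).le, ← ENNReal.ofReal_pow (lseW_pos _ _).le]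
    refine ENNReal.ofReal_le_ofReal ?_
    refine (lseW_mid hε _ _).trans_eq ?_
    congr 2
    have e1 : Ψ (s, (1 / 2 : ℝ) • (x + y)) = (1 / 2 : ℝ) • (Ψ (s, x) + Ψ (s, y)) := by
      rw [← map_add, ← map_smul]
      congr 1
      ext <;> simp <;> ring
    rw [e1]
    ext i
    simp [lin, inner_smul_left, inner_add_left]
    ring


/-- sliced density -/
noncomputable def rhoS (ε : ℝ) (c : Fin n → EuclideanSpace ℝ (Fin (m + 1)))
    (Ψ : (ℝ × (Fin m → ℝ)) ≃L[ℝ] EuclideanSpace ℝ (Fin (m + 1))) (s : ℝ) : ℝ :=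
  ∫ z, lseW ε (lin c (Ψ (s, z)))

/-- sliced mean -/
noncomputable def rhoT (ε : ℝ) (c : Fin n → EuclideanSpace ℝ (Fin (m + 1)))
    (Ψ : (ℝ × (Fin m → ℝ)) ≃L[ℝ] EuclideanSpace ℝ (Fin (m + 1))) (y : Fin n → ℝ) (s : ℝ) : ℝ :=
  ∫ z, -(mn ε (lin c (Ψ (s, z))) y) * lseW ε (lin c (Ψ (s, z)))

/-- cumulative -/
noncomputable def cumV (ε : ℝ) (c : Fin n → EuclideanSpace ℝ (Fin (m + 1)))
    (Ψ : (ℝ × (Fin m → ℝ)) ≃L[ℝ] EuclideanSpace ℝ (Fin (m + 1))) (y : Fin n → ℝ) (s : ℝ) : ℝ :=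
  ∫ u in Iic s, rhoT ε c Ψ y u

theorem decay_mn (hε : 0 < ε) (hg : Good c δ) (y : Fin n → ℝ) (R : ℝ) (hR : ∀ i, |y i| ≤ R) :
    Decay δ R (fun z => -(mn ε (lin c z) y) * lseW ε (lin c z)) :=
  decay_mulW hε hg (fun l => -(mn ε l y)) (continuous_mn ε y).neg R
    (fun l => by rw [abs_neg]; exact abs_mn_le ε l y R hR)

theorem decay_hs (hε : 0 < ε) (hg : Good c δ) (y y' : Fin n → ℝ) (R : ℝ) (hR : ∀ i, |y i| ≤ R)
    (hR' : ∀ i, |y' i| ≤ R) :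
    Decay δ (R ^ 2 + 2 * R ^ 2 / ε) (fun z => hs ε (lin c z) y y' * lseW ε (lin c z)) :=
  decay_mulW hε hg (fun l => hs ε l y y') (continuous_hs ε y y') _
    (fun l => abs_hs_le hε l y y' R hR hR')

theorem deriv_W_dir (hε : 0 < ε) (e z : EuclideanSpace ℝ (Fin (m + 1))) :
    HasDerivAt (fun t : ℝ => lseW ε (lin c (z + t • e)))
      (-(mn ε (lin c z) (lin c e)) * lseW ε (lin c z)) 0 := by
  have := hasDerivAt_lseW hε (lin c z) (lin c e) 0
  simp only [← lin_add_smul] at this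
  simpa using this

theorem deriv_mnW_dir (hε : 0 < ε) (e z : EuclideanSpace ℝ (Fin (m + 1))) (y : Fin n → ℝ) :
    HasDerivAt (fun t : ℝ => -(mn ε (lin c (z + t • e)) y) * lseW ε (lin c (z + t • e)))
      (hs ε (lin c z) (lin c e) y * lseW ε (lin c z)) 0 := by
  have := hasDerivAt_mnW hε (lin c z) (lin c e) y 0
  simp only [← lin_add_smul] at this
  simpa using this

theorem exists_bound2 (η ζ : Fin n → ℝ) : ∃ R, 0 ≤ R ∧ (∀ i, |η i| ≤ R) ∧ ∀ i, |ζ i| ≤ R := by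
  obtain ⟨R1, h1⟩ := exists_bound η
  obtain ⟨R2, h2⟩ := exists_bound ζ
  refine ⟨max R1 R2, ((abs_nonneg _).trans (h1 0)).trans (le_max_left _ _),
    fun i => (h1 i).trans (le_max_left _ _), fun i => (h2 i).trans (le_max_right _ _)⟩

theorem tendsto_of_exp_bound (f : ℝ → ℝ) (K δ : ℝ) (hδ : 0 < δ)
    (h : ∀ s, |f s| ≤ K * Real.exp (-(δ * |s|))) :
    Tendsto f atTop (𝓝 0) ∧ Tendsto f atBot (𝓝 0) := by
  have key : ∀ l : Filter ℝ, Tendsto (fun s : ℝ => |s|) l atTop → Tendsto f l (𝓝 0) := by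
    intro l hl
    refine squeeze_zero_norm h ?_
    have : Tendsto (fun s : ℝ => K * Real.exp (-(δ * |s|))) l (𝓝 (K * 0)) :=
      (Real.tendsto_exp_neg_atTop_nhds_zero.comp (hl.const_mul_atTop hδ)).const_mul K
    simpa using this
  exact ⟨key _ tendsto_abs_atTop_atTop, key _ tendsto_abs_atBot_atTop⟩

theorem rhoS_pos (hε : 0 < ε) (hδ : 0 < δ) (hg : Good c δ) (h : IsSlice e Ψ) (s : ℝ) :
    0 < rhoS ε c Ψ s := by
  have h1 := (decay_W hε hg).slice_integrable hδ h s
  unfold rhoS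
  rw [integral_pos_iff_support_of_nonneg (fun z => (lseW_pos _ _).le) h1]
  have : Function.support (fun z : Fin m → ℝ => lseW ε (lin c (Ψ (s, z)))) = univ := by
    ext z; simp [(lseW_pos ε (lin c (Ψ (s, z)))).ne']
  rw [this]
  exact isOpen_univ.measure_pos volume univ_nonempty

theorem slice_abs_le (hε : 0 < ε) (hδ : 0 < δ) (hg : Good c δ) (h : IsSlice e Ψ) (s : ℝ)
    (y : Fin n → ℝ) (R : ℝ) (hR : ∀ i, |y i| ≤ R) : |rhoT ε c Ψ y s| ≤ R * rhoS ε c Ψ s := by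
  unfold rhoT rhoS
  rw [← integral_const_mul, ← Real.norm_eq_abs]
  refine (norm_integral_le_integral_norm _).trans ?_
  refine integral_mono ((decay_mn hε hg y R hR).slice_integrable hδ h s).norm
    (((decay_W hε hg).slice_integrable hδ h s).const_mul R) fun z => ?_
  simp only [Real.norm_eq_abs]
  rw [abs_mul, abs_of_pos (lseW_pos _ _), abs_neg]
  exact mul_le_mul_of_nonneg_right (abs_mn_le ε _ y R hR) (lseW_pos _ _).le

theorem slice_main (hε : 0 < ε) (hδ : 0 < δ) (hg : Good c δ) (h : IsSlice e Ψ) (y : Fin n → ℝ)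
    (hy0 : ∫ z, mn ε (lin c z) y * lseW ε (lin c z) = 0) (α β μ : ℝ) (hαβ : α ≤ β) (hμ : 0 < μ)
    (hμρ : ∀ s ∈ Icc α β, μ ≤ rhoS ε c Ψ s) :
    (cumV ε c Ψ y β / rhoS ε c Ψ β - cumV ε c Ψ y α / rhoS ε c Ψ α) ^ 2 ≤
      (β - α) / μ * (- ∫ z, hs ε (lin c z) y y * lseW ε (lin c z)) := by
  obtain ⟨R, hR0, hR1, hR2⟩ := exists_bound2 (lin c e) y
  have hRR : 0 ≤ R ^ 2 + 2 * R ^ 2 / ε := by positivity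
  have k0 : Decay δ (1 + R + (R ^ 2 + 2 * R ^ 2 / ε)) _ := (decay_W hε hg).mono (by linarith)
  have k1 : Decay δ (1 + R + (R ^ 2 + 2 * R ^ 2 / ε)) _ := (decay_mn hε hg (lin c e) R hR1).mono (by linarith)
  have k2 : Decay δ (1 + R + (R ^ 2 + 2 * R ^ 2 / ε)) _ := (decay_mn hε hg y R hR2).mono (by linarith)
  have k3 : Decay δ (1 + R + (R ^ 2 + 2 * R ^ 2 / ε)) _ :=
    (decay_hs hε hg (lin c e) (lin c e) R hR1 hR1).mono (by linarith)
  have k4 : Decay δ (1 + R + (R ^ 2 + 2 * R ^ 2 / ε)) _ :=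
    (decay_hs hε hg (lin c e) y R hR1 hR2).mono (by linarith)
  have k5 : Decay δ (1 + R + (R ^ 2 + 2 * R ^ 2 / ε)) _ :=
    (decay_hs hε hg y y R hR2 hR2).mono (by linarith)
  have lims := tendsto_of_exp_bound (rhoS ε c Ψ) _ (δ / 2) (by positivity) (k0.slice_decay hδ h)
  have key := ode_lemma (rhoS ε c Ψ) (rhoT ε c Ψ (lin c e)) (rhoT ε c Ψ y)
    (fun s => ∫ z, hs ε (lin c (Ψ (s, z))) (lin c e) (lin c e) * lseW ε (lin c (Ψ (s, z))))
    (fun s => ∫ z, hs ε (lin c (Ψ (s, z))) (lin c e) y * lseW ε (lin c (Ψ (s, z))))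
    (fun s => ∫ z, hs ε (lin c (Ψ (s, z))) y y * lseW ε (lin c (Ψ (s, z))))
    (cumV ε c Ψ y) R (rhoS_pos hε hδ hg h)
    (k0.slice_deriv k1 hδ h (fun z => deriv_W_dir hε e z))
    (k1.slice_deriv k3 hδ h (fun z => deriv_mnW_dir hε e z _))
    (k2.slice_deriv k4 hδ h (fun z => deriv_mnW_dir hε e z _))
    (k3.slice_cont hδ h) (k4.slice_cont hδ h) (k5.slice_cont hδ h) (k0.fubini hδ h).1
    (k5.fubini hδ h).1 (fun s => slice_abs_le hε hδ hg h s _ R hR1)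
    (fun s => slice_abs_le hε hδ hg h s _ R hR2) lims.1 lims.2 ?_ ?_ (fun s => rfl) α β μ hαβ hμ hμρ
  · rwa [(k5.fubini hδ h).2] at key
  · intro a b s
    have hh := slice_hess hε hδ hg h (fun i => a * lin c e i + b * y i) s
    have e1 : ∫ z, hs ε (lin c (Ψ (s, z))) (fun i => a * lin c e i + b * y i)
        (fun i => a * lin c e i + b * y i) * lseW ε (lin c (Ψ (s, z))) =
        a ^ 2 * (∫ z, hs ε (lin c (Ψ (s, z))) (lin c e) (lin c e) * lseW ε (lin c (Ψ (s, z)))) +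
        2 * a * b * (∫ z, hs ε (lin c (Ψ (s, z))) (lin c e) y * lseW ε (lin c (Ψ (s, z)))) +
        b ^ 2 * ∫ z, hs ε (lin c (Ψ (s, z))) y y * lseW ε (lin c (Ψ (s, z))) := by
      have j3 := (k3.slice_integrable hδ h s).const_mul (a ^ 2)
      have j4 := (k4.slice_integrable hδ h s).const_mul (2 * a * b)
      have j5 := (k5.slice_integrable hδ h s).const_mul (b ^ 2)
      rw [← integral_const_mul, ← integral_const_mul, ← integral_const_mul,
        ← integral_add j3 j4, ← integral_add (j3.fun_add j4) j5]
      refine integral_congr_ae (Eventually.of_forall fun z => ?_)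
      simp only
      rw [hs_add]; ring
    have e2 : ∫ z, -(mn ε (lin c (Ψ (s, z))) (fun i => a * lin c e i + b * y i)) *
        lseW ε (lin c (Ψ (s, z))) = a * rhoT ε c Ψ (lin c e) s + b * rhoT ε c Ψ y s := by
      have j1 := (k1.slice_integrable hδ h s).const_mul a
      have j2 := (k2.slice_integrable hδ h s).const_mul b
      unfold rhoT
      rw [← integral_const_mul, ← integral_const_mul, ← integral_add j1 j2]
      refine integral_congr_ae (Eventually.of_forall fun z => ?_)
      simp only
      rw [mn_add]; ring
    rw [e1, e2] at hh
    exact hh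
  · have := (k2.fubini hδ h).2
    unfold rhoT
    rw [this]
    simp only [neg_mul]
    rw [integral_neg, hy0, neg_zero]

/-- translation invariance identities -/
theorem int_deriv_zero (hδ : 0 < δ) (h : IsSlice e Ψ) {K : ℝ}
    {g g' : EuclideanSpace ℝ (Fin (m + 1)) → ℝ} (kg : Decay δ K g) (kg' : Decay δ K g')
    (d : ∀ z, HasDerivAt (fun t : ℝ => g (z + t • e)) (g' z) 0) : ∫ z, g' z = 0 := by
  rw [← (kg'.fubini hδ h).2]
  have lims := tendsto_of_exp_bound (fun s => ∫ z, g (Ψ (s, z))) _ (δ / 2) (by positivity)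
    (kg.slice_decay hδ h)
  have := integral_of_hasDerivAt_of_tendsto (kg.slice_deriv kg' hδ h d) (kg'.fubini hδ h).1
    lims.2 lims.1
  simpa using this

theorem int_mn_dir (hε : 0 < ε) (hδ : 0 < δ) (hg : Good c δ)
    (e : EuclideanSpace ℝ (Fin (m + 1))) (he : ‖e‖ = 1) :
    ∫ z, mn ε (lin c z) (lin c e) * lseW ε (lin c z) = 0 ∧
    ∫ z, hs ε (lin c z) (lin c e) (lin c e) * lseW ε (lin c z) = 0 := by
  obtain ⟨Ψ, h⟩ := exists_slice e he
  obtain ⟨R, hR0, hR1, -⟩ := exists_bound2 (lin c e) (lin c e)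
  have hRR : 0 ≤ R ^ 2 + 2 * R ^ 2 / ε := by positivity
  have k0 : Decay δ (1 + R + (R ^ 2 + 2 * R ^ 2 / ε)) _ := (decay_W hε hg).mono (by linarith)
  have k1 : Decay δ (1 + R + (R ^ 2 + 2 * R ^ 2 / ε)) _ := (decay_mn hε hg (lin c e) R hR1).mono (by linarith)
  have k3 : Decay δ (1 + R + (R ^ 2 + 2 * R ^ 2 / ε)) _ :=
    (decay_hs hε hg (lin c e) (lin c e) R hR1 hR1).mono (by linarith)
  have a1 := int_deriv_zero hδ h k0 k1 (fun z => deriv_W_dir hε e z)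
  have a2 := int_deriv_zero hδ h k1 k3 (fun z => deriv_mnW_dir hε e z _)
  refine ⟨?_, a2⟩
  simp only [neg_mul] at a1
  rw [integral_neg, neg_eq_zero] at a1
  exact a1

end main


section bary
open MeasureTheory Set Filter Topology
variable {n m : ℕ} [NeZero n] {c : Fin n → EuclideanSpace ℝ (Fin (m + 1))} {δ ε : ℝ}

theorem Good.shift {a : Fin n → EuclideanSpace ℝ (Fin (m + 1))} {x x' : EuclideanSpace ℝ (Fin (m + 1))}
    (h : Good (fun i => a i - x) δ) : Good (fun i => a i - x') (δ - ‖x' - x‖) := by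
  intro z
  obtain ⟨i, hi⟩ := h z
  refine ⟨i, ?_⟩
  have h1 : inner ℝ z (a i - x') = inner ℝ z (a i - x) - inner ℝ z (x' - x) := by
    rw [← inner_sub_right]; congr 1; abel
  have h2 := real_inner_le_norm z (x' - x)
  rw [h1]
  nlinarith

theorem Good.mono {δ' : ℝ} (h : Good c δ) (hd : δ' ≤ δ) : Good c δ' := by
  intro z
  obtain ⟨i, hi⟩ := h z
  exact ⟨i, (mul_le_mul_of_nonneg_right hd (norm_nonneg _)).trans hi⟩

/-- partition function -/
noncomputable def pZ (ε : ℝ) (c : Fin n → EuclideanSpace ℝ (Fin (m + 1))) : ℝ :=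
  ∫ z, lseW ε (lin c z)

/-- unnormalised weights -/
noncomputable def pI (ε : ℝ) (c : Fin n → EuclideanSpace ℝ (Fin (m + 1))) (i : Fin n) : ℝ :=
  ∫ z, smx ε (lin c z) i * lseW ε (lin c z)

/-- normalised weights -/
noncomputable def pA (ε : ℝ) (c : Fin n → EuclideanSpace ℝ (Fin (m + 1))) (i : Fin n) : ℝ :=
  pI ε c i / pZ ε c

theorem decay_smx (hε : 0 < ε) (hg : Good c δ) (i : Fin n) :
    Decay δ 1 (fun z => smx ε (lin c z) i * lseW ε (lin c z)) :=
  decay_mulW hε hg (fun l => smx ε l i) (continuous_smx ε i) 1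
    (fun l => by rw [abs_of_pos (smx_pos ε l i)]; exact smx_le_one ε l i)

theorem integral_pos' {g : EuclideanSpace ℝ (Fin (m + 1)) → ℝ} (h : Integrable g) (hp : ∀ z, 0 < g z) :
    0 < ∫ z, g z := by
  rw [integral_pos_iff_support_of_nonneg (fun z => (hp z).le) h]
  have : Function.support g = univ := by
    ext z; simp [(hp z).ne']
  rw [this]
  exact isOpen_univ.measure_pos volume univ_nonempty

theorem pZ_pos (hε : 0 < ε) (hδ : 0 < δ) (hg : Good c δ) : 0 < pZ ε c :=
  integral_pos' ((decay_W hε hg).integrable hδ) fun z => lseW_pos _ _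

theorem pI_pos (hε : 0 < ε) (hδ : 0 < δ) (hg : Good c δ) (i : Fin n) : 0 < pI ε c i :=
  integral_pos' ((decay_smx hε hg i).integrable hδ) fun z => mul_pos (smx_pos _ _ _) (lseW_pos _ _)

theorem int_mn (hε : 0 < ε) (hδ : 0 < δ) (hg : Good c δ) (η : Fin n → ℝ) :
    ∫ z, mn ε (lin c z) η * lseW ε (lin c z) = ∑ i, pI ε c i * η i := by
  unfold mn pI
  simp_rw [← integral_mul_const]
  rw [← integral_finsetSum _ fun i _ => ((decay_smx hε hg i).integrable hδ).mul_const (η i)]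
  refine integral_congr_ae (Eventually.of_forall fun z => ?_)
  simp only [Finset.sum_mul]
  exact Finset.sum_congr rfl fun i _ => by ring

theorem pI_sum (hε : 0 < ε) (hδ : 0 < δ) (hg : Good c δ) : ∑ i, pI ε c i = pZ ε c := by
  have := int_mn hε hδ hg (fun _ => 1)
  simp only [mul_one] at this
  rw [← this]
  unfold pZ mn
  refine integral_congr_ae (Eventually.of_forall fun z => ?_)
  simp [smx_sum]

theorem pA_pos (hε : 0 < ε) (hδ : 0 < δ) (hg : Good c δ) (i : Fin n) : 0 < pA ε c i :=
  div_pos (pI_pos hε hδ hg i) (pZ_pos hε hδ hg)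

theorem pA_sum (hε : 0 < ε) (hδ : 0 < δ) (hg : Good c δ) : ∑ i, pA ε c i = 1 := by
  unfold pA
  rw [← Finset.sum_div, pI_sum hε hδ hg, div_self (pZ_pos hε hδ hg).ne']

theorem pI_bary (hε : 0 < ε) (hδ : 0 < δ) (hg : Good c δ) : ∑ i, pI ε c i • c i = 0 := by
  set v := ∑ i, pI ε c i • c i with hv
  have key : ∀ e : EuclideanSpace ℝ (Fin (m + 1)), ‖e‖ = 1 → inner ℝ e v = 0 := by
    intro e he
    have := (int_mn_dir hε hδ hg e he).1
    rw [int_mn hε hδ hg] at this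
    rw [hv, inner_sum, ← this]
    exact Finset.sum_congr rfl fun i _ => by rw [inner_smul_right]; rfl
  by_contra h0
  have h1 := key (‖v‖⁻¹ • v) (by rw [norm_smul, norm_inv, norm_norm, inv_mul_cancel₀ (norm_ne_zero_iff.mpr h0)])
  rw [inner_smul_left, real_inner_self_eq_norm_sq] at h1
  have := norm_pos_iff.mpr h0
  simp at h1
  exact h0 h1

theorem pA_bary {a : Fin n → EuclideanSpace ℝ (Fin (m + 1))} {x : EuclideanSpace ℝ (Fin (m + 1))}
    (hε : 0 < ε) (hδ : 0 < δ) (hg : Good (fun i => a i - x) δ) :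
    ∑ i, pA ε (fun i => a i - x) i • a i = x := by
  have h1 := pI_bary hε hδ hg
  have h2 := pA_sum hε hδ hg
  have h3 : ∑ i, pA ε (fun i => a i - x) i • (a i - x) = 0 := by
    unfold pA
    simp_rw [div_eq_inv_mul, mul_smul]
    rw [← Finset.smul_sum, h1, smul_zero]
  simp_rw [smul_sub] at h3
  rw [Finset.sum_sub_distrib, ← Finset.sum_smul, h2, one_smul, sub_eq_zero] at h3
  exact h3

theorem lseS_tilt (l : Fin n → ℝ) (t : ℝ) :
    lseS ε (fun i => l i - t) = lseS ε l * Real.exp (-(t / ε)) := by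
  unfold lseS
  rw [Finset.sum_mul]
  refine Finset.sum_congr rfl fun i _ => ?_
  rw [← Real.exp_add]; congr 1; ring

theorem lseW_tilt (hε : 0 < ε) (l : Fin n → ℝ) (t : ℝ) :
    lseW ε (fun i => l i - t) = lseW ε l * Real.exp t := by
  unfold lseW
  rw [lseS_tilt, Real.log_mul (lseS_pos ε l).ne' (Real.exp_pos _).ne', Real.log_exp, ← Real.exp_add]
  congr 1; field_simp; ring

theorem smx_tilt (l : Fin n → ℝ) (t : ℝ) (i : Fin n) :
    smx ε (fun i => l i - t) i = smx ε l i := by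
  unfold smx
  rw [lseS_tilt, sub_div, sub_eq_add_neg, Real.exp_add]
  exact mul_div_mul_right _ _ (Real.exp_pos _).ne'

theorem mn_tilt (l : Fin n → ℝ) (t : ℝ) (η : Fin n → ℝ) :
    mn ε (fun i => l i - t) η = mn ε l η := by
  unfold mn
  simp_rw [smx_tilt]

theorem lin_sub (u z : EuclideanSpace ℝ (Fin (m + 1))) :
    lin (fun i => c i - u) z = fun i => lin c z i - inner ℝ z u := by
  ext i; simp [lin, inner_sub_right]

/-- local continuity of weights in the base point -/
theorem pI_continuousAt {a : Fin n → EuclideanSpace ℝ (Fin (m + 1))} {x : EuclideanSpace ℝ (Fin (m + 1))}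
    (hε : 0 < ε) (hδ : 0 < δ) (hg : Good (fun i => a i - x) δ) (k : (Fin n → ℝ) → ℝ)
    (hk : Continuous k) (hk1 : ∀ l, |k l| ≤ 1) :
    ContinuousAt (fun x => ∫ z, k (lin (fun i => a i - x) z) * lseW ε (lin (fun i => a i - x) z)) x := by
  refine continuousAt_of_dominated (bound := fun z => 1 * Real.exp (-(δ / 2 * ‖z‖))) ?_ ?_ ?_ ?_
  · refine Eventually.of_forall fun x' => ?_
    exact ((hk.comp continuous_lin).mul ((continuous_lseW ε).comp continuous_lin)).aestronglyMeasurable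
  · filter_upwards [Metric.ball_mem_nhds x (half_pos hδ)] with x' hx'
    refine Eventually.of_forall fun z => ?_
    have hg' : Good (fun i => a i - x') (δ / 2) := (hg.shift (x' := x')).mono (by
      rw [mem_ball_iff_norm] at hx'; linarith)
    exact (decay_mulW hε hg' k hk 1 hk1).bound z
  · exact (integrable_exp_norm volume (δ / 2) (half_pos hδ)).const_mul 1
  · refine Eventually.of_forall fun z => ?_
    have : Continuous fun x => lin (fun i => a i - x) z := by unfold lin; fun_prop
    exact ((hk.comp this).mul ((continuous_lseW ε).comp this)).continuousAt

theorem pA_continuousAt {a : Fin n → EuclideanSpace ℝ (Fin (m + 1))} {x : EuclideanSpace ℝ (Fin (m + 1))}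
    (hε : 0 < ε) (hδ : 0 < δ) (hg : Good (fun i => a i - x) δ) (i : Fin n) :
    ContinuousAt (fun x => pA ε (fun i => a i - x) i) x := by
  unfold pA
  refine ContinuousAt.div ?_ ?_ (pZ_pos hε hδ hg).ne'
  · exact pI_continuousAt hε hδ hg (fun l => smx ε l i) (continuous_smx ε i)
      (fun l => by rw [abs_of_pos (smx_pos ε l i)]; exact smx_le_one ε l i)
  · have := pI_continuousAt hε hδ hg (fun l => 1) continuous_const (by simp)
    simpa [pZ] using this

end bary


section oneD
open MeasureTheory Set Filter Topology

theorem int_Ioi_exp (δ s : ℝ) (hδ : 0 < δ) :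
    IntegrableOn (fun t => Real.exp (-(δ * t))) (Ioi s) ∧
    ∫ t in Ioi s, Real.exp (-(δ * t)) = Real.exp (-(δ * s)) / δ := by
  have h1 := integral_exp_mul_Ioi (a := -δ) (by linarith) s
  have h2 := integrableOn_exp_mul_Ioi (a := -δ) (by linarith) s
  simp only [neg_mul] at h1 h2
  refine ⟨h2, ?_⟩
  rw [h1]; rw [neg_div_neg_eq]

theorem int_Iic_exp (δ s : ℝ) (hδ : 0 < δ) :
    IntegrableOn (fun t => Real.exp (δ * t)) (Iic s) ∧
    ∫ t in Iic s, Real.exp (δ * t) = Real.exp (δ * s) / δ :=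
  ⟨integrableOn_exp_mul_Iic hδ s, integral_exp_mul_Iic hδ s⟩

/-- bounds for the primitive -/
theorem cum_bound (r : ℝ → ℝ) (hr : Continuous r) (K δ lam : ℝ) (hδ : 0 < δ) (hl : 0 ≤ lam)
    (b0 : ∀ s, |r s| ≤ K * Real.exp (-(δ * |s|)))
    (b1 : ∀ s, |r s| * Real.exp (lam * s) ≤ K * Real.exp (-(δ * |s|))) (h0 : ∫ s, r s = 0) (s : ℝ) :
    |∫ t in Iic s, r t| * Real.exp (lam * s) ≤ K / δ * Real.exp (-(δ * |s|)) := by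
  have hintg : Integrable r := by
    refine ((integrable_exp_norm volume δ hδ).const_mul K).mono' hr.aestronglyMeasurable
      (Eventually.of_forall b0)
  have hK : 0 ≤ K := by
    have := (abs_nonneg _).trans (b0 0)
    simpa using this
  rcases le_or_gt 0 s with hs | hs
  · have e1 : ∫ t in Iic s, r t = - ∫ t in Ioi s, r t := by
      have := intervalIntegral.integral_Iic_add_Ioi (b := s) hintg.integrableOn hintg.integrableOn
      linarith
    rw [e1, abs_neg]
    obtain ⟨i1, i2⟩ := int_Ioi_exp δ s hδ
    have e2 : |∫ t in Ioi s, r t| ≤ ∫ t in Ioi s, (Real.exp (-(lam * s)) * K) * Real.exp (-(δ * t)) := by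
      rw [← Real.norm_eq_abs]
      refine norm_integral_le_of_norm_le (i1.const_mul _) ?_
      refine (ae_restrict_iff' measurableSet_Ioi).mpr (Eventually.of_forall fun t ht => ?_)
      have ht : s < t := ht
      have h1 := b1 t
      rw [abs_of_pos (hs.trans_lt ht)] at h1
      have h2 : Real.exp (lam * s) ≤ Real.exp (lam * t) := by gcongr
      have h3 : |r t| * Real.exp (lam * s) ≤ K * Real.exp (-(δ * t)) :=
        (mul_le_mul_of_nonneg_left h2 (abs_nonneg _)).trans h1
      rw [Real.exp_neg, Real.norm_eq_abs, mul_assoc, le_inv_mul_iff₀ (Real.exp_pos _)]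
      linarith
    rw [integral_const_mul, i2] at e2
    rw [abs_of_nonneg hs]
    calc _ ≤ (Real.exp (-(lam * s)) * K * (Real.exp (-(δ * s)) / δ)) * Real.exp (lam * s) :=
          mul_le_mul_of_nonneg_right e2 (Real.exp_pos _).le
      _ = (Real.exp (-(lam * s)) * Real.exp (lam * s)) * (K / δ * Real.exp (-(δ * s))) := by ring
      _ = _ := by rw [← Real.exp_add]; simp
  · obtain ⟨i1, i2⟩ := int_Iic_exp δ s hδ
    have e2 : |∫ t in Iic s, r t| ≤ ∫ t in Iic s, K * Real.exp (δ * t) := by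
      rw [← Real.norm_eq_abs]
      refine norm_integral_le_of_norm_le (i1.const_mul _) ?_
      refine (ae_restrict_iff' measurableSet_Iic).mpr (Eventually.of_forall fun t ht => ?_)
      have ht : t ≤ s := ht
      have h1 := b0 t
      rw [abs_of_neg (ht.trans_lt hs)] at h1
      simpa using h1
    rw [integral_const_mul, i2] at e2
    rw [abs_of_neg hs]
    have h3 : Real.exp (lam * s) ≤ 1 := by rw [Real.exp_le_one_iff]; nlinarith
    calc _ ≤ |∫ t in Iic s, r t| := mul_le_of_le_one_right (abs_nonneg _) h3
      _ ≤ _ := e2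
      _ = _ := by simp; ring

theorem cum_deriv (r : ℝ → ℝ) (hr : Continuous r) (hintg : Integrable r) (s : ℝ) :
    HasDerivAt (fun s => ∫ t in Iic s, r t) (r s) s := by
  have e : (fun s => ∫ t in Iic s, r t) = fun s => (∫ t in Iic 0, r t) + ∫ t in (0:ℝ)..s, r t := by
    ext s
    rw [← intervalIntegral.integral_Iic_sub_Iic hintg.integrableOn hintg.integrableOn]; ring
  rw [e]
  exact (intervalIntegral.integral_hasDerivAt_right (hr.intervalIntegrable _ _)
    (hr.stronglyMeasurableAtFilter _ _) hr.continuousAt).const_add _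

theorem integrable_of_exp (f : ℝ → ℝ) (hf : Continuous f) (K δ : ℝ) (hδ : 0 < δ)
    (b : ∀ s, |f s| ≤ K * Real.exp (-(δ * |s|))) : Integrable f :=
  ((integrable_exp_norm volume δ hδ).const_mul K).mono' hf.aestronglyMeasurable
      (Eventually.of_forall b)

theorem s_exp_bound (δ s : ℝ) (hδ : 0 < δ) :
    |s| * Real.exp (-(δ * |s|)) ≤ 2 / δ * Real.exp (-(δ / 2 * |s|)) := by
  have h1 := Real.add_one_le_exp (δ / 2 * |s|)
  have h2 : Real.exp (-(δ * |s|)) = Real.exp (-(δ / 2 * |s|)) * Real.exp (-(δ / 2 * |s|)) := by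
    rw [← Real.exp_add]; congr 1; ring
  have h3 : Real.exp (δ / 2 * |s|) * Real.exp (-(δ / 2 * |s|)) = 1 := by
    rw [← Real.exp_add]; simp
  have h4 := Real.exp_pos (-(δ / 2 * |s|))
  rw [h2, ← mul_assoc]
  refine mul_le_mul_of_nonneg_right ?_ h4.le
  rw [le_div_iff₀ hδ]
  nlinarith

theorem cum_parts (r : ℝ → ℝ) (hr : Continuous r) (K δ lam : ℝ) (hδ : 0 < δ) (hl : 0 ≤ lam)
    (b0 : ∀ s, |r s| ≤ K * Real.exp (-(δ * |s|)))
    (b1 : ∀ s, |r s| * Real.exp (lam * s) ≤ K * Real.exp (-(δ * |s|))) (h0 : ∫ s, r s = 0) :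
    (∫ s, r s * Real.exp (lam * s) = - (lam * ∫ s, (∫ t in Iic s, r t) * Real.exp (lam * s))) ∧
    (∫ s, r s * s = - ∫ s, (∫ t in Iic s, r t)) := by
  have hintg : Integrable r := integrable_of_exp r hr K δ hδ b0
  have dV := cum_deriv r hr hintg
  have cV : Continuous fun s => ∫ t in Iic s, r t :=
    continuous_iff_continuousAt.mpr fun s => (dV s).continuousAt
  have hK : 0 ≤ K := by
    have := (abs_nonneg _).trans (b0 0)
    simpa using this
  have bV := cum_bound r hr K δ lam hδ hl b0 b1 h0
  have bV0 : ∀ s, |∫ t in Iic s, r t| ≤ K / δ * Real.exp (-(δ * |s|)) := fun s => by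
    have := cum_bound r hr K δ 0 hδ le_rfl b0 (by simpa using b0) h0 s
    simpa using this
  have dE : ∀ s, HasDerivAt (fun s => Real.exp (lam * s)) (lam * Real.exp (lam * s)) s := fun s => by
    have := ((hasDerivAt_id s).const_mul lam).exp
    refine this.congr_deriv (by simp; ring)
  have cE : Continuous fun s => Real.exp (lam * s) := by fun_prop
  have iV1 : Integrable (fun s => (∫ t in Iic s, r t) * Real.exp (lam * s)) :=
    integrable_of_exp _ (cV.mul cE) (K / δ) δ hδ (fun s => by
      rw [abs_mul, abs_of_pos (Real.exp_pos _)]; exact bV s)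
  have ir1 : Integrable (fun s => r s * Real.exp (lam * s)) :=
    integrable_of_exp _ (hr.mul cE) K δ hδ (fun s => by
      rw [abs_mul, abs_of_pos (Real.exp_pos _)]; exact b1 s)
  have iV : Integrable (fun s => (∫ t in Iic s, r t)) := integrable_of_exp _ cV _ δ hδ bV0
  have aux : ∀ (f : ℝ → ℝ) (hf : Continuous f) (C : ℝ) (_ : ∀ s, |f s| ≤ C * Real.exp (-(δ * |s|))),
      Integrable (fun s => f s * s) := by
    intro f hf C hb
    have hC : 0 ≤ C := by
      have := (abs_nonneg _).trans (hb 0)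
      simpa using this
    refine integrable_of_exp _ (hf.mul continuous_id) (C * (2 / δ)) (δ / 2) (half_pos hδ) fun s => ?_
    rw [abs_mul]
    calc |f s| * |s| ≤ C * Real.exp (-(δ * |s|)) * |s| := mul_le_mul_of_nonneg_right (hb s) (abs_nonneg _)
      _ = C * (|s| * Real.exp (-(δ * |s|))) := by ring
      _ ≤ C * (2 / δ * Real.exp (-(δ / 2 * |s|))) := mul_le_mul_of_nonneg_left (s_exp_bound δ s hδ) hC
      _ = _ := by ring
  constructor
  · have := integral_mul_deriv_eq_deriv_mul_of_integrable (u := fun s => ∫ t in Iic s, r t)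
      (v := fun s => Real.exp (lam * s)) (u' := r) (v' := fun s => lam * Real.exp (lam * s))
      (fun x _ => dV x) (fun x _ => dE x) ?_ ir1 iV1
    · have e : ∀ x, (∫ t in Iic x, r t) * (lam * Real.exp (lam * x)) =
        lam * ((∫ t in Iic x, r t) * Real.exp (lam * x)) := fun x => by ring
      simp_rw [e] at this
      rw [integral_const_mul] at this
      linarith
    · refine (iV1.const_mul lam).congr (Eventually.of_forall fun x => ?_)
      simp; ring
  · have := integral_mul_deriv_eq_deriv_mul_of_integrable (u := fun s => ∫ t in Iic s, r t)
      (v := fun s => s) (u' := r) (v' := fun s => 1)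
      (fun x _ => dV x) (fun x _ => hasDerivAt_id x) (iV.congr (Eventually.of_forall fun x => by simp))
      (aux r hr K b0) (aux _ cV _ bV0)
    simp only [mul_one] at this
    linarith

theorem dct_exp (F : ℕ → ℝ → ℝ) (hF : ∀ k, Continuous (F k)) (K δ : ℝ) (hδ : 0 < δ)
    (b : ∀ k s, |F k s| ≤ K * Real.exp (-(δ * |s|))) (h : ∀ s, Tendsto (fun k => F k s) atTop (𝓝 0)) :
    Tendsto (fun k => ∫ s, F k s) atTop (𝓝 0) := by
  have := tendsto_integral_of_dominated_convergence (μ := volume) (F := F) (f := fun _ => 0)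
    (fun s => K * Real.exp (-(δ * |s|))) (fun k => (hF k).aestronglyMeasurable)
    ((integrable_exp_norm volume δ hδ).const_mul K) (fun k => Eventually.of_forall (b k))
    (Eventually.of_forall h)
  simpa using this

end oneD


section tilt
open MeasureTheory Set Filter Topology
variable {n m : ℕ} [NeZero n] {c : Fin n → EuclideanSpace ℝ (Fin (m + 1))} {δ ε : ℝ}
  {e : EuclideanSpace ℝ (Fin (m + 1))}
  {Ψ : (ℝ × (Fin m → ℝ)) ≃L[ℝ] EuclideanSpace ℝ (Fin (m + 1))}

theorem W_lower (hε : 0 < ε) (hε1 : ε ≤ 1) (R : ℝ) (hR : ∀ i, ‖c i‖ ≤ R)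
    (z : EuclideanSpace ℝ (Fin (m + 1))) :
    Real.exp (-Real.log n) * Real.exp (-(R * ‖z‖)) ≤ lseW ε (lin c z) := by
  refine le_trans ?_ (le_lseW hε (lin c z) (R * ‖z‖) fun i => ?_)
  · rw [← Real.exp_add, Real.exp_le_exp]
    have h1 : 0 ≤ Real.log n := Real.log_natCast_nonneg n
    nlinarith
  · unfold lin
    refine (real_inner_le_norm _ _).trans ?_
    rw [mul_comm]
    exact mul_le_mul_of_nonneg_right (hR i) (norm_nonneg _)

theorem pZ_lower (R : ℝ) (hR0 : 0 < R) : ∃ μ > 0, ∀ (ε δ : ℝ) (c : Fin n → EuclideanSpace ℝ (Fin (m + 1))),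
    0 < ε → ε ≤ 1 → 0 < δ → Good c δ → (∀ i, ‖c i‖ ≤ R) → μ ≤ pZ ε c := by
  have hi := (integrable_exp_norm (volume : Measure (EuclideanSpace ℝ (Fin (m + 1)))) R hR0).const_mul
    (Real.exp (-Real.log n))
  refine ⟨_, integral_pos' hi fun z => by positivity, fun ε δ c hε hε1 hδ hg hR => ?_⟩
  exact integral_mono hi ((decay_W hε hg).integrable hδ) fun z => W_lower hε hε1 R hR z

theorem pZ_upper (hε : 0 < ε) (hδ : 0 < δ) (hg : Good c δ) :
    pZ ε c ≤ ∫ z : EuclideanSpace ℝ (Fin (m + 1)), Real.exp (-(δ * ‖z‖)) :=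
  integral_mono ((decay_W hε hg).integrable hδ) (integrable_exp_norm volume δ hδ)
    fun z => lseW_lin_le hε hg z

theorem rhoS_lower (h : IsSlice e Ψ) (R : ℝ) (hR0 : 0 < R) (S : ℝ) : ∃ μ > 0,
    ∀ (ε δ : ℝ) (c : Fin n → EuclideanSpace ℝ (Fin (m + 1))),
    0 < ε → ε ≤ 1 → 0 < δ → Good c δ → (∀ i, ‖c i‖ ≤ R) → ∀ s, |s| ≤ S → μ ≤ rhoS ε c Ψ s := by
  obtain ⟨L, hL0, hL⟩ : ∃ L, 0 < L ∧ ∀ z : Fin m → ℝ, ‖Ψ (0, z)‖ ≤ L * ‖z‖ := by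
    refine ⟨‖(Ψ : (ℝ × (Fin m → ℝ)) →L[ℝ] EuclideanSpace ℝ (Fin (m + 1)))‖ + 1, by positivity, fun z => ?_⟩
    have h1 := (Ψ : (ℝ × (Fin m → ℝ)) →L[ℝ] EuclideanSpace ℝ (Fin (m + 1))).le_opNorm (0, z)
    have h2 : ‖((0:ℝ), z)‖ = ‖z‖ := by simp [Prod.norm_def]
    rw [h2] at h1
    refine h1.trans ?_
    gcongr
    linarith
  have hi := (integrable_exp_norm (volume : Measure (Fin m → ℝ)) (R * L) (by positivity)).const_mul
    (Real.exp (-Real.log n) * Real.exp (-(R * S)))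
  refine ⟨∫ x : Fin m → ℝ, Real.exp (-Real.log n) * Real.exp (-(R * S)) * Real.exp (-(R * L * ‖x‖)), ?_,
    fun ε δ c hε hε1 hδ hg hR s hs => ?_⟩
  rotate_left
  · unfold rhoS
    refine integral_mono hi ((decay_W hε hg).slice_integrable hδ h s) fun z => ?_
    refine le_trans ?_ (W_lower hε hε1 R hR _)
    rw [mul_assoc, ← Real.exp_add]
    gcongr
    have h1 : Ψ (s, z) = Ψ (0, z) + s • e := by rw [← h.add]; simp
    have h2 : ‖Ψ (s, z)‖ ≤ L * ‖z‖ + S := by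
      rw [h1]
      refine (norm_add_le _ _).trans (add_le_add (hL z) ?_)
      rw [norm_smul, h.norm_e, mul_one]; exact hs
    nlinarith
  · rw [integral_const_mul]
    refine mul_pos (by positivity) ?_
    rw [integral_pos_iff_support_of_nonneg (fun z => (Real.exp_pos _).le)
      (integrable_exp_norm (volume : Measure (Fin m → ℝ)) (R * L) (by positivity))]
    have : Function.support (fun z : Fin m → ℝ => Real.exp (-(R * L * ‖z‖))) = univ := by
      ext z; simp
    rw [this]
    exact isOpen_univ.measure_pos volume univ_nonempty

theorem lin_tilt_slice (h : IsSlice e Ψ) (lam s : ℝ) (z : Fin m → ℝ) :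
    lin (fun i => c i - lam • e) (Ψ (s, z)) = fun i => lin c (Ψ (s, z)) i - lam * s := by
  rw [lin_sub, inner_smul_right, h.inner]

theorem rhoT_tilt (hε : 0 < ε) (h : IsSlice e Ψ) (lam s : ℝ) (y : Fin n → ℝ) :
    rhoT ε (fun i => c i - lam • e) Ψ y s = rhoT ε c Ψ y s * Real.exp (lam * s) := by
  unfold rhoT
  rw [← integral_mul_const]
  refine integral_congr_ae (Eventually.of_forall fun z => ?_)
  simp only [lin_tilt_slice h, mn_tilt, lseW_tilt hε]
  ring

theorem rhoS_tilt (hε : 0 < ε) (h : IsSlice e Ψ) (lam s : ℝ) :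
    rhoS ε (fun i => c i - lam • e) Ψ s = rhoS ε c Ψ s * Real.exp (lam * s) := by
  unfold rhoS
  rw [← integral_mul_const]
  refine integral_congr_ae (Eventually.of_forall fun z => ?_)
  simp only [lin_tilt_slice h, lseW_tilt hε]

theorem mnW_parts (hε : 0 < ε) (hδ : 0 < δ) (h : IsSlice e Ψ) (lam : ℝ) (hl : 0 ≤ lam)
    (hg : Good c δ) (hg' : Good (fun i => c i - lam • e) δ) (y : Fin n → ℝ)
    (R : ℝ) (hR : ∀ i, |y i| ≤ R)
    (hy0 : ∫ z, mn ε (lin c z) y * lseW ε (lin c z) = 0) :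
    (∀ s, |cumV ε c Ψ y s| * Real.exp (lam * s) ≤
      (R * ∫ z : Fin m → ℝ, Real.exp (-(δ / 2 * ‖z‖))) / (δ / 2) * Real.exp (-(δ / 2 * |s|))) ∧
    (∀ s, |rhoS ε c Ψ s| * Real.exp (lam * s) ≤
      (1 * ∫ z : Fin m → ℝ, Real.exp (-(δ / 2 * ‖z‖))) * Real.exp (-(δ / 2 * |s|))) ∧
    ∑ i, pI ε (fun i => c i - lam • e) i * y i =
      lam * ∫ s, cumV ε c Ψ y s * Real.exp (lam * s) ∧
    ∫ z, mn ε (lin c z) y * lseW ε (lin c z) * inner ℝ z e = ∫ s, cumV ε c Ψ y s := by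
  have k := decay_mn hε hg y R hR
  have k' := decay_mn hε hg' y R hR
  have hR0 : 0 ≤ R := (abs_nonneg _).trans (hR 0)
  have b0 := k.slice_decay hδ h
  have b1 : ∀ s, |rhoT ε c Ψ y s| * Real.exp (lam * s) ≤
      (R * ∫ z : Fin m → ℝ, Real.exp (-(δ / 2 * ‖z‖))) * Real.exp (-(δ / 2 * |s|)) := by
    intro s
    have := k'.slice_decay hδ h s
    have e1 := rhoT_tilt (c := c) hε h lam s y
    unfold rhoT at e1
    rw [e1, abs_mul, abs_of_pos (Real.exp_pos _)] at this
    exact this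
  have cr : Continuous (rhoT ε c Ψ y) := k.slice_cont hδ h
  have h0 : ∫ s, rhoT ε c Ψ y s = 0 := by
    unfold rhoT
    rw [(k.fubini hδ h).2]
    simp only [neg_mul]
    rw [integral_neg, hy0, neg_zero]
  have parts := cum_parts (rhoT ε c Ψ y) cr _ (δ / 2) lam (half_pos hδ) hl b0 b1 h0
  refine ⟨cum_bound (rhoT ε c Ψ y) cr _ (δ / 2) lam (half_pos hδ) hl b0 b1 h0, ?_, ?_, ?_⟩
  · intro s
    have := (decay_W hε hg').slice_decay hδ h s
    have e1 := rhoS_tilt (c := c) hε h lam s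
    unfold rhoS at e1
    rw [e1, abs_mul, abs_of_pos (Real.exp_pos _)] at this
    exact this
  · rw [← int_mn hε hδ hg']
    have e1 := (k'.fubini hδ h).2
    simp only [neg_mul] at e1
    rw [integral_neg] at e1
    have e2 : ∀ s, (∫ z, -(mn ε (lin (fun i => c i - lam • e) (Ψ (s, z))) y *
        lseW ε (lin (fun i => c i - lam • e) (Ψ (s, z))))) = rhoT ε c Ψ y s * Real.exp (lam * s) := by
      intro s
      rw [← rhoT_tilt hε h]
      unfold rhoT
      simp only [neg_mul]
    simp_rw [e2] at e1
    rw [parts.1] at e1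
    unfold cumV
    linarith
  · have k2 : Decay (δ / 2) (R * (2 / δ))
        (fun z => mn ε (lin c z) y * lseW ε (lin c z) * inner ℝ z e) := by
      refine ⟨?_, fun z => ?_⟩
      · exact (((continuous_mn ε y).comp continuous_lin).mul
          ((continuous_lseW ε).comp continuous_lin)).mul (by fun_prop)
      · have h1 := k.bound z
        rw [neg_mul, abs_neg] at h1
        rw [abs_mul]
        have h2 : |(inner ℝ z e : ℝ)| ≤ ‖z‖ := by
          have := abs_real_inner_le_norm z e
          rwa [h.norm_e, mul_one] at this
        have h3 := s_exp_bound δ ‖z‖ hδ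
        rw [abs_norm] at h3
        calc _ ≤ (R * Real.exp (-(δ * ‖z‖))) * ‖z‖ :=
              mul_le_mul h1 h2 (abs_nonneg _) (by positivity)
          _ = R * (‖z‖ * Real.exp (-(δ * ‖z‖))) := by ring
          _ ≤ R * (2 / δ * Real.exp (-(δ / 2 * ‖z‖))) := mul_le_mul_of_nonneg_left h3 hR0
          _ = _ := by ring
    rw [← (k2.fubini (half_pos hδ) h).2]
    have e2 : ∀ s, (∫ z, mn ε (lin c (Ψ (s, z))) y * lseW ε (lin c (Ψ (s, z))) * inner ℝ (Ψ (s, z)) e)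
        = - (rhoT ε c Ψ y s * s) := by
      intro s
      simp_rw [h.inner]
      rw [integral_mul_const]
      unfold rhoT
      simp only [neg_mul]
      rw [integral_neg]; ring
    simp_rw [e2]
    rw [integral_neg, parts.2, neg_neg]
    rfl

theorem sq_small (f H : ℕ → ℝ) (C : ℝ) (h : ∀ k, f k ^ 2 ≤ C * H k) (hH : Tendsto H atTop (𝓝 0)) :
    Tendsto f atTop (𝓝 0) := by
  have h1 : Tendsto (fun k => f k ^ 2) atTop (𝓝 0) :=
    squeeze_zero (fun k => sq_nonneg _) h (by simpa using hH.const_mul C)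
  have h2 := (Real.continuous_sqrt.tendsto 0).comp h1
  simp only [Function.comp_def, Real.sqrt_sq_eq_abs, Real.sqrt_zero] at h2
  exact (tendsto_zero_iff_abs_tendsto_zero _).mpr h2

theorem tilt_int (h : IsSlice e Ψ) (lam : ℝ) (hl : 0 ≤ lam) (hδ : 0 < δ) (y : Fin n → ℝ)
    (ε : ℕ → ℝ) (c : ℕ → Fin n → EuclideanSpace ℝ (Fin (m + 1))) (hε : ∀ k, 0 < ε k)
    (hε1 : ∀ k, ε k ≤ 1) (hg : ∀ k, Good (c k) δ) (hg' : ∀ k, Good (fun i => c k i - lam • e) δ)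
    (R : ℝ) (hR0 : 0 < R) (hRy : ∀ i, |y i| ≤ R) (hRc : ∀ k i, ‖c k i‖ ≤ R)
    (hy0 : ∀ k, ∫ z, mn (ε k) (lin (c k) z) y * lseW (ε k) (lin (c k) z) = 0)
    (hH : Tendsto (fun k => - ∫ z, hs (ε k) (lin (c k) z) y y * lseW (ε k) (lin (c k) z)) atTop (𝓝 0)) :
    Tendsto (fun k => (∫ s, cumV (ε k) (c k) Ψ y s * Real.exp (lam * s)) -
      cumV (ε k) (c k) Ψ y 0 / rhoS (ε k) (c k) Ψ 0 * pZ (ε k) (fun i => c k i - lam • e))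
      atTop (𝓝 0) := by
  set I0 := ∫ z : Fin m → ℝ, Real.exp (-(δ / 2 * ‖z‖)) with hI0
  have mp := fun k => mnW_parts (hε k) hδ h lam hl (hg k) (hg' k) y R hRy (hy0 k)
  obtain ⟨μ0, hμ0, hμ⟩ := rhoS_lower (n := n) h R hR0 0
  have hv : ∀ k, |cumV (ε k) (c k) Ψ y 0 / rhoS (ε k) (c k) Ψ 0| ≤ (R * I0) / (δ / 2) / μ0 := by
    intro k
    have h1 := hμ (ε k) δ (c k) (hε k) (hε1 k) hδ (hg k) (hRc k) 0 (by simp)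
    have h2 := (mp k).1 0
    simp only [mul_zero, abs_zero, neg_zero, Real.exp_zero, mul_one] at h2
    rw [abs_div, abs_of_pos (rhoS_pos (hε k) hδ (hg k) h 0)]
    exact div_le_div₀ ((abs_nonneg _).trans h2) h2 hμ0 h1
  set v := fun k => cumV (ε k) (c k) Ψ y 0 / rhoS (ε k) (c k) Ψ 0 with hvdef
  set M := (R * I0) / (δ / 2) / μ0
  have crT : ∀ k, Continuous (rhoT (ε k) (c k) Ψ y) := fun k =>
    (decay_mn (hε k) (hg k) y R hRy).slice_cont hδ h
  have irT : ∀ k, Integrable (rhoT (ε k) (c k) Ψ y) := fun k =>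
    ((decay_mn (hε k) (hg k) y R hRy).fubini hδ h).1
  have cV : ∀ k, Continuous (cumV (ε k) (c k) Ψ y) := fun k =>
    continuous_iff_continuousAt.mpr fun s => (cum_deriv _ (crT k) (irT k) s).continuousAt
  have cS : ∀ k, Continuous (rhoS (ε k) (c k) Ψ) := fun k => (decay_W (hε k) (hg k)).slice_cont hδ h
  have key := dct_exp (fun k s => (cumV (ε k) (c k) Ψ y s - v k * rhoS (ε k) (c k) Ψ s) * Real.exp (lam * s))
    (fun k => by have := cV k; have := cS k; fun_prop) ((R * I0) / (δ / 2) + M * (1 * I0)) (δ / 2) (half_pos hδ)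
    ?_ ?_
  · refine key.congr fun k => ?_
    have i1 : Integrable fun s => cumV (ε k) (c k) Ψ y s * Real.exp (lam * s) :=
      integrable_of_exp _ (by have := cV k; fun_prop) _ (δ / 2) (half_pos hδ) (fun s => by
        rw [abs_mul, abs_of_pos (Real.exp_pos _)]; exact (mp k).1 s)
    have i2 : Integrable fun s => v k * (rhoS (ε k) (c k) Ψ s * Real.exp (lam * s)) :=
      (integrable_of_exp _ (by have := cS k; fun_prop) _ (δ / 2) (half_pos hδ) (fun s => by
        rw [abs_mul, abs_of_pos (Real.exp_pos _)]; exact (mp k).2.1 s)).const_mul _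
    have e1 : pZ (ε k) (fun i => c k i - lam • e) = ∫ s, rhoS (ε k) (c k) Ψ s * Real.exp (lam * s) := by
      unfold pZ
      rw [← ((decay_W (hε k) (hg' k)).fubini hδ h).2]
      refine integral_congr_ae (Eventually.of_forall fun s => ?_)
      exact rhoS_tilt (hε k) h lam s
    rw [e1, ← integral_const_mul, ← integral_sub i1 i2]
    refine integral_congr_ae (Eventually.of_forall fun s => ?_)
    simp only
    ring
  · intro k s
    have h1 := (mp k).1 s
    have h2 := (mp k).2.1 s
    rw [sub_mul]
    refine (abs_sub _ _).trans ?_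
    rw [mul_assoc, abs_mul, abs_mul, abs_mul, abs_of_pos (Real.exp_pos (lam * s)), add_mul, mul_assoc M]
    refine add_le_add h1 (mul_le_mul (hv k) h2 (by positivity) ((abs_nonneg _).trans (hv k)))
  · intro s
    obtain ⟨μs, hμs, hμs'⟩ := rhoS_lower (n := n) h R hR0 |s|
    have hd : Tendsto (fun k => cumV (ε k) (c k) Ψ y s / rhoS (ε k) (c k) Ψ s - v k) atTop (𝓝 0) := by
      refine sq_small _ _ (|s| / μs) (fun k => ?_) hH
      rcases le_total 0 s with h0 | h0
      · have := slice_main (hε k) hδ (hg k) h y (hy0 k) 0 s μs h0 hμs (fun t ht =>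
          hμs' _ δ _ (hε k) (hε1 k) hδ (hg k) (hRc k) t (by
            rw [abs_of_nonneg ht.1, abs_of_nonneg h0]; exact ht.2))
        rw [abs_of_nonneg h0]
        simpa using this
      · have := slice_main (hε k) hδ (hg k) h y (hy0 k) s 0 μs h0 hμs (fun t ht =>
          hμs' _ δ _ (hε k) (hε1 k) hδ (hg k) (hRc k) t (by
            rw [abs_of_nonpos ht.2, abs_of_nonpos h0]; linarith [ht.1]))
        rw [abs_of_nonpos h0]
        rw [zero_sub] at this
        rw [← neg_sq, neg_sub]
        exact this
    have hb : ∀ k, |rhoS (ε k) (c k) Ψ s * Real.exp (lam * s)| ≤ (1 * I0) * Real.exp (-(δ / 2 * |s|)) := by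
      intro k
      rw [abs_mul, abs_of_pos (Real.exp_pos (lam * s))]; exact (mp k).2.1 s
    have := hd.zero_mul_isBoundedUnder_le (g := fun k => rhoS (ε k) (c k) Ψ s * Real.exp (lam * s))
      (isBoundedUnder_of ⟨_, hb⟩)
    refine this.congr fun k => ?_
    have := (rhoS_pos (hε k) hδ (hg k) h s).ne'
    field_simp

theorem tilt_limit (he : ‖e‖ = 1) (lam : ℝ) (hl : 0 ≤ lam) (hδ : 0 < δ) (y : Fin n → ℝ)
    (ε : ℕ → ℝ) (c : ℕ → Fin n → EuclideanSpace ℝ (Fin (m + 1))) (hε : ∀ k, 0 < ε k)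
    (hε1 : ∀ k, ε k ≤ 1) (hg : ∀ k, Good (c k) δ) (hg' : ∀ k, Good (fun i => c k i - lam • e) δ)
    (R : ℝ) (hR0 : 0 < R) (hRy : ∀ i, |y i| ≤ R) (hRc : ∀ k i, ‖c k i‖ ≤ R)
    (hRc' : ∀ k i, ‖c k i - lam • e‖ ≤ R)
    (hy0 : ∀ k, ∫ z, mn (ε k) (lin (c k) z) y * lseW (ε k) (lin (c k) z) = 0)
    (hH : Tendsto (fun k => - ∫ z, hs (ε k) (lin (c k) z) y y * lseW (ε k) (lin (c k) z)) atTop (𝓝 0)) :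
    Tendsto (fun k => (∑ i, pA (ε k) (fun i => c k i - lam • e) i * y i) -
      (∫ z, mn (ε k) (lin (c k) z) y * lseW (ε k) (lin (c k) z) * inner ℝ z (lam • e)) / pZ (ε k) (c k))
      atTop (𝓝 0) := by
  obtain ⟨Ψ, h⟩ := exists_slice e he
  have t1 := tilt_int h lam hl hδ y ε c hε hε1 hg hg' R hR0 hRy hRc hy0 hH
  have t0 := tilt_int h 0 le_rfl hδ y ε c hε hε1 hg (by simpa using hg) R hR0 hRy hRc hy0 hH
  simp only [zero_mul, Real.exp_zero, mul_one, zero_smul, sub_zero] at t0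
  obtain ⟨μ, hμ, hμZ⟩ := pZ_lower (n := n) (m := m) R hR0
  have hinv : ∀ c' : ℕ → Fin n → EuclideanSpace ℝ (Fin (m + 1)), (∀ k, Good (c' k) δ) →
      (∀ k i, ‖c' k i‖ ≤ R) → ∀ k, |(lam / pZ (ε k) (c' k))| ≤ lam / μ := by
    intro c' h1 h2 k
    have := hμZ (ε k) δ (c' k) (hε k) (hε1 k) hδ (h1 k) (h2 k)
    rw [abs_of_nonneg (div_nonneg hl (hμ.le.trans this))]
    exact div_le_div_of_nonneg_left hl hμ this
  have u1 := t1.zero_mul_isBoundedUnder_le (g := fun k => lam / pZ (ε k) (fun i => c k i - lam • e))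
    (isBoundedUnder_of ⟨_, hinv _ hg' hRc'⟩)
  have u0 := t0.zero_mul_isBoundedUnder_le (g := fun k => lam / pZ (ε k) (c k))
    (isBoundedUnder_of ⟨_, hinv _ hg hRc⟩)
  have := u1.sub u0
  rw [sub_zero] at this
  refine this.congr fun k => ?_
  have mp := mnW_parts (hε k) hδ h lam hl (hg k) (hg' k) y R hRy (hy0 k)
  have z1 := (pZ_pos (hε k) hδ (hg k)).ne'
  have z2 := (pZ_pos (hε k) hδ (hg' k)).ne'
  have e1 : ∑ i, pA (ε k) (fun i => c k i - lam • e) i * y i =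
      (∑ i, pI (ε k) (fun i => c k i - lam • e) i * y i) / pZ (ε k) (fun i => c k i - lam • e) := by
    unfold pA
    rw [Finset.sum_div]
    exact Finset.sum_congr rfl fun i _ => by ring
  have e2 : ∫ z, mn (ε k) (lin (c k) z) y * lseW (ε k) (lin (c k) z) * inner ℝ z (lam • e) =
      lam * ∫ s, cumV (ε k) (c k) Ψ y s := by
    rw [← mp.2.2.2, ← integral_const_mul]
    refine integral_congr_ae (Eventually.of_forall fun z => ?_)
    simp only [inner_smul_right]; ring
  rw [e1, e2, mp.2.2.1]
  field_simp
  ring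

end tilt


section small
open MeasureTheory Set Filter Topology
variable {n m : ℕ} [NeZero n] {c : Fin n → EuclideanSpace ℝ (Fin (m + 1))} {δ ε : ℝ}

theorem hs_self (ε : ℝ) (l y : Fin n → ℝ) :
    hs ε l y y = (∑ i, smx ε l i * (y i * y i)) -
      (1 + 1 / ε) * ((1 / 2) * ∑ i, ∑ j, smx ε l i * smx ε l j * ((y i - y j) * (y i - y j))) := by
  have h1 := smx_sum ε l
  have e : ∑ i, ∑ j, smx ε l i * smx ε l j * ((y i - y j) * (y i - y j)) =
      2 * (∑ i, smx ε l i * (y i * y i)) - 2 * ((∑ i, smx ε l i * y i) * (∑ i, smx ε l i * y i)) := by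
    have e1 : ∀ i j, smx ε l i * smx ε l j * ((y i - y j) * (y i - y j)) =
      (smx ε l i * (y i * y i)) * smx ε l j + smx ε l i * (smx ε l j * (y j * y j)) -
        2 * ((smx ε l i * y i) * (smx ε l j * y j)) := fun i j => by ring
    simp_rw [e1, Finset.sum_sub_distrib, Finset.sum_add_distrib, ← Finset.mul_sum, ← Finset.sum_mul, h1]
    ring
  rw [e]
  unfold hs mn
  ring

theorem hs_trace {D : ℕ} (ε : ℝ) (l : Fin n → ℝ) (v : Fin n → EuclideanSpace ℝ (Fin D)) :
    ∑ b, hs ε l (fun i => v i b) (fun i => v i b) = (∑ i, smx ε l i * ‖v i‖ ^ 2) -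
      (1 + 1 / ε) * ((1 / 2) * ∑ i, ∑ j, smx ε l i * smx ε l j * ‖v i - v j‖ ^ 2) := by
  simp_rw [hs_self, Finset.sum_sub_distrib, ← Finset.mul_sum]
  have e : ∀ w : EuclideanSpace ℝ (Fin D), ‖w‖ ^ 2 = ∑ b, w b * w b := by
    intro w
    rw [EuclideanSpace.norm_sq_eq]
    exact Finset.sum_congr rfl fun b _ => by rw [Real.norm_eq_abs, sq_abs, sq]
  simp_rw [e]
  congr 1
  · rw [Finset.sum_comm]
    exact Finset.sum_congr rfl fun i _ => by rw [Finset.mul_sum]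
  · congr 2
    rw [Finset.sum_comm]
    refine Finset.sum_congr rfl fun i _ => ?_
    rw [Finset.sum_comm]
    refine Finset.sum_congr rfl fun j _ => ?_
    rw [Finset.mul_sum]
    rfl

/-- pair weights -/
noncomputable def pP (ε : ℝ) (c : Fin n → EuclideanSpace ℝ (Fin (m + 1))) (i j : Fin n) : ℝ :=
  ∫ z, smx ε (lin c z) i * smx ε (lin c z) j * lseW ε (lin c z)

theorem decay_pair (hε : 0 < ε) (hg : Good c δ) (i j : Fin n) :
    Decay δ 1 (fun z => smx ε (lin c z) i * smx ε (lin c z) j * lseW ε (lin c z)) :=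
  decay_mulW hε hg (fun l => smx ε l i * smx ε l j) ((continuous_smx ε i).mul (continuous_smx ε j)) 1
    (fun l => by
      rw [abs_of_pos (mul_pos (smx_pos ε l i) (smx_pos ε l j))]
      exact mul_le_one₀ (smx_le_one ε l i) (smx_pos ε l j).le (smx_le_one ε l j))

theorem int_hs_trace {D : ℕ} (hε : 0 < ε) (hδ : 0 < δ) (hg : Good c δ)
    (v : Fin n → EuclideanSpace ℝ (Fin D)) :
    ∑ b, ∫ z, hs ε (lin c z) (fun i => v i b) (fun i => v i b) * lseW ε (lin c z) =
      (∑ i, pI ε c i * ‖v i‖ ^ 2) -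
      (1 + 1 / ε) * ((1 / 2) * ∑ i, ∑ j, pP ε c i j * ‖v i - v j‖ ^ 2) := by
  have ihs : ∀ b, Integrable fun z => hs ε (lin c z) (fun i => v i b) (fun i => v i b) * lseW ε (lin c z) := by
    intro b
    obtain ⟨R, -, hR, -⟩ := exists_bound2 (fun i => v i b) (fun i => v i b)
    exact (decay_hs hε hg _ _ R hR hR).integrable hδ
  rw [← integral_finsetSum _ fun b _ => ihs b]
  simp_rw [← Finset.sum_mul, hs_trace]
  unfold pI pP
  simp_rw [← integral_mul_const]
  have iI : ∀ i, Integrable fun z => smx ε (lin c z) i * lseW ε (lin c z) * ‖v i‖ ^ 2 := fun i =>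
    ((decay_smx hε hg i).integrable hδ).mul_const _
  have iP : ∀ i j, Integrable fun z => smx ε (lin c z) i * smx ε (lin c z) j * lseW ε (lin c z) * ‖v i - v j‖ ^ 2 :=
    fun i j => ((decay_pair hε hg i j).integrable hδ).mul_const _
  rw [← integral_finsetSum _ fun i _ => iI i]
  simp_rw [← integral_finsetSum _ fun j _ => iP _ j]
  have iP2 : ∀ i, Integrable fun z => ∑ j, smx ε (lin c z) i * smx ε (lin c z) j * lseW ε (lin c z) * ‖v i - v j‖ ^ 2 :=
    fun i => integrable_finsetSum _ fun j _ => iP i j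
  rw [← integral_finsetSum _ fun i _ => iP2 i, ← integral_const_mul, ← integral_const_mul, ← integral_sub]
  · refine integral_congr_ae (Eventually.of_forall fun z => ?_)
    simp only [sub_mul, Finset.sum_mul, Finset.mul_sum]
    congr 1
    · exact Finset.sum_congr rfl fun i _ => by ring
    · exact Finset.sum_congr rfl fun i _ => Finset.sum_congr rfl fun j _ => by ring
  · exact integrable_finsetSum _ fun i _ => iI i
  · exact ((integrable_finsetSum _ fun i _ => iP2 i).const_mul _).const_mul _

theorem trace_id {d : ℕ} {a : Fin n → EuclideanSpace ℝ (Fin (m + 1))} {x : EuclideanSpace ℝ (Fin (m + 1))}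
    (hε : 0 < ε) (hδ : 0 < δ) (hg : Good (fun i => a i - x) δ)
    (q : Fin n → EuclideanSpace ℝ (Fin d)) (κ : ℝ) (hκ : ∀ i, ‖q i‖ ^ 2 = ‖a i‖ ^ 2 + κ) :
    ∑ b, (- ∫ z, hs ε (lin (fun i => a i - x) z) (fun i => q i b) (fun i => q i b) *
      lseW ε (lin (fun i => a i - x) z)) = - ((κ + ‖x‖ ^ 2) * pZ ε (fun i => a i - x)) +
      (1 + 1 / ε) * ((1 / 2) * ∑ i, ∑ j, pP ε (fun i => a i - x) i j *
        (‖q i - q j‖ ^ 2 - ‖a i - a j‖ ^ 2)) := by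
  have hq := int_hs_trace hε hδ hg q
  have ha := int_hs_trace hε hδ hg (fun i => a i - x)
  have ha0 : ∑ b, ∫ z, hs ε (lin (fun i => a i - x) z) (fun i => (a i - x) b) (fun i => (a i - x) b) *
      lseW ε (lin (fun i => a i - x) z) = 0 := by
    refine Finset.sum_eq_zero fun b _ => ?_
    have h1 := (int_mn_dir hε hδ hg (EuclideanSpace.single b (1:ℝ)) (by simp)).2
    have h2 : lin (fun i => a i - x) (EuclideanSpace.single b (1:ℝ)) = fun i => (a i - x) b := by
      ext i; simp [lin, EuclideanSpace.inner_single_left]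
    rw [h2] at h1
    exact h1
  rw [ha0] at ha
  simp only [sub_sub_sub_cancel_right] at ha
  rw [Finset.sum_neg_distrib, hq]
  have hS : ∑ i, pI ε (fun i => a i - x) i * ‖q i‖ ^ 2 =
      (∑ i, pI ε (fun i => a i - x) i * ‖a i - x‖ ^ 2) + (κ + ‖x‖ ^ 2) * pZ ε (fun i => a i - x) := by
    have hb := pI_bary hε hδ hg
    have hs := pI_sum hε hδ hg
    have e1 : ∀ i, ‖q i‖ ^ 2 = ‖a i - x‖ ^ 2 + 2 * inner ℝ (a i - x) x + (κ + ‖x‖ ^ 2) := by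
      intro i
      have h1 := norm_sub_sq_real (a i) x
      have h2 : inner ℝ (a i - x) x = inner ℝ (a i) x - ‖x‖ ^ 2 := by
        rw [inner_sub_left, real_inner_self_eq_norm_sq]
      rw [hκ, h1, h2]; ring
    have e2 : ∑ i, pI ε (fun i => a i - x) i * inner ℝ (a i - x) x = 0 := by
      have : (inner ℝ (∑ i, pI ε (fun i => a i - x) i • (a i - x)) x : ℝ) = 0 := by rw [hb, inner_zero_left]
      rw [sum_inner] at this
      simpa [inner_smul_left] using this
    simp_rw [e1, mul_add, Finset.sum_add_distrib, ← Finset.sum_mul, hs]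
    have e3 : ∑ i, pI ε (fun i => a i - x) i * (2 * inner ℝ (a i - x) x) = 0 := by
      have : ∀ i, pI ε (fun i => a i - x) i * (2 * inner ℝ (a i - x) x) =
        2 * (pI ε (fun i => a i - x) i * inner ℝ (a i - x) x) := fun i => by ring
      simp_rw [this, ← Finset.mul_sum, e2, mul_zero]
    rw [e3]; ring
  rw [hS]
  simp_rw [mul_sub, Finset.sum_sub_distrib, mul_sub]
  linarith

/-- pairs which do not touch contribute little -/
theorem small_offpair (hδ : 0 < δ) (g : ℝ) (hg0 : 0 < g) (u v : EuclideanSpace ℝ (Fin (m + 1))) (hu : u ≠ 0)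
    (huv : ∀ t : ℝ, v ≠ t • u) (ε : ℕ → ℝ) (hε : ∀ k, 0 < ε k) (hε0 : Tendsto ε atTop (𝓝 0))
    (f : ℕ → EuclideanSpace ℝ (Fin (m + 1)) → ℝ) (hf : ∀ k, Decay δ 1 (f k)) (hf0 : ∀ k z, 0 ≤ f k z)
    (b1 : ∀ k z, f k z ≤ Real.exp (-(g * |(inner ℝ z u : ℝ)| / ε k)) * Real.exp (-(δ * ‖z‖)))
    (b2 : ∀ k z, f k z ≤ Real.exp (-(g * |(inner ℝ z v : ℝ)| / ε k))) :
    Tendsto (fun k => 1 / ε k * ∫ z, f k z) atTop (𝓝 0) := by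
  have hun : 0 < ‖u‖ := norm_pos_iff.mpr hu
  set e := ‖u‖⁻¹ • u with he
  have hen : ‖e‖ = 1 := by rw [he, norm_smul, norm_inv, norm_norm, inv_mul_cancel₀ hun.ne']
  have hue : u = ‖u‖ • e := by rw [he, smul_smul, mul_inv_cancel₀ hun.ne', one_smul]
  obtain ⟨Ψ, h⟩ := exists_slice e hen
  have hinn : ∀ s z, |(inner ℝ (Ψ (s, z)) u : ℝ)| = ‖u‖ * |s| := by
    intro s z
    have : (inner ℝ (Ψ (s, z)) u : ℝ) = ‖u‖ * s := by
      conv_lhs => rw [hue]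
      rw [inner_smul_right, h.inner]
    rw [this, abs_mul, abs_norm]
  have hJ := dct_exp (fun k s => ∫ z, f k (Ψ (ε k * s, z)))
    (fun k => ((hf k).slice_cont hδ h).comp (continuous_const.mul continuous_id))
    (∫ z : Fin m → ℝ, Real.exp (-(δ * ‖z‖))) (g * ‖u‖) (by positivity) ?_ ?_
  · refine hJ.congr fun k => ?_
    have h1 := Measure.integral_comp_mul_left (fun s => ∫ z, f k (Ψ (s, z))) (ε k)
    rw [h1, ((hf k).fubini hδ h).2, abs_of_pos (inv_pos.mpr (hε k)), smul_eq_mul, one_div]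
  · intro k s
    rw [← Real.norm_eq_abs, mul_comm (∫ z : Fin m → ℝ, Real.exp (-(δ * ‖z‖))), ← integral_const_mul]
    refine norm_integral_le_of_norm_le ((integrable_exp_norm volume δ hδ).const_mul _)
      (Eventually.of_forall fun z => ?_)
    rw [Real.norm_of_nonneg (hf0 _ _)]
    refine (b1 k _).trans ?_
    rw [hinn, abs_mul, abs_of_pos (hε k)]
    have e1 : g * (‖u‖ * (ε k * |s|)) / ε k = g * ‖u‖ * |s| := by
      have := (hε k).ne'; field_simp
    rw [e1]
    gcongr
    exact h.norm _ _
  · intro s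
    have := tendsto_integral_of_dominated_convergence (μ := (volume : Measure (Fin m → ℝ)))
      (F := fun k z => f k (Ψ (ε k * s, z))) (f := fun _ => 0) (fun z => Real.exp (-(δ * ‖z‖)))
      (fun k => ((hf k).slice_integrable hδ h _).aestronglyMeasurable)
      (integrable_exp_norm volume δ hδ) (fun k => Eventually.of_forall fun z => ?_) ?_
    · simpa using this
    · rw [Real.norm_eq_abs]
      refine ((hf k).bound _).trans ?_
      rw [one_mul]
      gcongr
      exact h.norm _ _
    · set L : (Fin m → ℝ) →ₗ[ℝ] ℝ :=
        { toFun := fun z => inner ℝ (Ψ (0, z)) v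
          map_add' := fun z z' => by
            rw [← inner_add_left, ← map_add]; simp
          map_smul' := fun t z => by
            have : Ψ (0, t • z) = t • Ψ (0, z) := by rw [← map_smul]; simp
            simp [this, inner_smul_left] } with hL
      have hne : LinearMap.ker L ≠ ⊤ := by
        intro htop
        apply huv ((inner ℝ v e : ℝ) * ‖u‖⁻¹)
        rw [mul_smul, ← he]
        set w := v - (inner ℝ v e : ℝ) • e with hw
        have hwe : (inner ℝ w e : ℝ) = 0 := by
          rw [hw, inner_sub_left, inner_smul_left, real_inner_self_eq_norm_sq, hen]; simp
        obtain ⟨⟨s0, z0⟩, hz0⟩ := Ψ.surjective w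
        have hs0 : s0 = 0 := by rw [← h.inner s0 z0, hz0, hwe]
        have h1 : L z0 = 0 := by
          have : z0 ∈ LinearMap.ker L := by rw [htop]; trivial
          exact this
        have h2 : (inner ℝ w v : ℝ) = 0 := by
          rw [← hz0, hs0]; exact h1
        have h3 : (inner ℝ w w : ℝ) = 0 := by
          have h4 : (inner ℝ w w : ℝ) = inner ℝ w v - (inner ℝ v e : ℝ) * inner ℝ w e := by
            conv_lhs => rw [hw]
            rw [← hw, inner_sub_right, inner_smul_right]
          rw [h4, h2, hwe]; ring
        have h5 := inner_self_eq_zero.mp h3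
        rw [hw, sub_eq_zero] at h5
        exact h5
      have hnull := Measure.addHaar_submodule (volume : Measure (Fin m → ℝ)) _ hne
      have hae : ∀ᵐ z : Fin m → ℝ, z ∉ (LinearMap.ker L : Set (Fin m → ℝ)) :=
        measure_eq_zero_iff_ae_notMem.mp hnull
      filter_upwards [hae] with z hz
      have hz' : (inner ℝ (Ψ (0, z)) v : ℝ) ≠ 0 := fun hc => hz hc
      have t1 : Tendsto (fun k => g * |(inner ℝ (Ψ (ε k * s, z)) v : ℝ)|) atTop
          (𝓝 (g * |(inner ℝ (Ψ (0 * s, z)) v : ℝ)|)) := by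
        have hc : Continuous fun t : ℝ => g * |(inner ℝ (Ψ (t * s, z)) v : ℝ)| := by fun_prop
        exact (hc.tendsto 0).comp hε0
      rw [zero_mul] at t1
      have t2 : Tendsto (fun k => (ε k)⁻¹) atTop atTop :=
        (tendsto_nhdsWithin_of_tendsto_nhds_of_eventually_within _ hε0
          (Eventually.of_forall hε)).inv_tendsto_nhdsGT_zero
      have t3 := Real.tendsto_exp_neg_atTop_nhds_zero.comp
        (t1.pos_mul_atTop (mul_pos hg0 (abs_pos.mpr hz')) t2)
      exact squeeze_zero (fun k => hf0 _ _) (fun k => b2 k _) t3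

theorem log_smx (l : Fin n → ℝ) (i : Fin n) :
    Real.log (smx ε l i) = l i / ε - Real.log (lseS ε l) := by
  unfold smx
  rw [Real.log_div (Real.exp_pos _).ne' (lseS_pos ε l).ne', Real.log_exp]

theorem pair_bound (hε : 0 < ε) (l : Fin n → ℝ) (i j k : Fin n) (β : Fin n → ℝ) (θ : ℝ) (hθ0 : 0 ≤ θ) (hθ1 : θ ≤ 1)
    (hβ : ∀ i, 0 ≤ β i) (hβ1 : ∑ i, β i = 1) (hl : θ * l i + (1 - θ) * l j = ∑ r, β r * l r) :
    smx ε l i * smx ε l j ≤ Real.exp (-(β k * |l i - l j| / ε)) ∧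
    smx ε l i * smx ε l j ≤ Real.exp (-(β k * |l i - l k| / ε)) := by
  have hk1 : β k ≤ 1 := by
    rw [← hβ1]; exact Finset.single_le_sum (fun i _ => hβ i) (Finset.mem_univ k)
  have hL : ∀ r, Real.log (smx ε l r) ≤ 0 := fun r =>
    Real.log_nonpos (smx_pos ε l r).le (smx_le_one ε l r)
  have hlog := log_smx (ε := ε) l
  have hk := hβ k
  have e1 : θ * Real.log (smx ε l i) + (1 - θ) * Real.log (smx ε l j) = ∑ r, β r * Real.log (smx ε l r) := by
    simp_rw [hlog, mul_sub, Finset.sum_sub_distrib, ← Finset.sum_mul, hβ1, mul_div_assoc', ← Finset.sum_div, ← hl]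
    ring
  have e2 : ∑ r, β r * Real.log (smx ε l r) ≤ β k * Real.log (smx ε l k) := by
    have : ∑ r, -(β r * Real.log (smx ε l r)) ≥ -(β k * Real.log (smx ε l k)) :=
      Finset.single_le_sum (f := fun r => -(β r * Real.log (smx ε l r)))
        (fun r _ => by have := mul_nonneg (hβ r) (neg_nonneg.mpr (hL r)); linarith) (Finset.mem_univ k)
    rw [Finset.sum_neg_distrib] at this
    linarith
  have hprod : smx ε l i * smx ε l j = Real.exp (Real.log (smx ε l i) + Real.log (smx ε l j)) := by
    rw [Real.exp_add, Real.exp_log (smx_pos _ _ _), Real.exp_log (smx_pos _ _ _)]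
  have hd : ∀ r, |l i - l r| / ε = |Real.log (smx ε l i) - Real.log (smx ε l r)| := by
    intro r
    rw [hlog, hlog, show l i / ε - Real.log (lseS ε l) - (l r / ε - Real.log (lseS ε l)) = (l i - l r) / ε by ring,
      abs_div, abs_of_pos hε]
  rw [hprod, Real.exp_le_exp, Real.exp_le_exp, mul_div_assoc, mul_div_assoc, hd, hd]
  have hLi := hL i
  have hLj := hL j
  have hLk := hL k
  constructor
  · rcases abs_cases (Real.log (smx ε l i) - Real.log (smx ε l j)) with ⟨h, _⟩ | ⟨h, _⟩ <;> rw [h] <;> nlinarith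
  · rcases abs_cases (Real.log (smx ε l i) - Real.log (smx ε l k)) with ⟨h, _⟩ | ⟨h, _⟩ <;> rw [h] <;> nlinarith

end small


section core
open MeasureTheory Set Filter Topology

theorem compact_mod {X : Type*} [TopologicalSpace X] (K : Set X) (hK : IsCompact K) (f g : X → ℝ)
    (hf : Continuous f) (hg : Continuous g) (hf0 : ∀ x ∈ K, 0 ≤ f x) (h : ∀ x ∈ K, f x = 0 → g x = 0)
    (τ : ℝ) (hτ : 0 < τ) : ∃ η > 0, ∀ x ∈ K, f x ≤ η → g x ≤ τ := by
  have hc : IsCompact (K ∩ {x | τ ≤ g x}) := hK.inter_right (isClosed_le continuous_const hg)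
  rcases (K ∩ {x | τ ≤ g x}).eq_empty_or_nonempty with he | hne
  · refine ⟨1, one_pos, fun x hx _ => ?_⟩
    by_contra hcon
    have : x ∈ K ∩ {x | τ ≤ g x} := ⟨hx, (not_le.mp hcon).le⟩
    rw [he] at this
    exact this
  · obtain ⟨x0, hx0, hmin⟩ := hc.exists_isMinOn hne hf.continuousOn
    have hpos : 0 < f x0 := by
      rcases (hf0 x0 hx0.1).lt_or_eq with h1 | h1
      · exact h1
      · have := h x0 hx0.1 h1.symm
        have h2 : τ ≤ g x0 := hx0.2
        linarith
    refine ⟨f x0 / 2, half_pos hpos, fun x hx hfx => ?_⟩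
    by_contra hcon
    have : f x0 ≤ f x := hmin ⟨hx, (not_le.mp hcon).le⟩
    linarith

variable {n m : ℕ} [NeZero n] {c : Fin n → EuclideanSpace ℝ (Fin (m + 1))} {δ ε : ℝ}

theorem hess_nonneg (hε : 0 < ε) (hδ : 0 < δ) (hg : Good c δ) (y : Fin n → ℝ)
    (hy0 : ∫ z, mn ε (lin c z) y * lseW ε (lin c z) = 0) :
    0 ≤ - ∫ z, hs ε (lin c z) y y * lseW ε (lin c z) := by
  obtain ⟨Ψ, h⟩ := exists_slice (EuclideanSpace.single (0 : Fin (m + 1)) (1:ℝ)) (by simp)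
  have cS : Continuous (rhoS ε c Ψ) := (decay_W hε hg).slice_cont hδ h
  obtain ⟨s0, hs0, hmin⟩ := (isCompact_Icc (a := (0:ℝ)) (b := 1)).exists_isMinOn
    (nonempty_Icc.mpr zero_le_one) cS.continuousOn
  have h1 := slice_main hε hδ hg h y hy0 0 1 (rhoS ε c Ψ s0) zero_le_one (rhoS_pos hε hδ hg h s0)
    (fun s hs => hmin hs)
  have h2 := (sq_nonneg _).trans h1
  rw [sub_zero] at h2
  exact nonneg_of_mul_nonneg_right h2 (one_div_pos.mpr (rhoS_pos hε hδ hg h s0))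

theorem int_mnz (hε : 0 < ε) (hδ : 0 < δ) (hg : Good c δ) (y : Fin n → ℝ)
    (u : EuclideanSpace ℝ (Fin (m + 1))) :
    Integrable fun z => mn ε (lin c z) y * lseW ε (lin c z) * inner ℝ z u := by
  obtain ⟨R, hR0, hR, -⟩ := exists_bound2 y y
  have k := decay_mn hε hg y R hR
  have k2 : Decay (δ / 2) (R * (2 / δ) * ‖u‖)
      (fun z => mn ε (lin c z) y * lseW ε (lin c z) * inner ℝ z u) := by
    refine ⟨?_, fun z => ?_⟩
    · exact (((continuous_mn ε y).comp continuous_lin).mul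
        ((continuous_lseW ε).comp continuous_lin)).mul (by fun_prop)
    · have h1 := k.bound z
      rw [neg_mul, abs_neg] at h1
      rw [abs_mul]
      have h2 := abs_real_inner_le_norm z u
      have h3 := s_exp_bound δ ‖z‖ hδ
      rw [abs_norm] at h3
      calc _ ≤ (R * Real.exp (-(δ * ‖z‖))) * (‖z‖ * ‖u‖) :=
            mul_le_mul h1 h2 (abs_nonneg _) (by positivity)
        _ = R * (‖z‖ * Real.exp (-(δ * ‖z‖))) * ‖u‖ := by ring
        _ ≤ R * (2 / δ * Real.exp (-(δ / 2 * ‖z‖))) * ‖u‖ := by gcongr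
        _ = _ := by ring
  exact k2.integrable (half_pos hδ)

set_option maxHeartbeats 1600000 in
theorem limit_core {d : ℕ} (a : Fin n → EuclideanSpace ℝ (Fin (m + 1))) (q : Fin n → EuclideanSpace ℝ (Fin d))
    (κ : ℝ) (hκ0 : 0 ≤ κ) (hκ : ∀ i, ‖q i‖ ^ 2 = ‖a i‖ ^ 2 + κ)
    (hC : ∀ i j, i ≠ j → ‖q i - q j‖ = ‖a i - a j‖ ∨ ∃ k, k ≠ i ∧ k ≠ j ∧ ∃ (β : Fin n → ℝ) (θ : ℝ),
      0 ≤ θ ∧ θ ≤ 1 ∧ (∀ r, 0 ≤ β r) ∧ ∑ r, β r = 1 ∧ 0 < β k ∧ θ • a i + (1 - θ) • a j = ∑ r, β r • a r)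
    (hD : ∀ i j k, i ≠ j → k ≠ i → k ≠ j → ∀ t : ℝ, a i - a k ≠ t • (a i - a j))
    (hinj : Function.Injective a)
    (hG : ∀ i, ∀ α : Fin n → ℝ, (∀ r, 0 ≤ α r) → ∑ r, α r = 1 → ∑ r, α r • a r = a i → ∑ r, α r • q r = q i)
    (hδ : 0 < δ) (ε : ℕ → ℝ) (hε : ∀ k, 0 < ε k) (hε1 : ∀ k, ε k ≤ 1) (hε0 : Tendsto ε atTop (𝓝 0))
    (x : ℕ → EuclideanSpace ℝ (Fin (m + 1))) (hg : ∀ k, Good (fun i => a i - x k) δ)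
    (hx : ∀ k, ∑ i, pA (ε k) (fun i => a i - x k) i • q i = 0) :
    κ = 0 ∧ ∀ t : Fin n → ℝ, ∑ i, t i • a i = 0 → ∑ i, t i • q i = 0 := by
  -- bounds
  set R0 := ∑ i, ‖a i‖ with hR0
  have haR : ∀ i, ‖a i‖ ≤ R0 := fun i =>
    Finset.single_le_sum (f := fun i => ‖a i‖) (fun i _ => norm_nonneg _) (Finset.mem_univ i)
  have hR00 : 0 ≤ R0 := (norm_nonneg _).trans (haR 0)
  clear_value R0
  have hxR : ∀ k, ‖x k‖ ≤ R0 := by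
    intro k
    rw [← pA_bary (hε k) hδ (hg k)]
    refine (norm_sum_le _ _).trans ?_
    calc _ ≤ ∑ i, pA (ε k) (fun i => a i - x k) i * R0 := by
          refine Finset.sum_le_sum fun i _ => ?_
          rw [norm_smul, Real.norm_of_nonneg (pA_pos (hε k) hδ (hg k) i).le]
          exact mul_le_mul_of_nonneg_left (haR i) (pA_pos (hε k) hδ (hg k) i).le
      _ = R0 := by rw [← Finset.sum_mul, pA_sum (hε k) hδ (hg k), one_mul]
  have hcR : ∀ k i, ‖a i - x k‖ ≤ 2 * R0 := fun k i =>
    (norm_sub_le _ _).trans (by linarith [haR i, hxR k])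
  have hy0 : ∀ b k, ∫ z, mn (ε k) (lin (fun i => a i - x k) z) (fun i => q i b) *
      lseW (ε k) (lin (fun i => a i - x k) z) = 0 := by
    intro b k
    rw [int_mn (hε k) hδ (hg k)]
    have h1 := congrArg (fun v : EuclideanSpace ℝ (Fin d) => v b) (hx k)
    simp only [WithLp.ofLp_sum, Finset.sum_apply, PiLp.smul_apply, smul_eq_mul, PiLp.zero_apply] at h1
    unfold pA at h1
    have h2 : (∑ i, pI (ε k) (fun i => a i - x k) i * q i b) / pZ (ε k) (fun i => a i - x k) = 0 := by
      rw [← h1, Finset.sum_div]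
      exact Finset.sum_congr rfl fun i _ => by ring
    exact (div_eq_zero_iff.mp h2).resolve_right (pZ_pos (hε k) hδ (hg k)).ne'
  have hHnn := fun b k => hess_nonneg (hε k) hδ (hg k) (fun i => q i b) (hy0 b k)
  -- error term
  set T : ℕ → ℝ := fun k => (1 + 1 / ε k) * ((1 / 2) * ∑ i, ∑ j, pP (ε k) (fun i => a i - x k) i j *
        (‖q i - q j‖ ^ 2 - ‖a i - a j‖ ^ 2)) with hT
  have hTlim : Tendsto T atTop (𝓝 0) := by
    have hpair : ∀ i j, Tendsto (fun k => (1 + 1 / ε k) * (pP (ε k) (fun i => a i - x k) i j *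
        (‖q i - q j‖ ^ 2 - ‖a i - a j‖ ^ 2))) atTop (𝓝 0) := by
      intro i j
      by_cases hij : i = j
      · subst hij; simp
      rcases hC i j hij with h1 | ⟨r, hri, hrj, β, θ, hθ0, hθ1, hβ0, hβ1, hβr, hcomb⟩
      · simp [h1]
      · have hpb : ∀ k z, _ := fun k z => pair_bound (hε k) (lin (fun i => a i - x k) z) i j r β θ hθ0 hθ1 hβ0 hβ1 (by
          have e1 : θ • (a i - x k) + (1 - θ) • (a j - x k) = ∑ r, β r • (a r - x k) := by
            simp_rw [smul_sub, Finset.sum_sub_distrib, ← Finset.sum_smul, hβ1, ← hcomb]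
            module
          have e2 := congrArg (fun v => (inner ℝ z v : ℝ)) e1
          simpa [inner_add_right, inner_smul_right, inner_sum, lin] using e2)
        have hdiff : ∀ k z s, lin (fun i => a i - x k) z i - lin (fun i => a i - x k) z s = inner ℝ z (a i - a s) := by
          intro k z s
          simp only [lin]
          rw [← inner_sub_right]; congr 1; abel
        have hsm := small_offpair hδ (β r) hβr (a i - a j) (a i - a r)
          (sub_ne_zero.mpr fun h => hij (hinj h)) (hD i j r hij hri hrj) ε hε hε0
          (fun k z => smx (ε k) (lin (fun i => a i - x k) z) i * smx (ε k) (lin (fun i => a i - x k) z) j *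
            lseW (ε k) (lin (fun i => a i - x k) z)) (fun k => decay_pair (hε k) (hg k) i j)
          (fun k z => (mul_pos (mul_pos (smx_pos _ _ _) (smx_pos _ _ _)) (lseW_pos _ _)).le) ?_ ?_
        · have := ((hε0.const_add 1).mul hsm).mul_const (‖q i - q j‖ ^ 2 - ‖a i - a j‖ ^ 2)
          simp only [mul_zero, zero_mul] at this
          refine this.congr fun k => ?_
          have := (hε k).ne'
          unfold pP
          field_simp
          ring
        · intro k z
          have := (hpb k z).1
          rw [hdiff] at this
          exact mul_le_mul this (lseW_lin_le (hε k) (hg k) z) (lseW_pos _ _).le (Real.exp_pos _).le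
        · intro k z
          have := (hpb k z).2
          rw [hdiff] at this
          refine le_trans ?_ this
          refine mul_le_of_le_one_right (mul_pos (smx_pos _ _ _) (smx_pos _ _ _)).le ?_
          refine (lseW_lin_le (hε k) (hg k) z).trans ?_
          rw [Real.exp_le_one_iff]
          have := norm_nonneg z
          nlinarith
    have hsum : Tendsto (fun k => (1/2) * ∑ i, ∑ j, (1 + 1 / ε k) * (pP (ε k) (fun i => a i - x k) i j *
        (‖q i - q j‖ ^ 2 - ‖a i - a j‖ ^ 2))) atTop (𝓝 ((1/2) * ∑ i : Fin n, ∑ j : Fin n, 0)) :=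
      (tendsto_finsetSum _ fun i _ => tendsto_finsetSum _ fun j _ => hpair i j).const_mul _
    simp only [Finset.sum_const_zero, mul_zero] at hsum
    refine hsum.congr fun k => ?_
    simp only [hT, ← Finset.mul_sum]
    ring
  have htr : ∀ k, ∑ b, (- ∫ z, hs (ε k) (lin (fun i => a i - x k) z) (fun i => q i b) (fun i => q i b) *
      lseW (ε k) (lin (fun i => a i - x k) z)) = -((κ + ‖x k‖ ^ 2) * pZ (ε k) (fun i => a i - x k)) + T k :=
    fun k => trace_id (hε k) hδ (hg k) q κ hκ
  clear_value T
  obtain ⟨μ, hμ, hμZ⟩ := pZ_lower (n := n) (m := m) (2 * R0 + 1) (by linarith)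
  have hkey : ∀ k, (κ + ‖x k‖ ^ 2) * μ ≤ T k := by
    intro k
    have h1 : 0 ≤ ∑ b, (- ∫ z, hs (ε k) (lin (fun i => a i - x k) z) (fun i => q i b) (fun i => q i b) *
      lseW (ε k) (lin (fun i => a i - x k) z)) := Finset.sum_nonneg fun b _ => hHnn b k
    rw [htr k] at h1
    have h2 := hμZ (ε k) δ _ (hε k) (hε1 k) hδ (hg k) (fun i => (hcR k i).trans (by linarith))
    have h3 : (κ + ‖x k‖ ^ 2) * μ ≤ (κ + ‖x k‖ ^ 2) * pZ (ε k) (fun i => a i - x k) :=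
      mul_le_mul_of_nonneg_left h2 (by positivity)
    linarith
  have hκz : κ = 0 := by
    refine le_antisymm ?_ hκ0
    have h1 : ∀ k, κ * μ ≤ T k := fun k => by
      have := hkey k
      have h2 : 0 ≤ ‖x k‖ ^ 2 * μ := by positivity
      linarith
    have h2 := ge_of_tendsto' hTlim h1
    by_contra hcon
    have := mul_pos (not_le.mp hcon) hμ
    linarith
  have hx0 : Tendsto (fun k => ‖x k‖) atTop (𝓝 0) := by
    refine sq_small _ T (1 / μ) (fun k => ?_) hTlim
    have := hkey k
    rw [hκz, zero_add] at this
    rw [one_div, inv_mul_eq_div, le_div_iff₀ hμ]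
    exact this
  have hHlim : ∀ b, Tendsto (fun k => - ∫ z, hs (ε k) (lin (fun i => a i - x k) z) (fun i => q i b) (fun i => q i b) *
      lseW (ε k) (lin (fun i => a i - x k) z)) atTop (𝓝 0) := by
    intro b
    refine squeeze_zero (hHnn b) (fun k => ?_) hTlim
    have h1 := Finset.single_le_sum (fun b _ => hHnn b k) (Finset.mem_univ b)
    rw [htr k] at h1
    have h2 : 0 ≤ (κ + ‖x k‖ ^ 2) * pZ (ε k) (fun i => a i - x k) :=
      mul_nonneg (by positivity) (pZ_pos (hε k) hδ (hg k)).le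
    simp only at h1
    linarith
  refine ⟨hκz, ?_⟩
  have hga : Good a (δ / 2) := by
    obtain ⟨k, hk⟩ := (hx0.eventually_lt_const (half_pos hδ)).exists
    have := ((hg k).shift (x' := 0)).mono (δ' := δ / 2) (by rw [zero_sub, norm_neg]; linarith)
    simpa using this
  set w : ℕ → Fin d → EuclideanSpace ℝ (Fin (m + 1)) → ℝ := fun k b u =>
    (∫ z, mn (ε k) (lin (fun i => a i - x k) z) (fun i => q i b) *
      lseW (ε k) (lin (fun i => a i - x k) z) * inner ℝ z u) / pZ (ε k) (fun i => a i - x k) with hw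
  have hwsm : ∀ k b (t : ℝ) u, w k b (t • u) = t * w k b u := by
    intro k b t u
    simp only [hw, inner_smul_right]
    rw [mul_div_assoc', ← integral_const_mul]
    congr 2
    ext z; ring
  have hwlim : ∀ b i, Tendsto (fun k => w k b (a i)) atTop (𝓝 (q i b)) := by
    intro b i
    by_cases hai : a i = 0
    · have h1 : ‖q i‖ = 0 := by
        have := hκ i
        rw [hai, hκz] at this
        simpa using this
      rw [norm_eq_zero] at h1
      simp [hw, hai, h1]
    have hain : 0 < ‖a i‖ := norm_pos_iff.mpr hai
    rw [Metric.tendsto_nhds]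
    intro τ' hτ'
    set τ := τ' / 8 with hτdef
    have hτ : 0 < τ := by positivity
    obtain ⟨η0, hη0, hmod⟩ := compact_mod (stdSimplex ℝ (Fin n)) (isCompact_stdSimplex _ _)
      (fun α => ‖(∑ r, α r • a r) - a i‖) (fun α => |(∑ r, α r * q r b) - q i b|)
      (by fun_prop) (by fun_prop) (fun _ _ => norm_nonneg _) (fun α hα h => by
        have h1 := hG i α hα.1 hα.2 (sub_eq_zero.mp (norm_eq_zero.mp h))
        have h2 := congrArg (fun v : EuclideanSpace ℝ (Fin d) => v b) h1
        simp only [WithLp.ofLp_sum, Finset.sum_apply, PiLp.smul_apply, smul_eq_mul] at h2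
        rw [h2]; simp) τ hτ
    obtain ⟨η, hη, hη1, hη2, hη3⟩ : ∃ η > 0, η ≤ 1 / 2 ∧ η * ‖a i‖ ≤ η0 / 2 ∧ η * |q i b| ≤ τ := by
      refine ⟨min (1 / 2) (min (η0 / 2 / ‖a i‖) (τ / (|q i b| + 1))), by positivity, min_le_left _ _, ?_, ?_⟩
      · rw [← le_div_iff₀ hain]
        exact (min_le_right _ _).trans (min_le_left _ _)
      · have h1 : min (1 / 2) (min (η0 / 2 / ‖a i‖) (τ / (|q i b| + 1))) ≤ τ / (|q i b| + 1) :=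
          (min_le_right _ _).trans (min_le_right _ _)
        rw [le_div_iff₀ (by positivity)] at h1
        refine le_trans ?_ h1
        gcongr
        linarith
    -- the tilted point
    set e := ‖a i‖⁻¹ • a i with he
    have hen : ‖e‖ = 1 := by rw [he, norm_smul, norm_inv, norm_norm, inv_mul_cancel₀ hain.ne']
    set lam := (1 - η) * ‖a i‖ with hlam
    have hle : lam • e = (1 - η) • a i := by
      rw [hlam, he, smul_smul, mul_assoc, mul_inv_cancel₀ hain.ne', mul_one]
    have hl0 : 0 ≤ lam := mul_nonneg (by linarith) hain.le
    have hgt : Good (fun j => a j - (1 - η) • a i) (η * (δ / 2)) := by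
      intro z
      obtain ⟨j, -, hj⟩ := Finset.exists_max_image Finset.univ (fun j => (inner ℝ z (a j) : ℝ)) ⟨0, Finset.mem_univ _⟩
      obtain ⟨j', hj'⟩ := hga z
      refine ⟨j, ?_⟩
      have h1 := hj i (Finset.mem_univ _)
      have h2 := hj j' (Finset.mem_univ _)
      rw [inner_sub_right, inner_smul_right]
      nlinarith
    have hev : ∀ᶠ k in atTop, ‖x k‖ < min (η * (δ / 4)) (η0 / 2) :=
      hx0.eventually_lt_const (by positivity)
    obtain ⟨N, hN⟩ := eventually_atTop.mp hev
    set δ' := η * (δ / 4) with hδ'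
    have hδ'0 : 0 < δ' := by positivity
    have hδδ : δ' ≤ δ := by rw [hδ']; nlinarith
    have hg2 : ∀ k, Good (fun j => a j - x (k + N) - lam • e) δ' := by
      intro k
      have h1 := (hgt.shift (x' := (1 - η) • a i + x (k + N))).mono (δ' := δ') (by
        have := (hN (k + N) (by lia)).trans_le (min_le_left _ _)
        rw [add_sub_cancel_left]
        have h3 : η * (δ / 2) = 2 * δ' := by rw [hδ']; ring
        linarith)
      intro z
      obtain ⟨j, hj⟩ := h1 z
      refine ⟨j, hj.trans_eq ?_⟩
      beta_reduce; rw [hle, sub_add_eq_sub_sub_swap]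
    obtain ⟨Rq, -, hRq, -⟩ := exists_bound2 (fun i => q i b) (fun i => q i b)
    have hRq0 : 0 ≤ Rq := (abs_nonneg _).trans (hRq 0)
    have hlR : ‖lam • e‖ ≤ R0 := by
      rw [hle, norm_smul, Real.norm_of_nonneg (by linarith)]
      have := haR i
      nlinarith
    have hRR : 0 < 3 * R0 + Rq + 1 := by linarith
    have hb1 : ∀ i, |q i b| ≤ 3 * R0 + Rq + 1 := fun i => (hRq i).trans (by linarith)
    have hb2 : ∀ k i, ‖a i - x (k + N)‖ ≤ 3 * R0 + Rq + 1 := fun k i => (hcR (k + N) i).trans (by linarith)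
    have hb3 : ∀ k i, ‖a i - x (k + N) - lam • e‖ ≤ 3 * R0 + Rq + 1 := fun k i => 
      (norm_sub_le _ _).trans (by linarith [hcR (k + N) i])
    have hb4 := (hHlim b).comp (tendsto_add_atTop_nat N)
    have hb5 : ∀ k, Good (fun i => a i - x (k + N)) δ' := fun k => (hg (k + N)).mono hδδ
    clear_value lam e δ'
    have hlim := tilt_limit hen lam hl0 hδ'0 (fun i => q i b) (fun k => ε (k + N)) (fun k i => a i - x (k + N))
      (fun k => hε (k + N)) (fun k => hε1 (k + N)) hb5 hg2 (3 * R0 + Rq + 1) hRR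
      hb1 hb2 hb3 (fun k => hy0 b (k + N)) hb4
    have hev2 := (Metric.tendsto_nhds.mp hlim) τ hτ
    obtain ⟨N2, hN2⟩ := eventually_atTop.mp hev2
    refine eventually_atTop.mpr ⟨N2 + N, fun k' hk' => ?_⟩
    obtain ⟨k, rfl⟩ : ∃ k, k' = k + N := ⟨k' - N, by lia⟩
    have h1 := hN2 k (by lia)
    rw [Real.dist_eq, sub_zero] at h1
    have hwe : (∫ z, mn (ε (k + N)) (lin (fun i => a i - x (k + N)) z) (fun i => q i b) *
      lseW (ε (k + N)) (lin (fun i => a i - x (k + N)) z) * inner ℝ z (lam • e)) /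
        pZ (ε (k + N)) (fun i => a i - x (k + N)) = (1 - η) * w (k + N) b (a i) := by
      rw [← hwsm, ← hle]
    rw [hwe] at h1
    obtain ⟨α, hα⟩ : ∃ α, α = pA (ε (k + N)) (fun j => a j - x (k + N) - lam • e) := ⟨_, rfl⟩
    rw [← hα] at h1
    have hα0 : ∀ j, 0 < α j := by
      rw [hα]; exact pA_pos (hε _) hδ'0 (hg2 k)
    have hα1 : ∑ j, α j = 1 := by
      rw [hα]; exact pA_sum (hε _) hδ'0 (hg2 k)
    have hform : (fun j => a j - x (k + N) - lam • e) = fun j => a j - (x (k + N) + lam • e) := by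
      ext1 j; rw [sub_add_eq_sub_sub]
    have hαa : ∑ j, α j • a j = x (k + N) + lam • e := by
      have hg3 := hg2 k
      rw [hform] at hg3
      rw [hα, hform]
      exact pA_bary (hε _) hδ'0 hg3
    have h2 := hmod α ⟨fun j => (hα0 j).le, hα1⟩ (by
      rw [hαa, hle]
      have e1 : x (k + N) + (1 - η) • a i - a i = x (k + N) - η • a i := by module
      rw [e1]
      refine (norm_sub_le _ _).trans ?_
      rw [norm_smul, Real.norm_of_nonneg hη.le]
      have := (hN (k + N) (by lia)).trans_le (min_le_right _ _)
      linarith)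
    rw [Real.dist_eq]
    generalize w (k + N) b (a i) = W at h1 ⊢
    have h3 : |(1 - η) * (W - q i b)| ≤ τ + τ + τ := by
      have e1 : (1 - η) * (W - q i b) = -((∑ j, α j * q j b) - (1 - η) * W) + ((∑ j, α j * q j b) - q i b) + η * q i b := by ring
      rw [e1]
      refine (abs_add_le _ _).trans (add_le_add ((abs_add_le _ _).trans (add_le_add ?_ h2)) ?_)
      · rw [abs_neg]; exact h1.le
      · rw [abs_mul, abs_of_pos hη]; exact hη3
    rw [abs_mul, abs_of_nonneg (by linarith)] at h3
    have := abs_nonneg (W - q i b)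
    have h4 : τ' = 8 * τ := by rw [hτdef]; ring
    nlinarith
  intro t ht
  ext b
  simp only [WithLp.ofLp_sum, Finset.sum_apply, PiLp.smul_apply, smul_eq_mul, PiLp.zero_apply]
  have h1 : Tendsto (fun k => ∑ i, t i * w k b (a i)) atTop (𝓝 (∑ i, t i * q i b)) :=
    tendsto_finsetSum _ fun i _ => (hwlim b i).const_mul _
  have h2 : ∀ k, ∑ i, t i * w k b (a i) = 0 := by
    intro k
    simp only [hw]
    simp_rw [mul_div_assoc', ← Finset.sum_div, ← integral_const_mul]
    rw [← integral_finsetSum _ fun i _ => (int_mnz (hε k) hδ (hg k) _ _).const_mul _]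
    rw [div_eq_zero_iff]; left
    rw [← integral_zero (EuclideanSpace ℝ (Fin (m + 1))) ℝ]
    congr 1
    ext z
    have e1 : (inner ℝ z (∑ i, t i • a i) : ℝ) = 0 := by rw [ht, inner_zero_right]
    rw [inner_sum] at e1
    simp only [inner_smul_right] at e1
    have e2 : ∀ A : ℝ, ∑ i, t i * (A * inner ℝ z (a i)) = A * ∑ i, t i * inner ℝ z (a i) := by
      intro A
      rw [Finset.mul_sum]
      exact Finset.sum_congr rfl fun i _ => by ring
    rw [e2, e1, mul_zero]
  simp_rw [h2] at h1
  exact tendsto_nhds_unique h1 tendsto_const_nhds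

end core


section solve
open Set Filter Topology

variable {n m : ℕ} [NeZero n]

theorem unif_good (K : Set (Fin n → ℝ)) (hK : IsCompact K)
    (c : (Fin n → ℝ) → Fin n → EuclideanSpace ℝ (Fin (m + 1))) (hc : ∀ i, Continuous fun α => c α i)
    (h : ∀ α ∈ K, ∀ z, z ≠ 0 → ∃ i, 0 < (inner ℝ z (c α i) : ℝ)) :
    ∃ δ > 0, ∀ α ∈ K, Good (c α) δ := by
  rcases K.eq_empty_or_nonempty with rfl | hne
  · exact ⟨1, one_pos, fun α hα => hα.elim⟩
  have hun : (Finset.univ : Finset (Fin n)).Nonempty := ⟨0, Finset.mem_univ _⟩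
  let Φ : (Fin n → ℝ) × EuclideanSpace ℝ (Fin (m + 1)) → ℝ := fun w =>
    Finset.univ.sup' hun fun i => (inner ℝ w.2 (c w.1 i) : ℝ)
  have hΦ : Continuous Φ := Continuous.finset_sup'_apply hun fun i _ =>
    continuous_snd.inner ((hc i).comp continuous_fst)
  have hS : (Metric.sphere (0 : EuclideanSpace ℝ (Fin (m + 1))) 1).Nonempty :=
    ⟨EuclideanSpace.single 0 1, by simp⟩
  obtain ⟨w0, hw0, hmin⟩ := (hK.prod (isCompact_sphere (0 : EuclideanSpace ℝ (Fin (m + 1))) 1)).exists_isMinOn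
    (hne.prod hS) hΦ.continuousOn
  have hpos : 0 < Φ w0 := by
    have hz : w0.2 ≠ 0 := by
      intro h0
      have := hw0.2
      rw [h0] at this
      simp at this
    obtain ⟨i, hi⟩ := h w0.1 hw0.1 w0.2 hz
    exact hi.trans_le (Finset.le_sup' (fun i => (inner ℝ w0.2 (c w0.1 i) : ℝ)) (Finset.mem_univ i))
  refine ⟨Φ w0, hpos, fun α hα z => ?_⟩
  by_cases hz : z = 0
  · exact ⟨0, by simp [hz]⟩
  have hzn : 0 < ‖z‖ := norm_pos_iff.mpr hz
  have h1 : Φ w0 ≤ Φ (α, ‖z‖⁻¹ • z) := hmin ⟨hα, by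
    simp [norm_smul, hzn.ne']⟩
  obtain ⟨i, -, hi⟩ := Finset.exists_mem_eq_sup' hun fun i => (inner ℝ (‖z‖⁻¹ • z) (c α i) : ℝ)
  refine ⟨i, ?_⟩
  have h2 : Φ w0 ≤ inner ℝ (‖z‖⁻¹ • z) (c α i) := h1.trans_eq hi
  rw [inner_smul_left] at h2
  simp only [conj_trivial] at h2
  rw [inv_mul_eq_div, le_div_iff₀ hzn] at h2
  exact h2

theorem smx_gap (l : Fin n → ℝ) (i j : Fin n) : smx 1 l i * (l j - l i) ≤ 1 := by
  have h1 : smx 1 l j = smx 1 l i * Real.exp (l j - l i) := by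
    unfold smx
    rw [div_one, div_one, Real.exp_sub]
    have := (Real.exp_pos (l i)).ne'
    field_simp
  have h2 := smx_le_one 1 l j
  have h3 := Real.add_one_le_exp (l j - l i)
  have h4 := smx_pos 1 l i
  nlinarith

theorem solve_eps {d : ℕ} (a : Fin n → EuclideanSpace ℝ (Fin (m + 1))) (q : Fin n → EuclideanSpace ℝ (Fin d))
    (hspan : ∀ z : EuclideanSpace ℝ (Fin (m + 1)), z ≠ 0 → ∃ i j, (inner ℝ z (a i) : ℝ) ≠ inner ℝ z (a j))
    (hB : ∀ u : EuclideanSpace ℝ (Fin d), ∀ α ∈ stdSimplex ℝ (Fin n), ∀ β ∈ stdSimplex ℝ (Fin n),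
      (∀ i j, β i * (inner ℝ u (q j) - inner ℝ u (q i)) ≤ 0) → ∑ i, α i • a i = ∑ i, β i • a i →
      ∀ i j, α i * (inner ℝ u (q j) - inner ℝ u (q i)) ≤ 0)
    (hF : ∀ u : EuclideanSpace ℝ (Fin d), u ≠ 0 → ∃ i, 0 < (inner ℝ u (q i) : ℝ))
    (ε : ℝ) (hε : 0 < ε) :
    ∃ x, (∃ δ > 0, Good (fun i => a i - x) δ) ∧ ∑ i, pA ε (fun i => a i - x) i • q i = 0 := by
  let B : EuclideanSpace ℝ (Fin d) → Fin n → ℝ := fun u i => smx 1 (fun j => inner ℝ u (q j)) i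
  have hBs : ∀ u, B u ∈ stdSimplex ℝ (Fin n) := fun u => ⟨fun i => (smx_pos _ _ _).le, smx_sum _ _⟩
  have hBc : ∀ i, Continuous fun u => B u i := fun i => by
    have h : Continuous fun u : EuclideanSpace ℝ (Fin d) => fun j => (inner ℝ u (q j) : ℝ) := by fun_prop
    exact (continuous_smx 1 i).comp h
  let X : EuclideanSpace ℝ (Fin d) → EuclideanSpace ℝ (Fin (m + 1)) := fun u => ∑ i, B u i • a i
  have hXc : Continuous X := continuous_finsetSum _ fun i _ => (hBc i).smul continuous_const
  have hgood : ∀ u, ∃ δ > 0, Good (fun i => a i - X u) δ := by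
    intro u
    obtain ⟨δ, hδ, h⟩ := unif_good {(0 : Fin n → ℝ)} isCompact_singleton (fun _ i => a i - X u)
      (fun i => continuous_const) (by
        intro _ _ z hz
        by_contra hcon
        push Not at hcon
        have h0 : ∑ i, B u i * (inner ℝ z (a i - X u) : ℝ) = 0 := by
          have e1 : ∑ i, B u i * (inner ℝ z (a i - X u) : ℝ) = inner ℝ z (∑ i, B u i • (a i - X u)) := by
            rw [inner_sum]
            exact Finset.sum_congr rfl fun i _ => by rw [inner_smul_right]
          rw [e1]
          simp_rw [smul_sub, Finset.sum_sub_distrib, ← Finset.sum_smul]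
          rw [(hBs u).2, one_smul]
          simp [X]
        have h1 := (Finset.sum_eq_zero_iff_of_nonpos (fun i _ =>
          mul_nonpos_of_nonneg_of_nonpos ((hBs u).1 i) (hcon i))).mp h0
        have h2 : ∀ i, (inner ℝ z (a i) : ℝ) = inner ℝ z (X u) := fun i => by
          have := (mul_eq_zero.mp (h1 i (Finset.mem_univ i))).resolve_left (smx_pos _ _ _).ne'
          rw [inner_sub_right] at this
          linarith
        obtain ⟨i, j, hij⟩ := hspan z hz
        exact hij ((h2 i).trans (h2 j).symm))
    exact ⟨δ, hδ, h 0 rfl⟩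
  let A : EuclideanSpace ℝ (Fin d) → Fin n → ℝ := fun u i => pA ε (fun i => a i - X u) i
  have hAs : ∀ u, A u ∈ stdSimplex ℝ (Fin n) := fun u => by
    obtain ⟨δ, hδ, hg⟩ := hgood u
    exact ⟨fun i => (pA_pos hε hδ hg i).le, pA_sum hε hδ hg⟩
  have hAb : ∀ u, ∑ i, A u i • a i = ∑ i, B u i • a i := fun u => by
    obtain ⟨δ, hδ, hg⟩ := hgood u
    exact pA_bary hε hδ hg
  have hAc : ∀ i, Continuous fun u => A u i := by
    intro i
    rw [continuous_iff_continuousAt]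
    intro u
    obtain ⟨δ, hδ, hg⟩ := hgood u
    exact (pA_continuousAt (a := a) hε hδ hg i).comp (f := X) hXc.continuousAt
  let F : EuclideanSpace ℝ (Fin d) → EuclideanSpace ℝ (Fin d) := fun u => ∑ i, A u i • q i
  have hFc : Continuous F := continuous_finsetSum _ fun i _ => (hAc i).smul continuous_const
  have hR : ∃ R : ℝ, ∀ u, R ≤ ‖u‖ → 0 < (inner ℝ (F u) u : ℝ) := by
    by_contra hcon
    push Not at hcon
    choose u hu1 hu2 using fun k : ℕ => hcon (k + 1)
    have hup : ∀ k, 0 < ‖u k‖ := fun k => lt_of_lt_of_le (by positivity) (hu1 k)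
    let w : ℕ → EuclideanSpace ℝ (Fin d) × (Fin n → ℝ) × (Fin n → ℝ) := fun k =>
      (‖u k‖⁻¹ • u k, B (u k), A (u k))
    have hK : IsCompact ((Metric.sphere (0 : EuclideanSpace ℝ (Fin d)) 1) ×ˢ
        (stdSimplex ℝ (Fin n) ×ˢ stdSimplex ℝ (Fin n))) :=
      (isCompact_sphere _ _).prod ((isCompact_stdSimplex _ _).prod (isCompact_stdSimplex _ _))
    obtain ⟨⟨v, β, α⟩, hmem, φ, hφ, hlim⟩ := hK.tendsto_subseq (x := w) (fun k => ⟨by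
      simp [w, norm_smul, (hup k).ne'], hBs _, hAs _⟩)
    have hv := hlim.fst_nhds
    have hβ := tendsto_pi_nhds.mp hlim.snd_nhds.fst_nhds
    have hα := tendsto_pi_nhds.mp hlim.snd_nhds.snd_nhds
    simp only at hv hβ hα
    have hab : ∑ i, α i • a i = ∑ i, β i • a i := by
      have h1 := tendsto_finsetSum Finset.univ fun i _ => (hα i).smul_const (a i)
      have h2 := tendsto_finsetSum Finset.univ fun i _ => (hβ i).smul_const (a i)
      refine tendsto_nhds_unique h1 (h2.congr fun k => ?_)
      exact (hAb _).symm
    have hin : ∀ i, Tendsto (fun k => (inner ℝ ((w (φ k)).1) (q i) : ℝ)) atTop (𝓝 (inner ℝ v (q i))) :=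
      fun i => hv.inner tendsto_const_nhds
    have hinv : Tendsto (fun k => ‖u (φ k)‖⁻¹) atTop (𝓝 0) := by
      refine tendsto_inv_atTop_zero.comp ?_
      refine tendsto_atTop_mono (fun k => ?_) tendsto_natCast_atTop_atTop
      have h1 := hu1 (φ k)
      have h2 : (k : ℝ) ≤ φ k := by exact_mod_cast hφ.id_le k
      linarith
    have hmax : ∀ i j, β i * (inner ℝ v (q j) - inner ℝ v (q i)) ≤ 0 := by
      intro i j
      refine le_of_tendsto_of_tendsto' ((hβ i).mul ((hin j).sub (hin i))) hinv fun k => ?_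
      have h1 := smx_gap (fun j => inner ℝ (u (φ k)) (q j)) i j
      have h2 := mul_le_mul_of_nonneg_left h1 (inv_pos.mpr (hup (φ k))).le
      simp only [w, Function.comp, inner_smul_left, conj_trivial, mul_one] at h2 ⊢
      refine le_trans (le_of_eq ?_) h2
      simp only [B]
      ring
    have hmaxα := hB v α hmem.2.2 β hmem.2.1 hmax hab
    have hv0 : v ≠ 0 := by
      intro h0
      have := hmem.1
      rw [h0] at this
      simp at this
    obtain ⟨j, hj⟩ := hF v hv0
    have hle : ∑ i, α i * (inner ℝ v (q i) : ℝ) ≤ 0 := by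
      have h1 := tendsto_finsetSum Finset.univ fun i _ => (hα i).mul (hin i)
      refine le_of_tendsto' h1 fun k => ?_
      have h2 := hu2 (φ k)
      simp only [F, sum_inner, inner_smul_left, conj_trivial] at h2
      have h3 := mul_nonpos_of_nonneg_of_nonpos (inv_pos.mpr (hup (φ k))).le h2
      rw [Finset.mul_sum] at h3
      refine le_trans (le_of_eq (Finset.sum_congr rfl fun i _ => ?_)) h3
      simp only [w, Function.comp, inner_smul_left, conj_trivial]
      rw [real_inner_comm]
      ring
    have hge : ∑ i, α i * (inner ℝ v (q j) - inner ℝ v (q i) : ℝ) ≤ 0 :=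
      Finset.sum_nonpos fun i _ => hmaxα i j
    simp_rw [mul_sub, Finset.sum_sub_distrib, ← Finset.sum_mul] at hge
    rw [hmem.2.2.2] at hge
    linarith
  obtain ⟨R, hR⟩ := hR
  obtain ⟨u, hu⟩ := exists_zero_of_inner_pos F hFc R hR
  exact ⟨X u, hgood u, hu⟩

theorem analytic_core {d : ℕ} (a : Fin n → EuclideanSpace ℝ (Fin (m + 1))) (q : Fin n → EuclideanSpace ℝ (Fin d))
    (κ : ℝ) (hκ0 : 0 ≤ κ) (hκ : ∀ i, ‖q i‖ ^ 2 = ‖a i‖ ^ 2 + κ)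
    (hspan : ∀ z : EuclideanSpace ℝ (Fin (m + 1)), z ≠ 0 → ∃ i j, (inner ℝ z (a i) : ℝ) ≠ inner ℝ z (a j))
    (hA : ∀ α ∈ stdSimplex ℝ (Fin n), ∑ i, α i • q i = 0 → ∀ z, z ≠ 0 →
      ∃ i, 0 < (inner ℝ z (a i - ∑ r, α r • a r) : ℝ))
    (hB : ∀ u : EuclideanSpace ℝ (Fin d), ∀ α ∈ stdSimplex ℝ (Fin n), ∀ β ∈ stdSimplex ℝ (Fin n),
      (∀ i j, β i * (inner ℝ u (q j) - inner ℝ u (q i)) ≤ 0) → ∑ i, α i • a i = ∑ i, β i • a i →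
      ∀ i j, α i * (inner ℝ u (q j) - inner ℝ u (q i)) ≤ 0)
    (hF : ∀ u : EuclideanSpace ℝ (Fin d), u ≠ 0 → ∃ i, 0 < (inner ℝ u (q i) : ℝ))
    (hC : ∀ i j, i ≠ j → ‖q i - q j‖ = ‖a i - a j‖ ∨ ∃ k, k ≠ i ∧ k ≠ j ∧ ∃ (β : Fin n → ℝ) (θ : ℝ),
      0 ≤ θ ∧ θ ≤ 1 ∧ (∀ r, 0 ≤ β r) ∧ ∑ r, β r = 1 ∧ 0 < β k ∧ θ • a i + (1 - θ) • a j = ∑ r, β r • a r)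
    (hD : ∀ i j k, i ≠ j → k ≠ i → k ≠ j → ∀ t : ℝ, a i - a k ≠ t • (a i - a j))
    (hinj : Function.Injective a)
    (hG : ∀ i, ∀ α : Fin n → ℝ, (∀ r, 0 ≤ α r) → ∑ r, α r = 1 → ∑ r, α r • a r = a i → ∑ r, α r • q r = q i) :
    κ = 0 ∧ ∀ t : Fin n → ℝ, ∑ i, t i • a i = 0 → ∑ i, t i • q i = 0 := by
  have hε : ∀ k : ℕ, (0:ℝ) < 1 / ((k:ℝ) + 1) := fun k => by positivity
  choose x hx1 hx2 using fun k : ℕ => solve_eps a q hspan hB hF (1 / ((k:ℝ) + 1)) (hε k)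
  obtain ⟨δ, hδ, hg⟩ := unif_good (stdSimplex ℝ (Fin n) ∩ {α | ∑ i, α i • q i = 0})
    ((isCompact_stdSimplex _ _).inter_right (isClosed_eq (by fun_prop) continuous_const))
    (fun α i => a i - ∑ r, α r • a r) (fun i => by fun_prop) (fun α hα => hA α hα.1 hα.2)
  refine limit_core a q κ hκ0 hκ hC hD hinj hG hδ (fun k => 1 / ((k:ℝ) + 1)) hε (fun k => ?_)
    tendsto_one_div_add_atTop_nhds_zero_nat x (fun k => ?_) hx2
  · rw [div_le_one (by positivity)]
    have : (0:ℝ) ≤ k := Nat.cast_nonneg k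
    linarith
  · obtain ⟨δ', hδ', hg'⟩ := hx1 k
    have := hg (pA (1 / ((k:ℝ) + 1)) (fun i => a i - x k))
      ⟨⟨fun i => (pA_pos (hε k) hδ' hg' i).le, pA_sum (hε k) hδ' hg'⟩, hx2 k⟩
    rw [pA_bary (hε k) hδ' hg'] at this
    exact this

end solve


section faces
open Set Filter Topology

variable {n : ℕ} {V : Type*} [AddCommGroup V] [Module ℝ V]

/-- combinatorial description of faces by barycentric coordinates -/
def FaceC {n : ℕ} {V : Type*} [AddCommGroup V] [Module ℝ V] (a : Fin n → V) (S : Set (Fin n)) : Prop :=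
  ∀ α ∈ stdSimplex ℝ (Fin n), ∀ β ∈ stdSimplex ℝ (Fin n), (∀ i, β i ≠ 0 → i ∈ S) →
    ∑ i, α i • a i = ∑ i, β i • a i → ∀ i, α i ≠ 0 → i ∈ S

theorem sum_single_smul (p : Fin n → V) (i : Fin n) : ∑ j, (Pi.single i (1:ℝ) : Fin n → ℝ) j • p j = p i := by
  rw [Finset.sum_eq_single i]
  · simp
  · intro j _ hj; simp [hj]
  · simp

theorem mem_hull_image (p : Fin n → V) (S : Set (Fin n)) (x : V) :
    x ∈ convexHull ℝ (p '' S) ↔ ∃ β ∈ stdSimplex ℝ (Fin n), (∀ i, β i ≠ 0 → i ∈ S) ∧ ∑ i, β i • p i = x := by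
  constructor
  · intro hx
    have : convexHull ℝ (p '' S) ⊆ {x | ∃ β ∈ stdSimplex ℝ (Fin n), (∀ i, β i ≠ 0 → i ∈ S) ∧ ∑ i, β i • p i = x} := by
      refine convexHull_min ?_ ?_
      · rintro _ ⟨i, hi, rfl⟩
        refine ⟨Pi.single i 1, single_mem_stdSimplex ℝ i, fun j hj => ?_, sum_single_smul p i⟩
        by_cases hji : j = i
        · exact hji ▸ hi
        · simp [hji] at hj
      · rintro _ ⟨β, hβ, hβS, rfl⟩ _ ⟨γ, hγ, hγS, rfl⟩ s t hs ht hst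
        refine ⟨s • β + t • γ, convex_stdSimplex ℝ (Fin n) hβ hγ hs ht hst, fun i hi => ?_, ?_⟩
        · by_contra hc
          have h1 : β i = 0 := by by_contra h; exact hc (hβS i h)
          have h2 : γ i = 0 := by by_contra h; exact hc (hγS i h)
          simp [h1, h2] at hi
        · simp [add_smul, Finset.sum_add_distrib, Finset.smul_sum, smul_smul]
    exact this hx
  · rintro ⟨β, hβ, hβS, rfl⟩
    classical
    rw [← Finset.sum_filter_of_ne (p := fun i => i ∈ S) (fun i _ h => hβS i fun h0 => h (by simp [h0]))]
    refine (convex_convexHull ℝ _).sum_mem (fun i _ => hβ.1 i) ?_ (fun i hi => subset_convexHull ℝ _ ⟨i, (Finset.mem_filter.mp hi).2, rfl⟩)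
    rw [Finset.sum_filter_of_ne (fun i _ h => hβS i h)]
    exact hβ.2

theorem mem_hull_range (p : Fin n → V) (x : V) :
    x ∈ convexHull ℝ (range p) ↔ ∃ β ∈ stdSimplex ℝ (Fin n), ∑ i, β i • p i = x := by
  rw [← image_univ, mem_hull_image]
  simp

theorem isExtreme_of_faceC (p : Fin n → V) (S : Set (Fin n)) (h : FaceC p S) :
    IsExtreme ℝ (convexHull ℝ (range p)) (convexHull ℝ (p '' S)) := by
  refine ⟨convexHull_mono (image_subset_range p S), ?_⟩
  intro x hx y hy z hz hzs
  obtain ⟨α, hα, rfl⟩ := (mem_hull_range p x).mp hx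
  obtain ⟨α', hα', rfl⟩ := (mem_hull_range p y).mp hy
  obtain ⟨β, hβ, hβS, rfl⟩ := (mem_hull_image p S z).mp hz
  obtain ⟨s, t, hs, ht, hst, he⟩ := hzs
  refine (mem_hull_image p S _).mpr ⟨α, hα, fun i hi => ?_, rfl⟩
  refine h (s • α + t • α') (convex_stdSimplex ℝ (Fin n) hα hα' hs.le ht.le hst) β hβ hβS ?_ i ?_
  · rw [← he]
    simp [add_smul, Finset.sum_add_distrib, Finset.smul_sum, smul_smul]
  · have h1 : 0 < α i := (hα.1 i).lt_of_ne' hi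
    have h2 := hα'.1 i
    simp only [Pi.add_apply, Pi.smul_apply, smul_eq_mul]
    positivity

theorem mem_of_extreme (p : Fin n → V) (C : Set V) (hC : IsExtreme ℝ (convexHull ℝ (range p)) C)
    (α : Fin n → ℝ) (hα : α ∈ stdSimplex ℝ (Fin n)) (hx : ∑ i, α i • p i ∈ C) (i : Fin n) (hi : α i ≠ 0) :
    p i ∈ C := by
  have hpos : 0 < α i := (hα.1 i).lt_of_ne' hi
  have hsum : α i + ∑ j ∈ Finset.univ.erase i, α j = 1 := by
    rw [Finset.add_sum_erase _ _ (Finset.mem_univ i), hα.2]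
  have hsump : α i • p i + ∑ j ∈ Finset.univ.erase i, α j • p j = ∑ j, α j • p j :=
    Finset.add_sum_erase _ (fun j => α j • p j) (Finset.mem_univ i)
  have hnn : 0 ≤ ∑ j ∈ Finset.univ.erase i, α j := Finset.sum_nonneg fun j _ => hα.1 j
  set σ := ∑ j ∈ Finset.univ.erase i, α j with hσ
  rcases hnn.eq_or_lt with h0 | h0
  · have h1 : ∀ j ∈ Finset.univ.erase i, α j = 0 := (Finset.sum_eq_zero_iff_of_nonneg fun j _ => hα.1 j).mp (hσ ▸ h0.symm)
    rw [← hsump, Finset.sum_eq_zero (fun j hj => by rw [h1 j hj, zero_smul]), add_zero,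
      show α i = 1 by linarith, one_smul] at hx
    exact hx
  · have hy : ∑ j ∈ Finset.univ.erase i, (σ⁻¹ * α j) • p j ∈ convexHull ℝ (range p) := by
      refine (convex_convexHull ℝ _).sum_mem (fun j _ => mul_nonneg (inv_pos.mpr h0).le (hα.1 j)) ?_
        (fun j _ => subset_convexHull ℝ _ ⟨j, rfl⟩)
      rw [← Finset.mul_sum, ← hσ, inv_mul_cancel₀ h0.ne']
    refine hC.2 (subset_convexHull ℝ _ ⟨i, rfl⟩) hy hx ⟨α i, σ, hpos, h0, hsum, ?_⟩
    rw [← hsump, Finset.smul_sum]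
    congr 1
    exact Finset.sum_congr rfl fun j _ => by rw [smul_smul, mul_inv_cancel_left₀ h0.ne']

theorem faceC_iff (p : Fin n → V) (hinj : Function.Injective p)
    (hp : range p = extremePoints ℝ (convexHull ℝ (range p))) (S : Set (Fin n)) :
    IsExtreme ℝ (convexHull ℝ (range p)) (convexHull ℝ (p '' S)) ↔ FaceC p S := by
  refine ⟨fun h => ?_, isExtreme_of_faceC p S⟩
  intro α hα β hβ hβS he i hi
  have h1 := mem_of_extreme p _ h α hα (he ▸ (mem_hull_image p S _).mpr ⟨β, hβ, hβS, rfl⟩) i hi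
  have h2 : p i ∈ extremePoints ℝ (convexHull ℝ (range p)) := hp ▸ ⟨i, rfl⟩
  have h3 : p i ∈ extremePoints ℝ (convexHull ℝ (p '' S)) :=
    inter_extremePoints_subset_extremePoints_of_subset (convexHull_mono (image_subset_range p S)) ⟨h1, h2⟩
  obtain ⟨j, hj, hji⟩ := extremePoints_convexHull_subset h3
  exact hinj hji ▸ hj

theorem faceC_single (p : Fin n → V) (hinj : Function.Injective p)
    (hp : range p = extremePoints ℝ (convexHull ℝ (range p))) (i : Fin n) : FaceC p {i} := by
  rw [← faceC_iff p hinj hp, image_singleton, convexHull_singleton, isExtreme_singleton, ← hp]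
  exact ⟨i, rfl⟩

/-- transport along an injective affine map -/
theorem faceC_map {W : Type*} [AddCommGroup W] [Module ℝ W] (p : Fin n → V) (a : Fin n → W) (c : V)
    (f : W →ₗ[ℝ] V) (hf : Function.Injective f) (h : ∀ i, p i = c + f (a i)) (S : Set (Fin n)) :
    FaceC p S ↔ FaceC a S := by
  have key : ∀ α ∈ stdSimplex ℝ (Fin n), ∑ i, α i • p i = c + f (∑ i, α i • a i) := by
    intro α hα
    simp_rw [h, smul_add, Finset.sum_add_distrib, ← Finset.sum_smul, hα.2, one_smul, map_sum, map_smul]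
  constructor
  · intro H α hα β hβ hS he
    exact H α hα β hβ hS (by rw [key α hα, key β hβ, he])
  · intro H α hα β hβ hS he
    refine H α hα β hβ hS ?_
    rw [key α hα, key β hβ] at he
    exact hf (add_left_cancel he)

theorem argmax_face (q : Fin n → V) (f : V →ₗ[ℝ] ℝ) : FaceC q {i | ∀ j, f (q j) ≤ f (q i)} := by
  intro α hα β hβ hS he i hi j
  have e1 := congrArg f he
  simp only [map_sum, map_smul, smul_eq_mul] at e1
  obtain ⟨k, hk⟩ : ∃ k, β k ≠ 0 := by
    by_contra hcon
    push Not at hcon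
    have := hβ.2
    simp [hcon] at this
  have hkm : ∀ j, f (q j) ≤ f (q k) := hS k hk
  have e2 : ∑ r, β r * f (q r) = f (q k) := by
    have : ∀ r, β r * f (q r) = β r * f (q k) := by
      intro r
      by_cases hr : β r = 0
      · simp [hr]
      · rw [le_antisymm (hkm r) (hS r hr k)]
    simp_rw [this, ← Finset.sum_mul, hβ.2, one_mul]
  have e3 : ∑ r, α r * (f (q k) - f (q r)) = 0 := by
    simp_rw [mul_sub, Finset.sum_sub_distrib, ← Finset.sum_mul, hα.2, e1, e2]
    ring
  have e4 := (Finset.sum_eq_zero_iff_of_nonneg fun r _ => mul_nonneg (hα.1 r) (sub_nonneg.mpr (hkm r))).mp e3 i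
    (Finset.mem_univ i)
  have e5 := (mul_eq_zero.mp e4).resolve_left hi
  linarith [hkm j]

/-- two-point weights -/
theorem pair_weights (p : Fin n → V) (i j : Fin n) (hij : i ≠ j) (s t : ℝ) (hs : 0 ≤ s) (ht : 0 ≤ t)
    (hst : s + t = 1) : ∃ α ∈ stdSimplex ℝ (Fin n), α i = s ∧ α j = t ∧ (∀ k, α k ≠ 0 → k = i ∨ k = j) ∧
      ∑ k, α k • p k = s • p i + t • p j := by
  refine ⟨s • Pi.single i 1 + t • Pi.single j 1, convex_stdSimplex ℝ (Fin n) (single_mem_stdSimplex ℝ i)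
    (single_mem_stdSimplex ℝ j) hs ht hst, by simp [hij], by simp [hij.symm], fun k hk => ?_, ?_⟩
  · by_contra hcon
    push Not at hcon
    simp [hcon.1, hcon.2] at hk
  · simp only [Pi.add_apply, Pi.smul_apply, smul_eq_mul, add_smul, mul_smul, Finset.sum_add_distrib,
      ← Finset.smul_sum, sum_single_smul]

theorem faceC_inj (a : Fin n → V) (h : ∀ i, FaceC a {i}) : Function.Injective a := by
  intro i j hij
  have := h i (Pi.single j 1) (single_mem_stdSimplex ℝ j) (Pi.single i 1) (single_mem_stdSimplex ℝ i)
    (fun k hk => by by_contra hc; simp [show k ≠ i from hc] at hk)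
    (by rw [sum_single_smul, sum_single_smul, hij]) j (by simp)
  exact this.symm

theorem faceC_nomid (a : Fin n → V) (h : ∀ i, FaceC a {i}) (i j k : Fin n) (hij : i ≠ j) (hki : k ≠ i)
    (hkj : k ≠ j) (s t : ℝ) (hs : 0 ≤ s) (ht : 0 ≤ t) (hst : s + t = 1) : s • a i + t • a j ≠ a k := by
  intro he
  obtain ⟨α, hα, h1, h2, h3, h4⟩ := pair_weights a i j hij s t hs ht hst
  have h5 := h k α hα (Pi.single k 1) (single_mem_stdSimplex ℝ k)
    (fun r hr => by by_contra hc; simp [show r ≠ k from hc] at hr)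
    (by rw [h4, sum_single_smul, he])
  by_cases hs0 : s = 0
  · exact hkj (h5 j (by rw [h2]; intro h0; linarith)).symm
  · exact hki (h5 i (by rw [h1]; exact hs0)).symm

theorem faceC_nocol (a : Fin n → V) (h : ∀ i, FaceC a {i}) (i j k : Fin n) (hij : i ≠ j) (hki : k ≠ i)
    (hkj : k ≠ j) (t : ℝ) : a i - a k ≠ t • (a i - a j) := by
  intro he
  have hk : a k = a i - t • (a i - a j) := by rw [← he]; abel
  by_cases h0 : 0 ≤ t
  · by_cases h1 : t ≤ 1
    · exact faceC_nomid a h i j k hij hki hkj (1 - t) t (by linarith) h0 (by ring) (by rw [hk]; module)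
    · have ht : 0 < t := by linarith
      refine faceC_nomid a h k i j hki hkj.symm hij.symm t⁻¹ (1 - t⁻¹) (by positivity)
        (by rw [sub_nonneg]; exact inv_le_one_of_one_le₀ (by linarith)) (by ring) ?_
      rw [hk, smul_sub, smul_smul, inv_mul_cancel₀ ht.ne']
      module
  · have ht : 0 < 1 - t := by linarith
    have ht' : 0 < - t := by linarith
    refine faceC_nomid a h k j i hkj hki.symm hij (1 - t)⁻¹ ((1 - t)⁻¹ * (-t)) (by positivity)
      (by positivity) (by field_simp; ring) ?_
    have : (1 - t)⁻¹ • a k + ((1 - t)⁻¹ * (-t)) • a j = ((1 - t)⁻¹ * (1 - t)) • a i := by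
      rw [hk]; module
    rw [this, inv_mul_cancel₀ ht.ne', one_smul]

theorem faceC_vertex (a : Fin n → V) (i : Fin n) (h : FaceC a {i}) (α : Fin n → ℝ) (hα : α ∈ stdSimplex ℝ (Fin n))
    (he : ∑ r, α r • a r = a i) : α = Pi.single i 1 := by
  have h5 := h α hα (Pi.single i 1) (single_mem_stdSimplex ℝ i)
    (fun r hr => by by_contra hc; simp [show r ≠ i from hc] at hr)
    (by rw [sum_single_smul, he])
  have h6 : ∀ r, r ≠ i → α r = 0 := fun r hr => by
    by_contra hc; exact hr (h5 r hc)
  have h7 : α i = 1 := by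
    have := hα.2
    rwa [Finset.sum_eq_single i (fun r _ hr => h6 r hr) (by simp)] at this
  ext r
  by_cases hr : r = i
  · subst hr; simp [h7]
  · simp [h6 r hr, hr]

theorem faceC_nonedge (a : Fin n → V) (i j : Fin n) (hij : i ≠ j) (h : ¬ FaceC a {i, j}) :
    ∃ k, k ≠ i ∧ k ≠ j ∧ ∃ (β : Fin n → ℝ) (θ : ℝ),
      0 ≤ θ ∧ θ ≤ 1 ∧ (∀ r, 0 ≤ β r) ∧ ∑ r, β r = 1 ∧ 0 < β k ∧ θ • a i + (1 - θ) • a j = ∑ r, β r • a r := by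
  unfold FaceC at h
  push Not at h
  obtain ⟨α, hα, β, hβ, hS, he, k, hk, hkS⟩ := h
  simp only [mem_insert_iff, mem_singleton_iff, not_or] at hkS
  have hz : ∀ r, r ≠ i ∧ r ≠ j → β r = 0 := fun r hr => by
    by_contra hc
    have := hS r hc
    simp only [mem_insert_iff, mem_singleton_iff] at this
    tauto
  have h1 : β i + β j = 1 := by
    rw [← hβ.2, Finset.sum_eq_add i j hij (fun r _ hr => hz r hr) (by simp) (by simp)]
  have h2 : β i • a i + β j • a j = ∑ r, β r • a r := by
    rw [Finset.sum_eq_add i j hij (fun r _ hr => by rw [hz r hr, zero_smul]) (by simp) (by simp)]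
  refine ⟨k, hkS.1, hkS.2, α, β i, hβ.1 i, by linarith [hβ.1 j], hα.1, hα.2, (hα.1 k).lt_of_ne' hk, ?_⟩
  rw [he, ← h2, ← h1]
  congr 2
  ring

end faces


section simplexstep
open Set Filter Topology

variable {n d : ℕ}

theorem simplex_lemma (p : Fin n → EuclideanSpace ℝ (Fin d)) (h : ∀ i, FaceC p {i}) (i : Fin n)
    (g : EuclideanSpace ℝ (Fin d) →ₗ[ℝ] ℝ) (hg : ∀ j, i ≠ j → FaceC p {i, j} → g (p j) ≤ g (p i)) :
    ∀ k, g (p k) ≤ g (p i) := by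
  by_contra hcon
  push Not at hcon
  obtain ⟨k1, hk1⟩ := hcon
  -- exposing functional
  have hnot : p i ∉ convexHull ℝ (p '' {i}ᶜ) := by
    intro hm
    obtain ⟨β, hβ, hS, he⟩ := (mem_hull_image p _ _).mp hm
    have := faceC_vertex p i (h i) β hβ he
    exact hS i (by rw [this]; simp) rfl
  have hcl : IsClosed (convexHull ℝ (p '' {i}ᶜ)) :=
    ((Set.toFinite (p '' {i}ᶜ)).isCompact_convexHull (𝕜 := ℝ)).isClosed
  obtain ⟨f0, u, hf1, hf2⟩ := geometric_hahn_banach_closed_point (convex_convexHull ℝ _) hcl hnot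
  obtain ⟨f, hf⟩ : ∃ f : EuclideanSpace ℝ (Fin d) →ₗ[ℝ] ℝ, ∀ k, k ≠ i → f (p k) < f (p i) :=
    ⟨f0, fun k hk => (hf1 _ (subset_convexHull ℝ _ ⟨k, hk, rfl⟩)).trans hf2⟩
  set G : Fin n → ℝ := fun k => g (p k) - g (p i) with hG
  set r : Fin n → EuclideanSpace ℝ (Fin d) := fun k => (G k)⁻¹ • (p k - p i) with hr
  have hGr : ∀ k, 0 < G k → G k • r k = p k - p i := fun k hk => by
    simp only [hr]; rw [smul_smul, mul_inv_cancel₀ hk.ne', one_smul]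
  have hgr : ∀ k, 0 < G k → g (r k) = 1 := fun k hk => by
    simp only [hr, map_smul, map_sub, smul_eq_mul]
    exact inv_mul_cancel₀ hk.ne'
  obtain ⟨k2, hk2, hk2m⟩ := Finset.exists_max_image (Finset.univ.filter fun k => 0 < G k) (fun k => f (r k))
    ⟨k1, by simp [hG, hk1]⟩
  obtain ⟨k0, hk0, hk0m⟩ := Finset.exists_max_image (Finset.univ.filter fun k => 0 < G k ∧ f (r k) = f (r k2))
    (fun k => ‖r k‖) ⟨k2, by simpa using hk2⟩
  simp only [Finset.mem_filter, Finset.mem_univ, true_and] at hk2 hk2m hk0 hk0m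
  have hG0 : 0 < G k0 := hk0.1
  have hiG : G i = 0 := by simp [hG]
  have hk0i : i ≠ k0 := by rintro rfl; linarith
  have hfr : ∀ k, 0 < G k → f (p k) - f (p i) = G k * f (r k) := fun k hk => by
    rw [← smul_eq_mul, ← map_smul, hGr k hk, map_sub]
  have hneg : f (r k2) < 0 := by
    have h1 := hfr k0 hG0
    have h2 := hf k0 hk0i.symm
    rw [hk0.2] at h1
    by_contra hc
    have := mul_nonneg hG0.le (not_lt.mp hc)
    linarith
  set ψ : EuclideanSpace ℝ (Fin d) →ₗ[ℝ] ℝ := f - f (r k2) • g with hψ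
  have hψd : ∀ k, ψ (p k) - ψ (p i) = (f (p k) - f (p i)) - f (r k2) * G k := fun k => by
    simp [hψ, hG]; ring
  have hψle : ∀ k, ψ (p k) ≤ ψ (p i) := by
    intro k
    have h1 := hψd k
    by_cases hk : 0 < G k
    · rw [hfr k hk] at h1
      have h2 := mul_le_mul_of_nonneg_left (hk2m k hk) hk.le
      linarith
    · by_cases hki : k = i
      · rw [hki]
      · have h2 := hf k hki
        have h3 := mul_nonneg_of_nonpos_of_nonpos hneg.le (not_lt.mp hk)
        linarith
  have hψeq : ∀ k, k ≠ i → ψ (p k) = ψ (p i) → 0 < G k ∧ f (r k) = f (r k2) := by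
    intro k hki he
    have h1 := hψd k
    rw [he, sub_self] at h1
    by_cases hk : 0 < G k
    · refine ⟨hk, ?_⟩
      rw [hfr k hk] at h1
      have : G k * (f (r k) - f (r k2)) = 0 := by linarith
      have := (mul_eq_zero.mp this).resolve_left hk.ne'
      linarith
    · exfalso
      have h2 := hf k hki
      have h3 := mul_nonneg_of_nonpos_of_nonpos hneg.le (not_lt.mp hk)
      linarith
  have hface : FaceC p {i, k0} := by
    intro α hα β hβ hS he k hk
    by_cases hki : k = i
    · left; exact hki
    right
    have hψ0 : ψ (p k0) = ψ (p i) := by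
      have h1 := hψd k0
      rw [hfr k0 hG0, hk0.2] at h1
      linarith
    have hsup := argmax_face p ψ α hα β hβ (fun j hj => by
      rcases hS j hj with rfl | hj
      · exact hψle
      · rw [mem_singleton_iff] at hj
        subst hj
        intro j; rw [hψ0]; exact hψle j) he
    have hM : ∀ j, j ≠ i → α j ≠ 0 → 0 < G j ∧ f (r j) = f (r k2) := fun j hj hαj =>
      hψeq j hj (le_antisymm (hψle j) (hsup j hαj i))
    have hterm : ∀ j, α j • (p j - p i) = (α j * G j) • r j := by
      intro j
      by_cases hj : j = i
      · subst hj; simp [hiG]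
      by_cases h0 : α j = 0
      · simp [h0]
      · rw [mul_smul, hGr j (hM j hj h0).1]
    have hw0 : ∀ j, 0 ≤ α j * G j := by
      intro j
      by_cases hj : j = i
      · subst hj; simp [hiG]
      by_cases h0 : α j = 0
      · simp [h0]
      · exact mul_nonneg (hα.1 j) (hM j hj h0).1.le
    have hsub : ∀ γ ∈ stdSimplex ℝ (Fin n), ∑ j, γ j • (p j - p i) = ∑ j, γ j • p j - p i := by
      intro γ hγ
      simp_rw [smul_sub, Finset.sum_sub_distrib, ← Finset.sum_smul, hγ.2, one_smul]
    have hs1 : ∑ j, (α j * G j) • r j = (β k0 * G k0) • r k0 := by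
      simp_rw [← hterm]
      rw [hsub α hα, he, ← hsub β hβ, mul_smul, hGr k0 hG0]
      refine Finset.sum_eq_single k0 (fun j _ hj => ?_) (by simp)
      by_cases hβj : β j = 0
      · simp [hβj]
      · rcases hS j hβj with rfl | hj'
        · simp
        · exact absurd hj' hj
    have hs2 : ∑ j, α j * G j = β k0 * G k0 := by
      have h1 := congrArg g hs1
      simp only [map_sum, map_smul, smul_eq_mul, hgr k0 hG0, mul_one] at h1
      rw [← h1]
      refine Finset.sum_congr rfl fun j _ => ?_
      by_cases hj : j = i
      · subst hj; simp [hiG]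
      by_cases h0 : α j = 0
      · simp [h0]
      · rw [hgr j (hM j hj h0).1, mul_one]
    have hs3 : ∑ j, (α j * G j) * (‖r k0‖ ^ 2 - inner ℝ (r j) (r k0)) = 0 := by
      have h1 := congrArg (fun v => (inner ℝ v (r k0) : ℝ)) hs1
      simp only [sum_inner, inner_smul_left, conj_trivial, real_inner_self_eq_norm_sq] at h1
      simp_rw [mul_sub, Finset.sum_sub_distrib, ← Finset.sum_mul, h1, hs2, sub_self]
    have hnn : ∀ j, 0 ≤ (α j * G j) * (‖r k0‖ ^ 2 - inner ℝ (r j) (r k0)) := by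
      intro j
      by_cases hj : j = i
      · subst hj; simp [hiG]
      by_cases h0 : α j = 0
      · simp [h0]
      · refine mul_nonneg (hw0 j) ?_
        have h1 := real_inner_le_norm (r j) (r k0)
        have h2 := hk0m j (hM j hj h0)
        have := norm_nonneg (r k0)
        nlinarith
    have hz := (Finset.sum_eq_zero_iff_of_nonneg fun j _ => hnn j).mp hs3 k (Finset.mem_univ k)
    have hkM := hM k hki hk
    have hin := (mul_eq_zero.mp hz).resolve_left (mul_ne_zero hk hkM.1.ne')
    have hrr : r k = r k0 := by
      have h2 := hk0m k hkM
      have h3 := norm_sub_sq_real (r k) (r k0)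
      have h4 : ‖r k‖ ^ 2 ≤ ‖r k0‖ ^ 2 := by gcongr
      have h5 : ‖r k - r k0‖ ^ 2 ≤ 0 := by linarith
      have h6 : ‖r k - r k0‖ = 0 := by
        have := norm_nonneg (r k - r k0)
        nlinarith
      exact sub_eq_zero.mp (norm_eq_zero.mp h6)
    by_contra hkk
    refine faceC_nocol p h i k0 k hk0i hki hkk (G k * (G k0)⁻¹) ?_
    have h1 := hGr k hkM.1
    have h2 := hGr k0 hG0
    rw [← neg_sub (p k), ← neg_sub (p k0), ← h1, ← h2, hrr, smul_neg, smul_smul, h2]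
  have := hg k0 hk0i hface
  have h2 : 0 < g (p k0) - g (p i) := hG0
  linarith

theorem int_absorb (Q : Set (EuclideanSpace ℝ (Fin d))) (h0 : (0 : EuclideanSpace ℝ (Fin d)) ∈ interior Q)
    (x : EuclideanSpace ℝ (Fin d)) : ∃ s : ℝ, 0 < s ∧ s • x ∈ Q := by
  have h1 : Q ∈ 𝓝 ((0:ℝ) • x) := by rw [zero_smul]; exact mem_interior_iff_mem_nhds.mp h0
  have h2 : Tendsto (fun s : ℝ => s • x) (𝓝[>] 0) (𝓝 ((0:ℝ) • x)) :=
    ((continuous_id.smul continuous_const).tendsto 0).mono_left nhdsWithin_le_nhds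
  obtain ⟨s, hs, hs'⟩ := ((h2.eventually h1).and self_mem_nhdsWithin).exists
  exact ⟨s, hs', hs⟩

theorem exists_factor (p q : Fin n → EuclideanSpace ℝ (Fin d))
    (hrel : ∀ t : Fin n → ℝ, ∑ i, t i • p i = 0 → ∑ i, t i • q i = 0)
    (hq : ∀ x, ∃ t : Fin n → ℝ, ∑ i, t i • q i = x) :
    (∀ x, ∃ t : Fin n → ℝ, ∑ i, t i • p i = x) ∧
      ∃ W : EuclideanSpace ℝ (Fin d) →ₗ[ℝ] EuclideanSpace ℝ (Fin d), ∀ i, W (p i) = q i := by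
  let Lp := Fintype.linearCombination ℝ p
  let Lq := Fintype.linearCombination ℝ q
  have hLp : ∀ t, Lp t = ∑ i, t i • p i := fun t => Fintype.linearCombination_apply ℝ p t
  have hLq : ∀ t, Lq t = ∑ i, t i • q i := fun t => Fintype.linearCombination_apply ℝ q t
  have hker : LinearMap.ker Lp ≤ LinearMap.ker Lq := fun t ht => by
    rw [LinearMap.mem_ker, hLq]
    rw [LinearMap.mem_ker, hLp] at ht
    exact hrel t ht
  have hqs : Function.Surjective Lq := fun x => by
    obtain ⟨t, ht⟩ := hq x
    exact ⟨t, (hLq t).trans ht⟩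
  have hps : Function.Surjective Lp := by
    rw [← LinearMap.range_eq_top]
    apply Submodule.eq_top_of_finrank_eq
    have h1 := LinearMap.finrank_range_add_finrank_ker Lp
    have h2 := LinearMap.finrank_range_add_finrank_ker Lq
    have h3 := Submodule.finrank_mono hker
    rw [LinearMap.range_eq_top.mpr hqs, finrank_top] at h2
    have h4 := Submodule.finrank_le (LinearMap.range Lp)
    omega
  refine ⟨fun x => ?_, ?_⟩
  · obtain ⟨t, ht⟩ := hps x
    exact ⟨t, (hLp t).symm.trans ht⟩
  · obtain ⟨s, hs⟩ := Lp.exists_rightInverse_of_surjective (LinearMap.range_eq_top.mpr hps)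
    refine ⟨Lq ∘ₗ s, fun i => ?_⟩
    have h1 : Lp (s (p i)) = p i := congrArg (fun f => f (p i)) hs
    have h2 : Lp (Pi.single i 1) = p i := by rw [hLp, sum_single_smul]
    have h3 : s (p i) - Pi.single i 1 ∈ LinearMap.ker Lq := hker (by
      rw [LinearMap.mem_ker, map_sub, h1, h2, sub_self])
    rw [LinearMap.mem_ker, map_sub, sub_eq_zero] at h3
    rw [LinearMap.comp_apply, h3, hLq, sum_single_smul]

theorem rigid_of_rel (p q : Fin n → EuclideanSpace ℝ (Fin d)) (hp : ∀ i, FaceC p {i})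
    (h1 : ∀ i j, i ≠ j → FaceC p {i, j} → ‖q i - q j‖ = ‖p i - p j‖) (h2 : ∀ i, ‖q i‖ = ‖p i‖)
    (hrel : ∀ t : Fin n → ℝ, ∑ i, t i • p i = 0 → ∑ i, t i • q i = 0)
    (hq : ∀ x, ∃ t : Fin n → ℝ, ∑ i, t i • q i = x) :
    ∃ T : EuclideanSpace ℝ (Fin d) ≃ₗᵢ[ℝ] EuclideanSpace ℝ (Fin d), ∀ i, T (p i) = q i := by
  obtain ⟨hps, W, hW⟩ := exists_factor p q hrel hq
  have hgram : ∀ i k, (inner ℝ (q i) (q k) : ℝ) = inner ℝ (p i) (p k) := by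
    intro i k
    let g : EuclideanSpace ℝ (Fin d) →ₗ[ℝ] ℝ :=
      (innerₛₗ ℝ (q i)) ∘ₗ W - innerₛₗ ℝ (p i)
    have hg : ∀ j, g (p j) = inner ℝ (q i) (q j) - inner ℝ (p i) (p j) := fun j => by
      simp [g, hW]
    have hgi : g (p i) = 0 := by
      rw [hg, real_inner_self_eq_norm_sq, real_inner_self_eq_norm_sq, h2, sub_self]
    have hgj : ∀ j, i ≠ j → FaceC p {i, j} → g (p j) = 0 := by
      intro j hij hf
      have e := h1 i j hij hf
      have e1 := norm_sub_sq_real (q i) (q j)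
      have e2 := norm_sub_sq_real (p i) (p j)
      rw [e, h2, h2] at e1
      rw [hg]
      linarith
    have a1 := simplex_lemma p hp i g (fun j hij hf => by rw [hgj j hij hf, hgi]) k
    have a2 := simplex_lemma p hp i (-g) (fun j hij hf => by
      rw [LinearMap.neg_apply, LinearMap.neg_apply, hgj j hij hf, hgi]) k
    rw [LinearMap.neg_apply, LinearMap.neg_apply] at a2
    have := hg k
    linarith
  have hiso : ∀ x, ‖W x‖ = ‖x‖ := by
    intro x
    obtain ⟨t, rfl⟩ := hps x
    have : ‖W (∑ i, t i • p i)‖ ^ 2 = ‖∑ i, t i • p i‖ ^ 2 := by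
      rw [← real_inner_self_eq_norm_sq, ← real_inner_self_eq_norm_sq]
      simp only [map_sum, map_smul, hW, sum_inner, inner_sum, inner_smul_left, inner_smul_right, hgram]
    exact (sq_eq_sq₀ (norm_nonneg _) (norm_nonneg _)).mp this
  let T0 : EuclideanSpace ℝ (Fin d) →ₗᵢ[ℝ] EuclideanSpace ℝ (Fin d) := ⟨W, hiso⟩
  exact ⟨T0.toLinearIsometryEquiv rfl, fun i => by
    rw [LinearIsometry.coe_toLinearIsometryEquiv]; exact hW i⟩

end simplexstep


section final
open Set Filter Topology

theorem span_setup {n d : ℕ} (p : Fin n → EuclideanSpace ℝ (Fin d)) (i0 i1 : Fin n) (h01 : p i0 ≠ p i1) :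
    ∃ (m : ℕ) (a : Fin n → EuclideanSpace ℝ (Fin (m + 1))) (c : EuclideanSpace ℝ (Fin d))
      (f : EuclideanSpace ℝ (Fin (m + 1)) →ₗᵢ[ℝ] EuclideanSpace ℝ (Fin d)),
      (∀ i, p i = c + f (a i)) ∧ (∀ i, ‖p i‖ ^ 2 = ‖a i‖ ^ 2 + ‖c‖ ^ 2) ∧
      ∀ z : EuclideanSpace ℝ (Fin (m + 1)), z ≠ 0 → ∃ i j, (inner ℝ z (a i) : ℝ) ≠ inner ℝ z (a j) := by
  obtain ⟨V, hV⟩ : ∃ V, V = vectorSpan ℝ (range p) := ⟨_, rfl⟩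
  have hdiff : ∀ i j, p i - p j ∈ V := fun i j => by
    rw [hV]
    exact vsub_mem_vectorSpan ℝ ⟨i, rfl⟩ ⟨j, rfl⟩
  have hfr : Module.finrank ℝ V ≠ 0 := by
    intro h0
    rw [Submodule.finrank_eq_zero] at h0
    have := hdiff i0 i1
    rw [h0, Submodule.mem_bot] at this
    exact h01 (sub_eq_zero.mp this)
  obtain ⟨m, hm⟩ := Nat.exists_eq_succ_of_ne_zero hfr
  let b := (stdOrthonormalBasis ℝ V).reindex (finCongr hm)
  let e : V ≃ₗᵢ[ℝ] EuclideanSpace ℝ (Fin (m + 1)) := b.repr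
  obtain ⟨c, hc⟩ : ∃ c, c = p i0 - V.starProjection (p i0) := ⟨_, rfl⟩
  have hcV : c ∈ Vᗮ := by rw [hc]; exact V.sub_starProjection_mem_orthogonal (p i0)
  have hmem : ∀ i, p i - c ∈ V := by
    intro i
    have : p i - c = (p i - p i0) + V.starProjection (p i0) := by rw [hc]; abel
    rw [this]
    exact V.add_mem (hdiff i i0) (V.starProjection_apply_mem _)
  let a : Fin n → EuclideanSpace ℝ (Fin (m + 1)) := fun i => e ⟨p i - c, hmem i⟩
  let f : EuclideanSpace ℝ (Fin (m + 1)) →ₗᵢ[ℝ] EuclideanSpace ℝ (Fin d) :=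
    V.subtypeₗᵢ.comp e.symm.toLinearIsometry
  have hfa : ∀ i, f (a i) = p i - c := fun i => by simp [f, a]
  have hfV : ∀ z, f z ∈ V := fun z => (e.symm z).2
  refine ⟨m, a, c, f, fun i => by rw [hfa]; abel, fun i => ?_, fun z hz => ?_⟩
  · have h1 : p i = f (a i) + c := by rw [hfa]; abel
    have h2 : (inner ℝ (f (a i)) c : ℝ) = 0 := hcV _ (hfV _)
    rw [h1, norm_add_sq_real, h2, f.norm_map]
    ring
  · by_contra hcon
    push Not at hcon
    have h1 : V ≤ (ℝ ∙ f z)ᗮ := by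
      rw [hV, vectorSpan_def, Submodule.span_le]
      rintro _ ⟨_, ⟨i, rfl⟩, _, ⟨j, rfl⟩, rfl⟩
      rw [SetLike.mem_coe, Submodule.mem_orthogonal_singleton_iff_inner_right]
      have h2 : p i -ᵥ p j = f (a i - a j) := by
        rw [map_sub, hfa, hfa, vsub_eq_sub]; abel
      change (inner ℝ (f z) (p i -ᵥ p j) : ℝ) = 0
      rw [h2, f.inner_map_map, inner_sub_right, hcon i j, sub_self]
    have h2 := h1 (hfV z)
    rw [Submodule.mem_orthogonal_singleton_iff_inner_right, f.inner_map_map, inner_self_eq_zero] at h2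
    exact hz h2

theorem main_abs {n d : ℕ} (p q : Fin n → EuclideanSpace ℝ (Fin d)) (hface : ∀ S, FaceC p S ↔ FaceC q S)
    (hp : ∀ i, FaceC p {i}) (h0 : (0 : EuclideanSpace ℝ (Fin d)) ∈ interior (convexHull ℝ (range q)))
    (h1 : ∀ i j, i ≠ j → FaceC p {i, j} → ‖q i - q j‖ = ‖p i - p j‖) (h2 : ∀ i, ‖q i‖ = ‖p i‖) :
    ∃ T : EuclideanSpace ℝ (Fin d) ≃ₗᵢ[ℝ] EuclideanSpace ℝ (Fin d), ∀ i, T (p i) = q i := by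
  have habs := int_absorb _ h0
  obtain ⟨β0, hβ0, hβz⟩ := (mem_hull_range q 0).mp (interior_subset h0)
  have hn : n ≠ 0 := by
    rintro rfl
    have := hβ0.2
    simp at this
  haveI : NeZero n := ⟨hn⟩
  by_cases hn1 : ∃ i1 : Fin n, i1 ≠ 0
  swap
  · push Not at hn1
    refine ⟨LinearIsometryEquiv.refl ℝ _, fun i => ?_⟩
    have e1 : ∑ j, β0 j • q j = q 0 := by
      have : ∀ j, β0 j • q j = β0 j • q 0 := fun j => by rw [hn1 j]
      simp_rw [this, ← Finset.sum_smul, hβ0.2, one_smul]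
    have e2 : q 0 = 0 := e1.symm.trans hβz
    have e3 : p 0 = 0 := by
      have := h2 0
      rw [e2, norm_zero] at this
      exact norm_eq_zero.mp this.symm
    rw [hn1 i, e2, e3]; simp
  obtain ⟨i1, hi1⟩ := hn1
  have hpinj := faceC_inj p hp
  obtain ⟨m, a, c, f, hpa, hnorm, hspan⟩ := span_setup p i1 0 (fun h => hi1 (hpinj h))
  have hfa : ∀ S, FaceC p S ↔ FaceC a S := fun S => faceC_map p a c f.toLinearMap f.injective hpa S
  have ha : ∀ i, FaceC a {i} := fun i => (hfa _).mp (hp i)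
  have hdist : ∀ i j, ‖p i - p j‖ = ‖a i - a j‖ := by
    intro i j
    rw [hpa i, hpa j, add_sub_add_left_eq_sub, ← map_sub, f.norm_map]
  have hqs : ∀ x, ∃ t : Fin n → ℝ, ∑ i, t i • q i = x := by
    intro x
    obtain ⟨s, hs, hx⟩ := habs x
    obtain ⟨β, hβ, he⟩ := (mem_hull_range q _).mp hx
    refine ⟨fun i => s⁻¹ * β i, ?_⟩
    simp_rw [mul_smul, ← Finset.smul_sum, he]
    rw [smul_smul, inv_mul_cancel₀ hs.ne', one_smul]
  have hF : ∀ u : EuclideanSpace ℝ (Fin d), u ≠ 0 → ∃ i, 0 < (inner ℝ u (q i) : ℝ) := by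
    intro u hu
    obtain ⟨s, hs, hx⟩ := habs u
    obtain ⟨β, hβ, he⟩ := (mem_hull_range q _).mp hx
    by_contra hcon
    push Not at hcon
    have e1 := congrArg (fun v => (inner ℝ u v : ℝ)) he
    simp only [inner_sum, inner_smul_right, real_inner_self_eq_norm_sq] at e1
    have e2 : ∑ i, β i * (inner ℝ u (q i) : ℝ) ≤ 0 :=
      Finset.sum_nonpos fun i _ => mul_nonpos_of_nonneg_of_nonpos (hβ.1 i) (hcon i)
    have e3 : 0 < s * ‖u‖ ^ 2 := by
      have := norm_pos_iff.mpr hu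
      positivity
    linarith
  -- a fully supported representation of the origin
  obtain ⟨γ, hγ, hγpos, hγ0⟩ : ∃ γ ∈ stdSimplex ℝ (Fin n), (∀ i, γ i ≠ 0) ∧ ∑ i, γ i • q i = 0 := by
    obtain ⟨s, hs, hx⟩ := habs (-(∑ i, q i))
    obtain ⟨β, hβ, he⟩ := (mem_hull_range q _).mp hx
    have hD : 0 < 1 + s * n := by positivity
    refine ⟨fun i => (1 + s * n)⁻¹ * (β i + s), ⟨fun i => ?_, ?_⟩, fun i => ?_, ?_⟩
    · have := hβ.1 i
      positivity
    · rw [← Finset.mul_sum, Finset.sum_add_distrib, hβ.2]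
      simp only [Finset.sum_const, Finset.card_univ, Fintype.card_fin, nsmul_eq_mul]
      rw [mul_comm (n : ℝ) s, inv_mul_cancel₀ hD.ne']
    · have := hβ.1 i
      positivity
    · simp_rw [mul_smul, ← Finset.smul_sum, add_smul, Finset.sum_add_distrib, ← Finset.smul_sum, he]
      simp
  have hcore := analytic_core a q (‖c‖ ^ 2) (sq_nonneg _) (fun i => by rw [h2, hnorm]) hspan ?_ ?_ hF ?_
    (fun i j k hij hki hkj t => faceC_nocol a ha i j k hij hki hkj t) (faceC_inj a ha) ?_
  · obtain ⟨hc, hrel⟩ := hcore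
    have hc0 : c = 0 := norm_eq_zero.mp (pow_eq_zero_iff two_ne_zero |>.mp hc)
    refine rigid_of_rel p q hp h1 h2 (fun t ht => hrel t ?_) hqs
    apply f.injective
    rw [map_zero, ← ht, map_sum]
    exact Finset.sum_congr rfl fun i _ => by rw [hpa, hc0, zero_add, map_smul]
  · intro α hα hαq z hz
    by_contra hcon
    push Not at hcon
    have hle : ∀ i, (inner ℝ z (a i) : ℝ) ≤ ∑ r, α r * inner ℝ z (a r) := by
      intro i
      have := hcon i
      rw [inner_sub_right, inner_sum] at this
      simp only [inner_smul_right] at this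
      linarith
    have hS := argmax_face a (innerₛₗ ℝ z)
    simp only [innerₛₗ_apply_apply] at hS
    have hSq := (hface _).mp ((hfa _).mpr hS)
    have hsupp : ∀ i, α i ≠ 0 → i ∈ {i | ∀ j, (inner ℝ z (a j) : ℝ) ≤ inner ℝ z (a i)} := by
      intro i hi j
      have e1 : ∑ s, α s * ((∑ r, α r * inner ℝ z (a r)) - inner ℝ z (a s)) = 0 := by
        simp_rw [mul_sub, Finset.sum_sub_distrib, ← Finset.sum_mul, hα.2]
        ring
      have e2 := (Finset.sum_eq_zero_iff_of_nonneg fun s _ => mul_nonneg (hα.1 s)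
        (sub_nonneg.mpr (hle s))).mp e1 i (Finset.mem_univ i)
      have e3 := (mul_eq_zero.mp e2).resolve_left hi
      linarith [hle j]
    have hall := hSq γ hγ α hα hsupp (by rw [hγ0, hαq])
    obtain ⟨i, j, hij⟩ := hspan z hz
    exact hij (le_antisymm (hall j (hγpos j) i) (hall i (hγpos i) j))
  · intro u α hα β hβ hmax he
    have hS := argmax_face q (innerₛₗ ℝ u)
    simp only [innerₛₗ_apply_apply] at hS
    have hSa := (hfa _).mp ((hface _).mpr hS)
    have hsupp := hSa α hα β hβ (fun i hi j => by
      have e1 := hmax i j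
      have e2 : 0 < β i := (hβ.1 i).lt_of_ne' hi
      by_contra hc
      have := mul_pos e2 (sub_pos.mpr (not_le.mp hc))
      linarith) he
    intro i j
    by_cases hi : α i = 0
    · simp [hi]
    · exact mul_nonpos_of_nonneg_of_nonpos (hα.1 i) (sub_nonpos.mpr (hsupp i hi j))
  · intro i j hij
    by_cases hf : FaceC a {i, j}
    · left
      rw [h1 i j hij ((hfa _).mpr hf), hdist]
    · exact Or.inr (faceC_nonedge a i j hij hf)
  · intro i α hα0 hα1 he
    rw [faceC_vertex a i (ha i) α ⟨hα0, hα1⟩ he, sum_single_smul]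

end final


theorem reconstruction_from_face_lattice {n d : ℕ}
    (p q : Fin n → EuclideanSpace ℝ (Fin d))
    (hpinj : Function.Injective p) (hqinj : Function.Injective q)
    (hpvert : Set.range p = Set.extremePoints ℝ (convexHull ℝ (Set.range p)))
    (hqvert : Set.range q = Set.extremePoints ℝ (convexHull ℝ (Set.range q)))
    (hcomb : CombEquiv p q)
    (h0 : (0 : EuclideanSpace ℝ (Fin d)) ∈ interior (convexHull ℝ (Set.range q)))
    (h1 : ∀ i j, IsEdge p i j → ‖q i - q j‖ = ‖p i - p j‖)
    (h2 : ∀ i, ‖q i‖ = ‖p i‖) :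
    ∃ T : EuclideanSpace ℝ (Fin d) ≃ₗᵢ[ℝ] EuclideanSpace ℝ (Fin d),
      ∀ i, T (p i) = q i := by
  refine main_abs p q (fun S => ?_) (faceC_single p hpinj hpvert) h0 (fun i j hij hf => h1 i j ⟨hij, ?_⟩) h2
  · rw [← faceC_iff p hpinj hpvert, ← faceC_iff q hqinj hqvert]
    exact hcomb S
  · have := (faceC_iff p hpinj hpvert _).mpr hf
    rwa [Set.image_pair, convexHull_pair] at this
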